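/- The crossing number of the complete 4-partite graph K_{1,1,4,4} equals 24. -/

import Mathlib

open SimpleGraph

variable {V : Type*}

/-- A drawing of a simple graph in the plane: an injective placement of the
vertices in `ℝ²` together with, for each edge, a continuous arc joining the
positions of its endpoints (parametrised compatibly in both directions),
such that no arc passes through the position of a vertex other than its
endpoints. -/
structure Drawing (G : SimpleGraph V) where
  pos : V → ℝ × ℝ
  pos_inj : Function.Injective pos
  arc : V → V → ℝ → ℝ × ℝ
  arc_cont : ∀ ⦃a b⦄, G.Adj a b → ContinuousOn (arc a b) (Set.Icc 0 1)
  arc_zero : ∀ ⦃a b⦄, G.Adj a b → arc a b 0 = pos a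
  arc_one : ∀ ⦃a b⦄, G.Adj a b → arc a b 1 = pos b
  arc_symm : ∀ ⦃a b⦄, G.Adj a b → ∀ t, arc b a t = arc a b (1 - t)
  arc_avoid : ∀ ⦃a b⦄, G.Adj a b → ∀ c, c ≠ a → c ≠ b →
      pos c ∉ arc a b '' Set.Icc 0 1

namespace Drawing

variable {G : SimpleGraph V} (D : Drawing G)

/-- The set of points of the plane used by the edge `e`. -/
def edgePoints (e : Sym2 V) : Set (ℝ × ℝ) :=
  {p | ∃ a b, e = s(a, b) ∧ G.Adj a b ∧ p ∈ D.arc a b '' Set.Icc 0 1}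

/-- The positions of the endpoints of an edge. -/
def ends (e : Sym2 V) : Set (ℝ × ℝ) := {p | ∃ a ∈ e, p = D.pos a}

/-- `p` is a crossing of the (distinct) edges `e` and `f` in the drawing `D`:
a common point of the two edges other than an endpoint. -/
def IsCrossing (e f : Sym2 V) (p : ℝ × ℝ) : Prop :=
  e ∈ G.edgeSet ∧ f ∈ G.edgeSet ∧ e ≠ f ∧
    p ∈ D.edgePoints e ∧ p ∈ D.edgePoints f ∧ p ∉ D.ends e ∧ p ∉ D.ends f

/-- The crossings between an edge of `A` and an edge of `B`: a crossing is
recorded as a point of the plane together with the unordered pair of edges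
crossing there. -/
def crossings (A B : Set (Sym2 V)) : Set ((ℝ × ℝ) × Sym2 (Sym2 V)) :=
  {q | ∃ e f, q.2 = s(e, f) ∧ e ∈ A ∧ f ∈ B ∧ D.IsCrossing e f q.1}

/-- `cr_D(A, B)`: the number of crossings between an edge of `A` and an
edge of `B`. -/
noncomputable def crBetween (A B : Set (Sym2 V)) : ℕ := Nat.card (D.crossings A B)

/-- `cr(D)`: the total number of crossings of the drawing `D`. -/
noncomputable def crNum : ℕ := D.crBetween G.edgeSet G.edgeSet

/-- A good drawing: no edge crosses itself (each arc is a simple arc),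
no two adjacent edges cross, no two edges cross more than once, and no three
edges cross at a common point. -/
structure IsGood : Prop where
  arc_inj : ∀ ⦃a b⦄, G.Adj a b → Set.InjOn (D.arc a b) (Set.Icc 0 1)
  adj_no_cross : ∀ e f : Sym2 V, (∃ a, a ∈ e ∧ a ∈ f) → ∀ p, ¬ D.IsCrossing e f p
  cross_once : ∀ e f : Sym2 V, {p | D.IsCrossing e f p}.Subsingleton
  no_triple : ∀ p, ∀ e f g : Sym2 V, e ≠ f → e ≠ g → f ≠ g →
      ¬ (D.IsCrossing e f p ∧ D.IsCrossing f g p ∧ D.IsCrossing e g p)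

end Drawing

/-- The crossing number of a graph: the minimum number of crossings among
all good drawings of `G` in the plane. -/
noncomputable def crossingNumber (G : SimpleGraph V) : ℕ :=
  sInf {n | ∃ D : Drawing G, D.IsGood ∧ D.crNum = n}

/-- The Zarankiewicz function `Z(m,n) = ⌊m/2⌋⌊(m-1)/2⌋⌊n/2⌋⌊(n-1)/2⌋`. -/
def Z (m n : ℕ) : ℕ := m / 2 * ((m - 1) / 2) * (n / 2) * ((n - 1) / 2)

/-- The complete bipartite graph `K_{a,b}`. -/
abbrev bipK (a b : ℕ) : SimpleGraph (Fin a ⊕ Fin b) :=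
  completeBipartiteGraph (Fin a) (Fin b)

/-- The complete tripartite graph `K_{a,b,c}`. -/
abbrev triK (a b c : ℕ) : SimpleGraph (Σ i : Fin 3, ![Fin a, Fin b, Fin c] i) :=
  completeMultipartiteGraph ![Fin a, Fin b, Fin c]

/-- The complete 4-partite graph `K_{a,b,c,d}`. -/
abbrev quadK (a b c d : ℕ) : SimpleGraph (Σ i : Fin 4, ![Fin a, Fin b, Fin c, Fin d] i) :=
  completeMultipartiteGraph ![Fin a, Fin b, Fin c, Fin d]

/-- `E(V₁, V₂)`: the set of pairs `{v₁, v₂}` with `v₁ ∈ V₁` and `v₂ ∈ V₂`. -/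
def pairEdges {α : Type*} (V₁ V₂ : Set α) : Set (Sym2 α) :=
  {e | ∃ a ∈ V₁, ∃ b ∈ V₂, e = s(a, b)}

namespace K1142


/-- table lookup: the `k`-th hexadecimal digit of `t` -/
def tlook (t k : ℕ) : ℕ := Nat.land (Nat.shiftRight t (Nat.mul 4 k)) 15
def tsig (q : ℕ) : ℕ := Nat.land (Nat.shiftRight 13624344767681711970654858505943237250042093458661624035034851918395574845441 (Nat.mul 8 q)) 31
def tW0 : ℕ := 42623912332505111997840613340873822496
def tW1 : ℕ := 85247824823471375282754836094370587200
def tA : ℕ := 79228167236631101938182651904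
def tD : ℕ := 24014717856177456468622551215127920640
def tN0 : ℕ := 112004398439102515831086157106144944400
def tN1 : ℕ := 133355448912573164518984171690099028256
def pidx (s p q : ℕ) : ℕ := Nat.xor p (Nat.xor (tsig q) s)
def all32 : List ℕ := [0,1,2,3,4,5,6,7,8,9,10,11,12,13,14,15,16,17,18,19,20,21,22,23,24,25,26,27,28,29,30,31]

/-- evaluate a natural number before passing it on -/
def force (n : ℕ) (k : ℕ → Bool) : Bool := Nat.rec (k 0) (fun m _ => k (Nat.succ m)) n

def lall (l : List ℕ) (k : ℕ → Bool) : Bool := List.rec true (fun a _ r => cond (k a) r false) l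

def enum4 (W N cut : ℕ) (s e : ℕ) (leaf : ℕ → ℕ → ℕ → ℕ → Bool) : Bool :=
  lall all32 fun a => force (Nat.add e (tlook N a)) fun t1 => cond (Nat.ble cut t1) true <|
  lall all32 fun b => force (Nat.add t1 (Nat.add (tlook N b) (tlook W (pidx s a b)))) fun t2 =>
    cond (Nat.ble cut t2) true <|
  lall all32 fun c => force (Nat.add t2 (Nat.add (tlook N c) (Nat.add (tlook W (pidx s a c))
    (tlook W (pidx s b c))))) fun t3 => cond (Nat.ble cut t3) true <|
  lall all32 fun d => cond (Nat.ble cut (Nat.add t3 (Nat.add (tlook N d) (Nat.add (tlook W (pidx s a d))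
    (Nat.add (tlook W (pidx s b d)) (tlook W (pidx s c d))))))) true (leaf a b c d)

def sum6 (t s a b c d : ℕ) : ℕ := tlook t (pidx s a b) + tlook t (pidx s a c) + tlook t (pidx s a d) +
  tlook t (pidx s b c) + tlook t (pidx s b d) + tlook t (pidx s c d)

def leaf0 (s e a b c d : ℕ) : Bool :=
  let tot := e + tlook tN0 a + tlook tN0 b + tlook tN0 c + tlook tN0 d + sum6 tW0 s a b c d
  let A := sum6 tA s a b c d
  let G := a % 2 + b % 2 + c % 2 + d % 2
  let N := tlook tN0 a + tlook tN0 b + tlook tN0 c + tlook tN0 d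
  Nat.beq tot 6 && (Nat.ble 4 (e + A) || (Nat.beq e 0 && Nat.beq A 0 && Nat.beq N G) ||
    (Nat.beq A 2 && Nat.beq (sum6 tW0 s a b c d) 2 && Nat.ble 2 (sum6 tD s a b c d)))

theorem enum0 : (enum4 tW0 tN0 7 0 0 (leaf0 0 0) && enum4 tW0 tN0 7 25 1 (leaf0 25 1) &&
  enum4 tW0 tN0 7 7 1 (leaf0 7 1) && enum4 tW0 tN0 7 30 2 (leaf0 30 2)) = true := by decide +kernel
theorem enum1 : (enum4 tW1 tN1 12 0 0 (fun _ _ _ _ => false) && enum4 tW1 tN1 12 25 1 (fun _ _ _ _ => false) &&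
  enum4 tW1 tN1 12 7 1 (fun _ _ _ _ => false) && enum4 tW1 tN1 12 30 2 (fun _ _ _ _ => false)) = true := by decide +kernel

/-! ### Parity systems -/

/-- order correction term -/
def kap {k : ℕ} (u v w z : Fin k) : ZMod 2 :=
  (if v < w then 1 else 0) + (if w < u then 1 else 0) + (if z < v then 1 else 0) +
    (if u < z then 1 else 0)

/-- the parity of the crossing of `uv` with `wz` in terms of winding data `n` -/
def cpar {k : ℕ} (n : Fin k → Fin k → Fin k → ZMod 2) (u v w z : Fin k) : ZMod 2 :=
  kap u v w z + n u v w + n u v z + n w z u + n w z v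

/-- abstract crossing parities of a drawing of a complete multipartite graph -/
structure XSys {m : ℕ} (col : Fin m → ℕ) (c : Fin m → Fin m → Fin m → Fin m → ℕ) : Prop where
  s1 : ∀ u v w z, c u v w z = c v u w z
  s2 : ∀ u v w z, c u v w z = c w z u v
  top : ∀ (k : ℕ) (φ : Fin k → Fin m), Function.Injective φ →
    ∃ n : Fin k → Fin k → Fin k → ZMod 2, (∀ u v w, n u v w = n v u w) ∧
      ∀ u v w z, u ≠ w → u ≠ z → v ≠ w → v ≠ z → col (φ u) ≠ col (φ v) → col (φ w) ≠ col (φ z) →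
        c (φ u) (φ v) (φ w) (φ z) = (cpar n u v w z).val

theorem XSys.comap {m k : ℕ} {col : Fin m → ℕ} {c} (h : XSys col c) (φ : Fin k → Fin m)
    (hφ : Function.Injective φ) (col' : Fin k → ℕ) (hc : ∀ i j, col' i ≠ col' j → col (φ i) ≠ col (φ j)) :
    XSys col' (fun u v w z => c (φ u) (φ v) (φ w) (φ z)) where
  s1 _ _ _ _ := h.s1 _ _ _ _
  s2 _ _ _ _ := h.s2 _ _ _ _
  top l ψ hψ := by
    obtain ⟨n, h1, h2⟩ := h.top l (φ ∘ ψ) (hφ.comp hψ)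
    exact ⟨n, h1, fun u v w z a b c d e f => h2 u v w z a b c d (hc _ _ e) (hc _ _ f)⟩

/-- crossings between the stars of `u`, `v` at the leaves `p`, `q` -/
def q2 {m : ℕ} (c : Fin m → Fin m → Fin m → Fin m → ℕ) (u v p q : Fin m) : ℕ :=
  c u p v q + c u q v p

theorem XSys.q2_swap {m : ℕ} {col : Fin m → ℕ} {c} (h : XSys col c) (u v p q : Fin m) :
    q2 c u v p q = q2 c p q u v := by
  unfold q2
  have e1 : c u p v q = c p u q v := by rw [h.s1 u p, h.s2 p u, h.s1 v q, h.s2 q v]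
  have e2 : c u q v p = c p v q u := by rw [h.s1 u q, h.s2 q u, h.s1 v p]
  rw [e1, e2]

theorem XSys.q2_comm1 {m : ℕ} {col : Fin m → ℕ} {c} (h : XSys col c) (u v p q : Fin m) :
    q2 c u v p q = q2 c v u p q := by
  unfold q2
  rw [h.s2 u p, h.s2 u q, add_comm]

theorem XSys.q2_comm2 {m : ℕ} (c : Fin m → Fin m → Fin m → Fin m → ℕ) (u v p q : Fin m) :
    q2 c u v p q = q2 c u v q p := by
  unfold q2
  rw [add_comm]

/-! ### `K_{3,3}` is odd -/

def s33 {m : ℕ} (c : Fin m → Fin m → Fin m → Fin m → ℕ) (p q r x y z : Fin m) : ℕ :=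
  (q2 c p q x y + q2 c p q x z + q2 c p q y z) + (q2 c p r x y + q2 c p r x z + q2 c p r y z) +
    (q2 c q r x y + q2 c q r x z + q2 c q r y z)

theorem zmod2_val_cast (a : ZMod 2) : ((a.val : ℕ) : ZMod 2) = a := by
  revert a; decide

theorem XSys.k33_odd {m : ℕ} {col : Fin m → ℕ} {c} (h : XSys col c) (p q r x y z : Fin m)
    (hinj : Function.Injective ![p, q, r, x, y, z])
    (hc : ∀ i ∈ [p, q, r], ∀ j ∈ [x, y, z], col i ≠ col j) :
    s33 c p q r x y z % 2 = 1 := by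
  obtain ⟨n, h1, h2⟩ := h.top 6 ![p, q, r, x, y, z] hinj
  have key : ∀ i j k l : Fin 6, (i.val < 3 ∧ j.val < 3 ∧ 3 ≤ k.val ∧ 3 ≤ l.val ∧ i ≠ j ∧ k ≠ l) →
      c (![p, q, r, x, y, z] i) (![p, q, r, x, y, z] k) (![p, q, r, x, y, z] j)
        (![p, q, r, x, y, z] l) = (cpar n i k j l).val := by
    intro i j k l ⟨hi, hj, hk, hl, hij, hkl⟩
    have hcol : ∀ i k : Fin 6, i.val < 3 → 3 ≤ k.val →
        col (![p, q, r, x, y, z] i) ≠ col (![p, q, r, x, y, z] k) := by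
      intro i k hi hk
      apply hc
      · fin_cases i <;> simp_all
      · fin_cases k <;> simp_all
    refine h2 i k j l hij ?_ ?_ hkl (hcol i k hi hk) (hcol j l hj hl)
    · rintro rfl; omega
    · rintro rfl; omega
  have hcast : ((s33 c p q r x y z : ℕ) : ZMod 2) = 1 := by
    have k0 := key 0 1 3 4 (by decide)
    have k1 := key 0 1 4 3 (by decide)
    have k2 := key 0 1 3 5 (by decide)
    have k3 := key 0 1 5 3 (by decide)
    have k4 := key 0 1 4 5 (by decide)
    have k5 := key 0 1 5 4 (by decide)
    have l0 := key 0 2 3 4 (by decide)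
    have l1 := key 0 2 4 3 (by decide)
    have l2 := key 0 2 3 5 (by decide)
    have l3 := key 0 2 5 3 (by decide)
    have l4 := key 0 2 4 5 (by decide)
    have l5 := key 0 2 5 4 (by decide)
    have m0 := key 1 2 3 4 (by decide)
    have m1 := key 1 2 4 3 (by decide)
    have m2 := key 1 2 3 5 (by decide)
    have m3 := key 1 2 5 3 (by decide)
    have m4 := key 1 2 4 5 (by decide)
    have m5 := key 1 2 5 4 (by decide)
    have e0 : (![p, q, r, x, y, z] 0) = p := rfl
    have e1 : (![p, q, r, x, y, z] 1) = q := rfl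
    have e2 : (![p, q, r, x, y, z] 2) = r := rfl
    have e3 : (![p, q, r, x, y, z] 3) = x := rfl
    have e4 : (![p, q, r, x, y, z] 4) = y := rfl
    have e5 : (![p, q, r, x, y, z] 5) = z := rfl
    simp only [e0, e1, e2, e3, e4, e5] at k0 k1 k2 k3 k4 k5 l0 l1 l2 l3 l4 l5 m0 m1 m2 m3 m4 m5
    simp only [s33, q2, k0, k1, k2, k3, k4, k5, l0, l1, l2, l3, l4, l5, m0, m1, m2, m3, m4, m5,
      Nat.cast_add, zmod2_val_cast, cpar]
    have hk : ∀ i j k l : Fin 6, (i.val < 3 ∧ j.val < 3 ∧ 3 ≤ k.val ∧ 3 ≤ l.val ∧ i < j ∧ k < l) →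
      (kap i k j l = 1 ∧ kap i l j k = 0) := by decide
    simp only [(hk 0 1 3 4 (by decide)).1, (hk 0 1 3 4 (by decide)).2,
      (hk 0 1 3 5 (by decide)).1, (hk 0 1 3 5 (by decide)).2,
      (hk 0 1 4 5 (by decide)).1, (hk 0 1 4 5 (by decide)).2,
      (hk 0 2 3 4 (by decide)).1, (hk 0 2 3 4 (by decide)).2,
      (hk 0 2 3 5 (by decide)).1, (hk 0 2 3 5 (by decide)).2,
      (hk 0 2 4 5 (by decide)).1, (hk 0 2 4 5 (by decide)).2,
      (hk 1 2 3 4 (by decide)).1, (hk 1 2 3 4 (by decide)).2,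
      (hk 1 2 3 5 (by decide)).1, (hk 1 2 3 5 (by decide)).2,
      (hk 1 2 4 5 (by decide)).1, (hk 1 2 4 5 (by decide)).2]
    ring_nf
    reduce_mod_char
  have := (ZMod.natCast_eq_natCast_iff' (s33 c p q r x y z) 1 2).1 (by simpa using hcast)
  simpa using this

/-! ### Soundness of the enumeration -/

theorem force_eq (n : ℕ) (k : ℕ → Bool) : force n k = k n := by
  cases n <;> rfl

theorem lall_cons (a : ℕ) (l : List ℕ) (k : ℕ → Bool) :
    lall (a :: l) k = cond (k a) (lall l k) false := rfl

theorem lall_mem (l : List ℕ) (k : ℕ → Bool) (h : lall l k = true) : ∀ a ∈ l, k a = true := by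
  induction l with
  | nil => simp
  | cons b l ih =>
    rw [lall_cons] at h
    cases hb : k b with
    | false => rw [hb] at h; simp at h
    | true =>
      rw [hb] at h
      intro a ha
      rcases List.mem_cons.1 ha with rfl | ha
      · exact hb
      · exact ih h a ha

theorem lall32 (k : ℕ → Bool) (h : lall all32 k = true) (a : ℕ) (ha : a < 32) : k a = true := by
  apply lall_mem _ _ h
  unfold all32
  simp only [List.mem_cons, List.not_mem_nil]
  omega

theorem cond_ble {m n : ℕ} {b : Bool} (h : cond (Nat.ble m n) true b = true) : m ≤ n ∨ b = true := by
  cases hb : Nat.ble m n with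
  | true => exact Or.inl (Nat.le_of_ble_eq_true hb)
  | false => rw [hb] at h; exact Or.inr h

theorem enum4_sound {W N cut s e : ℕ} {leaf : ℕ → ℕ → ℕ → ℕ → Bool}
    (h : enum4 W N cut s e leaf = true) (a b c d : ℕ) (ha : a < 32) (hb : b < 32) (hc : c < 32)
    (hd : d < 32) :
    cut ≤ e + (tlook N a + tlook N b + tlook N c + tlook N d) + sum6 W s a b c d ∨
      leaf a b c d = true := by
  unfold enum4 at h
  unfold sum6
  have h1 := lall32 _ h a ha
  rw [force_eq] at h1
  rcases cond_ble h1 with h1 | h1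
  · left; simp only [Nat.add_eq] at h1; omega
  have h2 := lall32 _ h1 b hb
  rw [force_eq] at h2
  rcases cond_ble h2 with h2 | h2
  · left; simp only [Nat.add_eq] at h2; omega
  have h3 := lall32 _ h2 c hc
  rw [force_eq] at h3
  rcases cond_ble h3 with h3 | h3
  · left; simp only [Nat.add_eq] at h3; omega
  have h4 := lall32 _ h3 d hd
  rcases cond_ble h4 with h4 | h4
  · left; simp only [Nat.add_eq] at h4; omega
  · exact Or.inr h4

def num5 (a b c d e : Bool) : ℕ := a.toNat + 2 * b.toNat + 4 * c.toNat + 8 * d.toNat + 16 * e.toNat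

def stab (e1 e2 : Bool) : ℕ := cond e1 (cond e2 30 7) (cond e2 25 0)

theorem pair_tab : ∀ m01 m02 m03 m10 m12 m13 m20 m21 m23 m30 m31 m32 : Bool,
    tlook tW0 (num5 (xor (xor m20 m21) (xor m30 m31)) (xor (xor m10 m12) (xor m30 m32))
      (xor (xor m01 m03) (xor m21 m23)) (xor (xor m10 m13) (xor m20 m23))
      (xor (xor m01 m02) (xor m31 m32))) ≤ (m23.toNat + m32.toNat) +
        (m02.toNat + m20.toNat + (m12.toNat + m21.toNat) + (m03.toNat + m30.toNat) +
          (m13.toNat + m31.toNat)) ∧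
    ((m23.toNat + m32.toNat) +
        (m02.toNat + m20.toNat + (m12.toNat + m21.toNat) + (m03.toNat + m30.toNat) +
          (m13.toNat + m31.toNat)) =
      tlook tW0 (num5 (xor (xor m20 m21) (xor m30 m31)) (xor (xor m10 m12) (xor m30 m32))
      (xor (xor m01 m03) (xor m21 m23)) (xor (xor m10 m13) (xor m20 m23))
      (xor (xor m01 m02) (xor m31 m32))) → m23.toNat + m32.toNat =
      tlook tA (num5 (xor (xor m20 m21) (xor m30 m31)) (xor (xor m10 m12) (xor m30 m32))
      (xor (xor m01 m03) (xor m21 m23)) (xor (xor m10 m13) (xor m20 m23))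
      (xor (xor m01 m02) (xor m31 m32))) ∧
      tlook tD (num5 (xor (xor m20 m21) (xor m30 m31)) (xor (xor m10 m12) (xor m30 m32))
      (xor (xor m01 m03) (xor m21 m23)) (xor (xor m10 m13) (xor m20 m23))
      (xor (xor m01 m02) (xor m31 m32))) ≤ m01.toNat + m10.toNat) ∧
    tlook tW1 (num5 (xor (xor m20 m21) (xor m30 m31)) (xor (xor m10 m12) (xor m30 m32))
      (xor (xor m01 m03) (xor m21 m23)) (xor (xor m10 m13) (xor m20 m23))
      (xor (xor m01 m02) (xor m31 m32))) ≤ 2 *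
        (m02.toNat + m20.toNat + (m12.toNat + m21.toNat) + (m03.toNat + m30.toNat) +
          (m13.toNat + m31.toNat)) + 4 * (m01.toNat + m10.toNat) := by
  decide +kernel

theorem pidx_tab : ∀ g f1 f2 f3 f4 g' k1 k2 k3 k4 e1 e2 : Bool,
    pidx (stab e1 e2) (num5 g f1 f2 f3 f4) (num5 g' k1 k2 k3 k4) =
      num5 (!(xor (xor g (xor g' (xor (xor k1 k2) (xor k3 k4)))) (xor e1 e2)))
        (xor (xor f1 k2) e1) (xor (xor f2 k1) e1) (xor (xor f3 k4) e2) (xor (xor f4 k3) e2) := by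
  decide +kernel

theorem node_tab : ∀ g f1 f2 f3 f4 : Bool,
    num5 g f1 f2 f3 f4 < 32 ∧ num5 g f1 f2 f3 f4 % 2 = g.toNat ∧
    tlook tN0 (num5 g f1 f2 f3 f4) = g.toNat + (f1.toNat + f2.toNat + f3.toNat + f4.toNat) ∧
    tlook tN1 (num5 g f1 f2 f3 f4) = 2 * g.toNat + (f1.toNat + f2.toNat + f3.toNat + f4.toNat) := by
  decide

def toB (a : ZMod 2) : Bool := decide (a = 1)

theorem toB_add : ∀ a b : ZMod 2, toB (a + b) = xor (toB a) (toB b) := by decide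
theorem toB_one : toB 1 = true := rfl
theorem toB_val : ∀ a : ZMod 2, a.val = (toB a).toNat := by decide
theorem toB_le : ∀ a b : ZMod 2, (toB (a + b)).toNat ≤ a.val + b.val := by decide

/-! ### The pair inequality: `K_{1,1,4,2}` -/


def g8 (n : Fin 8 → Fin 8 → Fin 8 → ZMod 2) (x : Fin 8) : ZMod 2 := cpar n x 2 0 1 + cpar n x 3 0 1
def fa8 (n : Fin 8 → Fin 8 → Fin 8 → ZMod 2) (x : Fin 8) : ZMod 2 := cpar n x 1 0 2 + cpar n x 3 0 2
def fb8 (n : Fin 8 → Fin 8 → Fin 8 → ZMod 2) (x : Fin 8) : ZMod 2 := cpar n x 0 1 3 + cpar n x 2 1 3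
def fc8 (n : Fin 8 → Fin 8 → Fin 8 → ZMod 2) (x : Fin 8) : ZMod 2 := cpar n x 1 0 3 + cpar n x 2 0 3
def fd8 (n : Fin 8 → Fin 8 → Fin 8 → ZMod 2) (x : Fin 8) : ZMod 2 := cpar n x 0 1 2 + cpar n x 3 1 2

theorem kap8a : ∀ q r x x' : Fin 8, q < 4 → r < 4 → q ≠ r → 4 ≤ x → x < x' →
    kap x q x' r = if q < r then 1 else 0 := by decide +kernel
theorem kap8b : ∀ q r s x : Fin 8, q < 4 → r < 4 → s < 4 → 4 ≤ x → r < s → q ≠ r → q ≠ s →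
    kap x q r s = if r < q ∧ q < s then 1 else 0 := by decide +kernel

def P8 (n : Fin 8 → Fin 8 → Fin 8 → ZMod 2) (x : Fin 8) : ℕ :=
  num5 (toB (g8 n x)) (toB (fa8 n x)) (toB (fb8 n x)) (toB (fc8 n x)) (toB (fd8 n x))

theorem rect8 (n : Fin 8 → Fin 8 → Fin 8 → ZMod 2) (x x' : Fin 8) (hx : 4 ≤ x) (hxx : x < x') :
    (cpar n x 2 x' 0 + cpar n x 2 x' 1) + (cpar n x 3 x' 0 + cpar n x 3 x' 1) =
      1 + ((g8 n x + (g8 n x' + ((fa8 n x' + fb8 n x') + (fc8 n x' + fd8 n x')))) +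
        (cpar n 0 2 1 3 + cpar n 0 3 1 2)) ∧
    (cpar n x 1 x' 0 + cpar n x 1 x' 2) + (cpar n x 3 x' 0 + cpar n x 3 x' 2) =
      fa8 n x + fb8 n x' + cpar n 0 2 1 3 ∧
    (cpar n x 0 x' 1 + cpar n x 0 x' 3) + (cpar n x 2 x' 1 + cpar n x 2 x' 3) =
      fb8 n x + fa8 n x' + cpar n 0 2 1 3 ∧
    (cpar n x 1 x' 0 + cpar n x 1 x' 3) + (cpar n x 2 x' 0 + cpar n x 2 x' 3) =
      fc8 n x + fd8 n x' + cpar n 0 3 1 2 ∧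
    (cpar n x 0 x' 1 + cpar n x 0 x' 2) + (cpar n x 3 x' 1 + cpar n x 3 x' 2) =
      fd8 n x + fc8 n x' + cpar n 0 3 1 2 := by
  have hx' : 4 ≤ x' := le_of_lt (lt_of_le_of_lt hx hxx)
  have ka := fun q r hq hr hqr => kap8a q r x x' hq hr hqr hx hxx
  have kb := fun q r s h1 h2 h3 h4 h5 h6 => kap8b q r s x h1 h2 h3 hx h4 h5 h6
  have kb' := fun q r s h1 h2 h3 h4 h5 h6 => kap8b q r s x' h1 h2 h3 hx' h4 h5 h6
  have z1 : kap (0 : Fin 8) 2 1 3 = 1 := by decide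
  have z2 : kap (0 : Fin 8) 3 1 2 = 0 := by decide
  have a01 := ka 0 1 (by decide) (by decide) (by decide)
  have a02 := ka 0 2 (by decide) (by decide) (by decide)
  have a03 := ka 0 3 (by decide) (by decide) (by decide)
  have a10 := ka 1 0 (by decide) (by decide) (by decide)
  have a12 := ka 1 2 (by decide) (by decide) (by decide)
  have a13 := ka 1 3 (by decide) (by decide) (by decide)
  have a20 := ka 2 0 (by decide) (by decide) (by decide)
  have a21 := ka 2 1 (by decide) (by decide) (by decide)
  have a23 := ka 2 3 (by decide) (by decide) (by decide)
  have a30 := ka 3 0 (by decide) (by decide) (by decide)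
  have a31 := ka 3 1 (by decide) (by decide) (by decide)
  have a32 := ka 3 2 (by decide) (by decide) (by decide)
  have b1 := kb 2 0 1 (by decide) (by decide) (by decide) (by decide) (by decide) (by decide)
  have b2 := kb 3 0 1 (by decide) (by decide) (by decide) (by decide) (by decide) (by decide)
  have b3 := kb 1 0 2 (by decide) (by decide) (by decide) (by decide) (by decide) (by decide)
  have b4 := kb 3 0 2 (by decide) (by decide) (by decide) (by decide) (by decide) (by decide)
  have b5 := kb 0 1 3 (by decide) (by decide) (by decide) (by decide) (by decide) (by decide)
  have b6 := kb 2 1 3 (by decide) (by decide) (by decide) (by decide) (by decide) (by decide)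
  have b7 := kb 1 0 3 (by decide) (by decide) (by decide) (by decide) (by decide) (by decide)
  have b8 := kb 2 0 3 (by decide) (by decide) (by decide) (by decide) (by decide) (by decide)
  have b9 := kb 0 1 2 (by decide) (by decide) (by decide) (by decide) (by decide) (by decide)
  have b0 := kb 3 1 2 (by decide) (by decide) (by decide) (by decide) (by decide) (by decide)
  have c1 := kb' 2 0 1 (by decide) (by decide) (by decide) (by decide) (by decide) (by decide)
  have c2 := kb' 3 0 1 (by decide) (by decide) (by decide) (by decide) (by decide) (by decide)
  have c3 := kb' 1 0 2 (by decide) (by decide) (by decide) (by decide) (by decide) (by decide)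
  have c4 := kb' 3 0 2 (by decide) (by decide) (by decide) (by decide) (by decide) (by decide)
  have c5 := kb' 0 1 3 (by decide) (by decide) (by decide) (by decide) (by decide) (by decide)
  have c6 := kb' 2 1 3 (by decide) (by decide) (by decide) (by decide) (by decide) (by decide)
  have c7 := kb' 1 0 3 (by decide) (by decide) (by decide) (by decide) (by decide) (by decide)
  have c8 := kb' 2 0 3 (by decide) (by decide) (by decide) (by decide) (by decide) (by decide)
  have c9 := kb' 0 1 2 (by decide) (by decide) (by decide) (by decide) (by decide) (by decide)
  have c0 := kb' 3 1 2 (by decide) (by decide) (by decide) (by decide) (by decide) (by decide)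
  rw [if_pos (by decide)] at a01 a02 a03 a12 a13 a23 b3 b6 b7 b8 c3 c6 c7 c8
  rw [if_neg (by decide)] at a10 a20 a21 a30 a31 a32 b1 b2 b4 b5 b9 b0 c1 c2 c4 c5 c9 c0
  simp only [g8, fa8, fb8, fc8, fd8, cpar, z1, z2, a01, a02, a03, a10, a12, a13, a20, a21, a23, a30,
    a31, a32, b1, b2, b3, b4, b5, b6, b7, b8, b9, b0, c1, c2, c3, c4, c5, c6, c7, c8, c9, c0]
  refine ⟨?_, ?_, ?_, ?_, ?_⟩
  · rw [← sub_eq_zero]; ring_nf; reduce_mod_char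
  · rw [← sub_eq_zero]; ring_nf; reduce_mod_char
  · rw [← sub_eq_zero]; ring_nf; reduce_mod_char
  · rw [← sub_eq_zero]; ring_nf; reduce_mod_char
  · rw [← sub_eq_zero]; ring_nf; reduce_mod_char

def col8 : Fin 8 → ℕ := ![0, 1, 2, 2, 3, 3, 3, 3]

def pB8 (c : Fin 8 → Fin 8 → Fin 8 → Fin 8 → ℕ) (x x' : Fin 8) : ℕ :=
  q2 c x x' 0 2 + q2 c x x' 1 2 + q2 c x x' 0 3 + q2 c x x' 1 3

theorem pair8 {c : Fin 8 → Fin 8 → Fin 8 → Fin 8 → ℕ} (n : Fin 8 → Fin 8 → Fin 8 → ZMod 2)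
    (hn : ∀ u v w z, u ≠ w → u ≠ z → v ≠ w → v ≠ z → col8 u ≠ col8 v → col8 w ≠ col8 z →
        c u v w z = (cpar n u v w z).val) (x x' : Fin 8) (hx : 4 ≤ x) (hxx : x < x') :
    tlook tW0 (pidx (stab (toB (cpar n 0 2 1 3)) (toB (cpar n 0 3 1 2))) (P8 n x) (P8 n x')) ≤
      q2 c x x' 2 3 + pB8 c x x' ∧
    (q2 c x x' 2 3 + pB8 c x x' =
      tlook tW0 (pidx (stab (toB (cpar n 0 2 1 3)) (toB (cpar n 0 3 1 2))) (P8 n x) (P8 n x')) →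
      q2 c x x' 2 3 =
        tlook tA (pidx (stab (toB (cpar n 0 2 1 3)) (toB (cpar n 0 3 1 2))) (P8 n x) (P8 n x')) ∧
      tlook tD (pidx (stab (toB (cpar n 0 2 1 3)) (toB (cpar n 0 3 1 2))) (P8 n x) (P8 n x')) ≤
        q2 c x x' 0 1) ∧
    tlook tW1 (pidx (stab (toB (cpar n 0 2 1 3)) (toB (cpar n 0 3 1 2))) (P8 n x) (P8 n x')) ≤
      2 * pB8 c x x' + 4 * q2 c x x' 0 1 := by
  have hv : ∀ q r : Fin 8, q < 4 → r < 4 → q ≠ r →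
      c x q x' r = (toB (cpar n x q x' r)).toNat := by
    intro q r hq hr hqr
    rw [← toB_val]
    have hcol : ∀ q x : Fin 8, q < 4 → 4 ≤ x → col8 x ≠ col8 q := by decide
    refine hn x q x' r hxx.ne ?_ ?_ hqr (hcol q x hq hx) (hcol r x' hr (hx.trans hxx.le))
    · exact (lt_of_lt_of_le hr hx).ne'
    · exact (lt_of_lt_of_le hq (hx.trans hxx.le)).ne
  obtain ⟨r1, r2, r3, r4, r5⟩ := rect8 n x x' hx hxx
  have s1 := congrArg toB r1
  have s2 := congrArg toB r2
  have s3 := congrArg toB r3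
  have s4 := congrArg toB r4
  have s5 := congrArg toB r5
  simp only [toB_add, toB_one, Bool.true_xor] at s1 s2 s3 s4 s5
  have key := pair_tab (toB (cpar n x 0 x' 1)) (toB (cpar n x 0 x' 2)) (toB (cpar n x 0 x' 3))
    (toB (cpar n x 1 x' 0)) (toB (cpar n x 1 x' 2)) (toB (cpar n x 1 x' 3))
    (toB (cpar n x 2 x' 0)) (toB (cpar n x 2 x' 1)) (toB (cpar n x 2 x' 3))
    (toB (cpar n x 3 x' 0)) (toB (cpar n x 3 x' 1)) (toB (cpar n x 3 x' 2))
  rw [s1, s2, s3, s4, s5] at key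
  unfold P8
  rw [pidx_tab]
  unfold pB8 q2
  rw [hv 0 1 (by decide) (by decide) (by decide), hv 0 2 (by decide) (by decide) (by decide),
    hv 0 3 (by decide) (by decide) (by decide), hv 1 0 (by decide) (by decide) (by decide),
    hv 1 2 (by decide) (by decide) (by decide), hv 1 3 (by decide) (by decide) (by decide),
    hv 2 0 (by decide) (by decide) (by decide), hv 2 1 (by decide) (by decide) (by decide),
    hv 2 3 (by decide) (by decide) (by decide), hv 3 0 (by decide) (by decide) (by decide),
    hv 3 1 (by decide) (by decide) (by decide), hv 3 2 (by decide) (by decide) (by decide)]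
  exact key


/-- crossings of the star of `y` with `K_{1,1,4}` (`f` of the text), for the vertex set
`a, b, x₁, …, x₄, y` -/
def fS {m : ℕ} (c : Fin m → Fin m → Fin m → Fin m → ℕ) (a b x1 x2 x3 x4 y : Fin m) : ℕ :=
  (c x1 y a b + c x2 y a b + c x3 y a b + c x4 y a b) +
  (q2 c x1 y a b + q2 c x2 y a b + q2 c x3 y a b + q2 c x4 y a b)

/-- the part of the crossings of the star of `y` with `K_{2,4}` -/
def bS {m : ℕ} (c : Fin m → Fin m → Fin m → Fin m → ℕ) (a b x1 x2 x3 x4 y : Fin m) : ℕ :=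
  (q2 c x1 x2 a y + q2 c x1 x2 b y) + (q2 c x1 x3 a y + q2 c x1 x3 b y) +
  (q2 c x1 x4 a y + q2 c x1 x4 b y) + (q2 c x2 x3 a y + q2 c x2 x3 b y) +
  (q2 c x2 x4 a y + q2 c x2 x4 b y) + (q2 c x3 x4 a y + q2 c x3 x4 b y)

/-- sum over the pairs of `x`s -/
def aS {m : ℕ} (c : Fin m → Fin m → Fin m → Fin m → ℕ) (x1 x2 x3 x4 y y' : Fin m) : ℕ :=
  q2 c x1 x2 y y' + q2 c x1 x3 y y' + q2 c x1 x4 y y' + q2 c x2 x3 y y' + q2 c x2 x4 y y' +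
    q2 c x3 x4 y y'

/-- the crossings between the stars of `y` and `y'` involving `a` or `b` -/
def cS {m : ℕ} (c : Fin m → Fin m → Fin m → Fin m → ℕ) (a b x1 x2 x3 x4 y y' : Fin m) : ℕ :=
  (q2 c y y' a x1 + q2 c y y' b x1) + (q2 c y y' a x2 + q2 c y y' b x2) +
  (q2 c y y' a x3 + q2 c y y' b x3) + (q2 c y y' a x4 + q2 c y y' b x4) + q2 c y y' a b

theorem node8 {c : Fin 8 → Fin 8 → Fin 8 → Fin 8 → ℕ} (h1 : ∀ u v w z, c u v w z = c v u w z)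
    (h2 : ∀ u v w z, c u v w z = c w z u v) (n : Fin 8 → Fin 8 → Fin 8 → ZMod 2)
    (hn : ∀ u v w z, u ≠ w → u ≠ z → v ≠ w → v ≠ z → col8 u ≠ col8 v → col8 w ≠ col8 z →
        c u v w z = (cpar n u v w z).val) (x : Fin 8) (hx : 4 ≤ x) :
    ∃ N : ℕ, P8 n x < 32 ∧ tlook tN0 (P8 n x) = P8 n x % 2 + N ∧
      tlook tN1 (P8 n x) = 2 * (P8 n x % 2) + N ∧
      P8 n x % 2 ≤ c x 2 0 1 + c x 3 0 1 ∧
      N ≤ (q2 c x 2 0 1 + q2 c x 3 0 1) + (q2 c 2 3 0 x + q2 c 2 3 1 x) := by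
  have h3 : ∀ u v w z, c u v w z = c u v z w := by
    intro u v w z
    rw [h2, h1, h2]
  have hv : ∀ q r s : Fin 8, q < 4 → r < 4 → s < 4 → q ≠ r → q ≠ s → r < s → col8 r ≠ col8 s →
      c x q r s = (cpar n x q r s).val := by
    intro q r s hq hr hs hqr hqs hrs hcol
    have hc : ∀ q x : Fin 8, q < 4 → 4 ≤ x → col8 x ≠ col8 q := by decide
    exact hn x q r s (lt_of_lt_of_le hr hx).ne' (lt_of_lt_of_le hs hx).ne' hqr hqs (hc q x hq hx) hcol
  obtain ⟨k1, k2, k3, k4⟩ := node_tab (toB (g8 n x)) (toB (fa8 n x)) (toB (fb8 n x)) (toB (fc8 n x))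
    (toB (fd8 n x))
  have v1 := hv 2 0 1 (by decide) (by decide) (by decide) (by decide) (by decide) (by decide) (by decide)
  have v2 := hv 3 0 1 (by decide) (by decide) (by decide) (by decide) (by decide) (by decide) (by decide)
  have v3 := hv 1 0 2 (by decide) (by decide) (by decide) (by decide) (by decide) (by decide) (by decide)
  have v4 := hv 3 0 2 (by decide) (by decide) (by decide) (by decide) (by decide) (by decide) (by decide)
  have v5 := hv 0 1 3 (by decide) (by decide) (by decide) (by decide) (by decide) (by decide) (by decide)
  have v6 := hv 2 1 3 (by decide) (by decide) (by decide) (by decide) (by decide) (by decide) (by decide)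
  have v7 := hv 1 0 3 (by decide) (by decide) (by decide) (by decide) (by decide) (by decide) (by decide)
  have v8 := hv 2 0 3 (by decide) (by decide) (by decide) (by decide) (by decide) (by decide) (by decide)
  have v9 := hv 0 1 2 (by decide) (by decide) (by decide) (by decide) (by decide) (by decide) (by decide)
  have v0 := hv 3 1 2 (by decide) (by decide) (by decide) (by decide) (by decide) (by decide) (by decide)
  have w1 := toB_le (cpar n x 2 0 1) (cpar n x 3 0 1)
  have w2 := toB_le (cpar n x 1 0 2) (cpar n x 3 0 2)
  have w3 := toB_le (cpar n x 0 1 3) (cpar n x 2 1 3)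
  have w4 := toB_le (cpar n x 1 0 3) (cpar n x 2 0 3)
  have w5 := toB_le (cpar n x 0 1 2) (cpar n x 3 1 2)
  have y1 : c x 0 2 1 = c x 0 1 2 := h3 _ _ _ _
  have y2 : c x 1 2 0 = c x 1 0 2 := h3 _ _ _ _
  have y3 : c x 0 3 1 = c x 0 1 3 := h3 _ _ _ _
  have y4 : c x 1 3 0 = c x 1 0 3 := h3 _ _ _ _
  have y5 : c 2 0 3 x = c x 3 0 2 := by rw [h1 2 0, h2, h1 3 x]
  have y6 : c 2 x 3 0 = c x 2 0 3 := by rw [h1 2 x, h3 x 2]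
  have y7 : c 2 1 3 x = c x 3 1 2 := by rw [h1 2 1, h2, h1 3 x]
  have y8 : c 2 x 3 1 = c x 2 1 3 := by rw [h1 2 x, h3 x 2]
  refine ⟨(toB (fa8 n x)).toNat + (toB (fb8 n x)).toNat + (toB (fc8 n x)).toNat +
    (toB (fd8 n x)).toNat, k1, ?_, ?_, ?_, ?_⟩
  · unfold P8; rw [k3, k2]
  · unfold P8; rw [k4, k2]
  · unfold P8; rw [k2, v1, v2]; exact w1
  · unfold q2
    rw [y1, y2, y3, y4, y5, y6, y7, y8, v3, v4, v5, v6, v7, v8, v9, v0]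
    unfold fa8 fb8 fc8 fd8
    omega

theorem enum0_all : ∀ e1 e2 : Bool,
    enum4 tW0 tN0 7 (stab e1 e2) (e1.toNat + e2.toNat) (leaf0 (stab e1 e2) (e1.toNat + e2.toNat)) = true := by
  have h := enum0
  simp only [Bool.and_eq_true] at h
  obtain ⟨⟨⟨h1, h2⟩, h3⟩, h4⟩ := h
  intro e1 e2
  cases e1 <;> cases e2
  · exact h1
  · exact h2
  · exact h3
  · exact h4

theorem enum1_all : ∀ e1 e2 : Bool,
    enum4 tW1 tN1 12 (stab e1 e2) (e1.toNat + e2.toNat) (fun _ _ _ _ => false) = true := by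
  have h := enum1
  simp only [Bool.and_eq_true] at h
  obtain ⟨⟨⟨h1, h2⟩, h3⟩, h4⟩ := h
  intro e1 e2
  cases e1 <;> cases e2
  · exact h1
  · exact h2
  · exact h3
  · exact h4

theorem leaf0_prop {s e a b c d : ℕ} (h : leaf0 s e a b c d = true) :
    e + (tlook tN0 a + tlook tN0 b + tlook tN0 c + tlook tN0 d) + sum6 tW0 s a b c d = 6 ∧
    (4 ≤ e + sum6 tA s a b c d ∨
      (e = 0 ∧ sum6 tA s a b c d = 0 ∧ tlook tN0 a + tlook tN0 b + tlook tN0 c + tlook tN0 d =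
        a % 2 + b % 2 + c % 2 + d % 2) ∨
      (sum6 tA s a b c d = 2 ∧ sum6 tW0 s a b c d = 2 ∧ 2 ≤ sum6 tD s a b c d)) := by
  unfold leaf0 at h
  simp only [Bool.and_eq_true, Bool.or_eq_true, Nat.beq_eq, Nat.ble_eq] at h
  omega

theorem add4_le {a b c d a' b' c' d' : ℕ} (h1 : a ≤ a') (h2 : b ≤ b') (h3 : c ≤ c') (h4 : d ≤ d') :
    a + b + c + d ≤ a' + b' + c' + d' := by omega

theorem add6_le {a b c d e f a' b' c' d' e' f' : ℕ} (h1 : a ≤ a') (h2 : b ≤ b') (h3 : c ≤ c')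
    (h4 : d ≤ d') (h5 : e ≤ e') (h6 : f ≤ f') :
    a + b + c + d + e + f ≤ a' + b' + c' + d' + e' + f' := by omega

theorem add6_eq {a b c d e f a' b' c' d' e' f' : ℕ} (h1 : a ≤ a') (h2 : b ≤ b') (h3 : c ≤ c')
    (h4 : d ≤ d') (h5 : e ≤ e') (h6 : f ≤ f')
    (h : a' + b' + c' + d' + e' + f' = a + b + c + d + e + f) :
    a' = a ∧ b' = b ∧ c' = c ∧ d' = d ∧ e' = e ∧ f' = f := by omega

theorem add4_eq1 {t1 t2 t3 t4 p1 p2 p3 p4 n1 n2 n3 n4 : ℕ} (h1 : t1 = p1 + n1) (h2 : t2 = p2 + n2)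
    (h3 : t3 = p3 + n3) (h4 : t4 = p4 + n4) :
    t1 + t2 + t3 + t4 = (p1 + p2 + p3 + p4) + (n1 + n2 + n3 + n4) := by omega

theorem add4_eq2 {t1 t2 t3 t4 p1 p2 p3 p4 n1 n2 n3 n4 : ℕ} (h1 : t1 = 2 * p1 + n1)
    (h2 : t2 = 2 * p2 + n2) (h3 : t3 = 2 * p3 + n3) (h4 : t4 = 2 * p4 + n4) :
    t1 + t2 + t3 + t4 = 2 * (p1 + p2 + p3 + p4) + (n1 + n2 + n3 + n4) := by omega

theorem rearF (a1 a2 a3 a4 q1 q2 q3 q4 b1 b2 b3 b4 r1 r2 r3 r4 : ℕ) :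
    ((a1 + a2 + a3 + a4) + (q1 + q2 + q3 + q4)) + ((b1 + b2 + b3 + b4) + (r1 + r2 + r3 + r4)) =
    ((a1 + b1) + (a2 + b2) + (a3 + b3) + (a4 + b4)) +
      ((q1 + r1) + (q2 + r2) + (q3 + r3) + (q4 + r4)) := by ring

theorem rear4 (a1 a2 a3 a4 q1 q2 q3 q4 : ℕ) :
    (a1 + q1) + (a2 + q2) + (a3 + q3) + (a4 + q4) = (a1 + a2 + a3 + a4) + (q1 + q2 + q3 + q4) := by ring

theorem rear6 (a1 a2 a3 a4 a5 a6 q1 q2 q3 q4 q5 q6 : ℕ) :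
    (a1 + q1) + (a2 + q2) + (a3 + q3) + (a4 + q4) + (a5 + q5) + (a6 + q6) =
      (a1 + a2 + a3 + a4 + a5 + a6) + (q1 + q2 + q3 + q4 + q5 + q6) := by ring

theorem rear6' (a1 a2 a3 a4 a5 a6 q1 q2 q3 q4 q5 q6 : ℕ) :
    (2 * a1 + 4 * q1) + (2 * a2 + 4 * q2) + (2 * a3 + 4 * q3) + (2 * a4 + 4 * q4) +
      (2 * a5 + 4 * q5) + (2 * a6 + 4 * q6) =
      2 * (a1 + a2 + a3 + a4 + a5 + a6) + 4 * (q1 + q2 + q3 + q4 + q5 + q6) := by ring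

theorem rearB (a1 a2 a3 a4 a5 a6 b1 b2 b3 b4 b5 b6 c1 c2 c3 c4 c5 c6 d1 d2 d3 d4 d5 d6 : ℕ) :
    ((a1 + b1) + (a2 + b2) + (a3 + b3) + (a4 + b4) + (a5 + b5) + (a6 + b6)) +
    ((c1 + d1) + (c2 + d2) + (c3 + d3) + (c4 + d4) + (c5 + d5) + (c6 + d6)) =
    (a1 + b1 + c1 + d1) + (a2 + b2 + c2 + d2) + (a3 + b3 + c3 + d3) + (a4 + b4 + c4 + d4) +
    (a5 + b5 + c5 + d5) + (a6 + b6 + c6 + d6) := by ring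

theorem arith8 {F B A C D e G Q Cx p N s0 s1 W0 W1 SA SD : ℕ} (lf : Prop) (hF : F = G + Q)
    (hC : C = Cx + e) (hp : p ≤ G) (hN : N ≤ Q + Cx) (hs0 : s0 = p + N) (hs1 : s1 = 2 * p + N)
    (hW0 : W0 ≤ A + B) (hW1 : W1 ≤ 2 * B + 4 * D) (ht : A + B = W0 → A = SA ∧ SD ≤ D)
    (z0 : 7 ≤ e + s0 + W0 ∨ lf) (z1 : 12 ≤ e + s1 + W1)
    (hlf : lf → e + s0 + W0 = 6 ∧ (4 ≤ e + SA ∨ (e = 0 ∧ SA = 0 ∧ s0 = p) ∨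
      (SA = 2 ∧ W0 = 2 ∧ 2 ≤ SD))) :
    6 ≤ F + B + A + C ∧
    (F + B + A + C = 6 → A + C = 0 ∨ 4 ≤ A + C ∨ (A = 2 ∧ B = 0 ∧ 2 ≤ D)) ∧
    12 ≤ 2 * (F + B) + C + 4 * D := by
  refine ⟨?_, ?_, by omega⟩
  · rcases z0 with z0 | z0
    · omega
    · obtain ⟨h1, -⟩ := hlf z0
      omega
  · intro h6
    rcases z0 with z0 | z0
    · omega
    · obtain ⟨h1, h2⟩ := hlf z0
      obtain ⟨h3, h4⟩ := ht (by omega)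
      rcases h2 with h2 | h2 | h2
      · right; left; omega
      · left; omega
      · right; right; omega

theorem hE8 {c : Fin 8 → Fin 8 → Fin 8 → Fin 8 → ℕ} (h : XSys col8 c)
    (n : Fin 8 → Fin 8 → Fin 8 → ZMod 2)
    (hn : ∀ u v w z, u ≠ w → u ≠ z → v ≠ w → v ≠ z → col8 u ≠ col8 v → col8 w ≠ col8 z →
        c u v w z = (cpar n u v w z).val) :
    q2 c 2 3 0 1 = (toB (cpar n 0 2 1 3)).toNat + (toB (cpar n 0 3 1 2)).toNat := by
  have e1 : c 2 0 3 1 = (cpar n 0 2 1 3).val := by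
    rw [h.s1, h.s2, h.s1, h.s2]
    exact hn _ _ _ _ (by decide) (by decide) (by decide) (by decide) (by decide) (by decide)
  have e2 : c 2 1 3 0 = (cpar n 0 3 1 2).val := by
    rw [h.s1, h.s2, h.s1]
    exact hn _ _ _ _ (by decide) (by decide) (by decide) (by decide) (by decide) (by decide)
  unfold q2
  rw [e1, e2, toB_val, toB_val]

theorem k1142_8 {c : Fin 8 → Fin 8 → Fin 8 → Fin 8 → ℕ} (h : XSys col8 c) :
    6 ≤ (fS c 0 1 4 5 6 7 2 + fS c 0 1 4 5 6 7 3) + (bS c 0 1 4 5 6 7 2 + bS c 0 1 4 5 6 7 3) +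
      aS c 4 5 6 7 2 3 + cS c 0 1 4 5 6 7 2 3 ∧
    ((fS c 0 1 4 5 6 7 2 + fS c 0 1 4 5 6 7 3) + (bS c 0 1 4 5 6 7 2 + bS c 0 1 4 5 6 7 3) +
      aS c 4 5 6 7 2 3 + cS c 0 1 4 5 6 7 2 3 = 6 →
        aS c 4 5 6 7 2 3 + cS c 0 1 4 5 6 7 2 3 = 0 ∨
        4 ≤ aS c 4 5 6 7 2 3 + cS c 0 1 4 5 6 7 2 3 ∨
        (aS c 4 5 6 7 2 3 = 2 ∧ (bS c 0 1 4 5 6 7 2 + bS c 0 1 4 5 6 7 3) = 0 ∧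
          2 ≤ aS c 4 5 6 7 0 1)) ∧
    12 ≤ 2 * ((fS c 0 1 4 5 6 7 2 + fS c 0 1 4 5 6 7 3) +
      (bS c 0 1 4 5 6 7 2 + bS c 0 1 4 5 6 7 3)) + cS c 0 1 4 5 6 7 2 3 + 4 * aS c 4 5 6 7 0 1 := by
  obtain ⟨n, -, hn⟩ := h.top 8 id Function.injective_id
  simp only [id] at hn
  obtain ⟨N4, n41, n42, n43, n44, n45⟩ := node8 h.s1 h.s2 n hn 4 (by decide)
  obtain ⟨N5, n51, n52, n53, n54, n55⟩ := node8 h.s1 h.s2 n hn 5 (by decide)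
  obtain ⟨N6, n61, n62, n63, n64, n65⟩ := node8 h.s1 h.s2 n hn 6 (by decide)
  obtain ⟨N7, n71, n72, n73, n74, n75⟩ := node8 h.s1 h.s2 n hn 7 (by decide)
  obtain ⟨p1, p2, p3⟩ := pair8 n hn 4 5 (by decide) (by decide)
  obtain ⟨q1, q2', q3⟩ := pair8 n hn 4 6 (by decide) (by decide)
  obtain ⟨r1, r2, r3⟩ := pair8 n hn 4 7 (by decide) (by decide)
  obtain ⟨s1, s2, s3⟩ := pair8 n hn 5 6 (by decide) (by decide)
  obtain ⟨t1, t2, t3⟩ := pair8 n hn 5 7 (by decide) (by decide)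
  obtain ⟨u1, u2, u3⟩ := pair8 n hn 6 7 (by decide) (by decide)
  have z0 := enum4_sound (enum0_all (toB (cpar n 0 2 1 3)) (toB (cpar n 0 3 1 2)))
    (P8 n 4) (P8 n 5) (P8 n 6) (P8 n 7) n41 n51 n61 n71
  have z1 := enum4_sound (enum1_all (toB (cpar n 0 2 1 3)) (toB (cpar n 0 3 1 2)))
    (P8 n 4) (P8 n 5) (P8 n 6) (P8 n 7) n41 n51 n61 n71
  have hE := hE8 h n hn
  have hF : fS c 0 1 4 5 6 7 2 + fS c 0 1 4 5 6 7 3 = _ := rearF _ _ _ _ _ _ _ _ _ _ _ _ _ _ _ _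
  have hB : bS c 0 1 4 5 6 7 2 + bS c 0 1 4 5 6 7 3 = pB8 c 4 5 + pB8 c 4 6 + pB8 c 4 7 + pB8 c 5 6 + pB8 c 5 7 + pB8 c 6 7 :=
    rearB _ _ _ _ _ _ _ _ _ _ _ _ _ _ _ _ _ _ _ _ _ _ _ _
  have hC : cS c 0 1 4 5 6 7 2 3 = ((q2 c 2 3 0 4 + q2 c 2 3 1 4) +
      (q2 c 2 3 0 5 + q2 c 2 3 1 5) + (q2 c 2 3 0 6 + q2 c 2 3 1 6) +
      (q2 c 2 3 0 7 + q2 c 2 3 1 7)) + ((toB (cpar n 0 2 1 3)).toNat + (toB (cpar n 0 3 1 2)).toNat) := by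
    unfold cS
    rw [hE]
  have hp := add4_le n44 n54 n64 n74
  have hN := add4_le n45 n55 n65 n75
  rw [rear4] at hN
  have hs0 := add4_eq1 n42 n52 n62 n72
  have hs1 := add4_eq2 n43 n53 n63 n73
  have hW0 := add6_le p1 q1 r1 s1 t1 u1
  have hWe := add6_eq p1 q1 r1 s1 t1 u1
  rw [rear6] at hW0
  rw [rear6] at hWe
  have hW1 := add6_le p3 q3 r3 s3 t3 u3
  rw [rear6'] at hW1
  rw [← hB] at hW0 hW1 hWe
  refine arith8 _ hF hC hp hN hs0 hs1 hW0 hW1 ?_ z0 ?_ (fun hz => leaf0_prop hz)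
  · intro hh
    obtain ⟨g1, g2, g3, g4, g5, g6⟩ := hWe hh
    obtain ⟨p4, p5⟩ := p2 g1
    obtain ⟨q4, q5⟩ := q2' g2
    obtain ⟨r4, r5⟩ := r2 g3
    obtain ⟨s4, s5⟩ := s2 g4
    obtain ⟨t4, t5⟩ := t2 g5
    obtain ⟨u4, u5⟩ := u2 g6
    refine ⟨?_, add6_le p5 q5 r5 s5 t5 u5⟩
    unfold aS sum6
    rw [p4, q4, r4, s4, t4, u4]
  · rcases z1 with z1 | z1
    · exact z1
    · exact absurd z1 Bool.false_ne_true
/-! ### Arithmetic of one side -/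

def PairOK (F1 F2 B1 B2 A C D : ℕ) : Prop :=
  6 ≤ (F1 + F2) + (B1 + B2) + A + C ∧
  ((F1 + F2) + (B1 + B2) + A + C = 6 → A + C = 0 ∨ 4 ≤ A + C ∨ (A = 2 ∧ B1 + B2 = 0 ∧ 2 ≤ D)) ∧
  12 ≤ 2 * ((F1 + F2) + (B1 + B2)) + C + 4 * D

theorem PairOK.symm {F1 F2 B1 B2 A C D : ℕ} (h : PairOK F1 F2 B1 B2 A C D) :
    PairOK F2 F1 B2 B1 A C D := by
  unfold PairOK at *
  omega

def TriOK (B1 B2 B3 A12 A13 A23 C12 C13 C23 D : ℕ) : Prop :=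
  6 ≤ (A12 + C12) + (A13 + C13) + (A23 + C23) ∧ 2 ≤ A12 + A13 + A23 ∧
  8 ≤ A12 + A13 + A23 + (B1 + B2 + B3) + D

theorem TriOK.swap12 {B1 B2 B3 A12 A13 A23 C12 C13 C23 D : ℕ}
    (h : TriOK B1 B2 B3 A12 A13 A23 C12 C13 C23 D) :
    TriOK B2 B1 B3 A12 A23 A13 C12 C23 C13 D := by
  unfold TriOK at *
  omega

theorem TriOK.swap23 {B1 B2 B3 A12 A13 A23 C12 C13 C23 D : ℕ}
    (h : TriOK B1 B2 B3 A12 A13 A23 C12 C13 C23 D) :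
    TriOK B1 B3 B2 A13 A12 A23 C13 C12 C23 D := by
  unfold TriOK at *
  omega

structure Side (F1 F2 F3 F4 B1 B2 B3 B4 A12 A13 A14 A23 A24 A34 C12 C13 C14 C23 C24 C34 D : ℕ) :
    Prop where
  p12 : PairOK F1 F2 B1 B2 A12 C12 D
  p13 : PairOK F1 F3 B1 B3 A13 C13 D
  p14 : PairOK F1 F4 B1 B4 A14 C14 D
  p23 : PairOK F2 F3 B2 B3 A23 C23 D
  p24 : PairOK F2 F4 B2 B4 A24 C24 D
  p34 : PairOK F3 F4 B3 B4 A34 C34 D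
  t123 : TriOK B1 B2 B3 A12 A13 A23 C12 C13 C23 D
  t124 : TriOK B1 B2 B4 A12 A14 A24 C12 C14 C24 D
  t134 : TriOK B1 B3 B4 A13 A14 A34 C13 C14 C34 D
  t234 : TriOK B2 B3 B4 A23 A24 A34 C23 C24 C34 D
  tot : D + ((F1 + F2 + F3 + F4) + (B1 + B2 + B3 + B4)) +
    ((A12 + A13 + A14 + A23 + A24 + A34) + (C12 + C13 + C14 + C23 + C24 + C34)) ≤ 23

namespace Side

variable {F1 F2 F3 F4 B1 B2 B3 B4 A12 A13 A14 A23 A24 A34 C12 C13 C14 C23 C24 C34 D : ℕ}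

theorem swap12 (h : Side F1 F2 F3 F4 B1 B2 B3 B4 A12 A13 A14 A23 A24 A34 C12 C13 C14 C23 C24 C34 D) :
    Side F2 F1 F3 F4 B2 B1 B3 B4 A12 A23 A24 A13 A14 A34 C12 C23 C24 C13 C14 C34 D where
  p12 := h.p12.symm
  p13 := h.p23
  p14 := h.p24
  p23 := h.p13
  p24 := h.p14
  p34 := h.p34
  t123 := h.t123.swap12
  t124 := h.t124.swap12
  t134 := h.t234
  t234 := h.t134
  tot := by have := h.tot; omega

theorem swap23 (h : Side F1 F2 F3 F4 B1 B2 B3 B4 A12 A13 A14 A23 A24 A34 C12 C13 C14 C23 C24 C34 D) :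
    Side F1 F3 F2 F4 B1 B3 B2 B4 A13 A12 A14 A23 A34 A24 C13 C12 C14 C23 C34 C24 D where
  p12 := h.p13
  p13 := h.p12
  p14 := h.p14
  p23 := h.p23.symm
  p24 := h.p34
  p34 := h.p24
  t123 := h.t123.swap23
  t124 := h.t134
  t134 := h.t124
  t234 := h.t234.swap12
  tot := by have := h.tot; omega

theorem swap34 (h : Side F1 F2 F3 F4 B1 B2 B3 B4 A12 A13 A14 A23 A24 A34 C12 C13 C14 C23 C24 C34 D) :
    Side F1 F2 F4 F3 B1 B2 B4 B3 A12 A14 A13 A24 A23 A34 C12 C14 C13 C24 C23 C34 D where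
  p12 := h.p12
  p13 := h.p14
  p14 := h.p13
  p23 := h.p24
  p24 := h.p23
  p34 := h.p34.symm
  t123 := h.t124
  t124 := h.t123
  t134 := h.t134.swap23
  t234 := h.t234.swap23
  tot := by have := h.tot; omega

theorem d_ne0 (h : Side F1 F2 F3 F4 B1 B2 B3 B4 A12 A13 A14 A23 A24 A34 C12 C13 C14 C23 C24 C34 D) :
    1 ≤ A12 + C12 := by
  have h1 := h.p12.1
  have h2 := h.p34.1
  have h3 := h.t123.1
  have h4 := h.t124.1
  have h5 := h.tot
  omega

theorem d_ne1 (h : Side F1 F2 F3 F4 B1 B2 B3 B4 A12 A13 A14 A23 A24 A34 C12 C13 C14 C23 C24 C34 D) :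
    2 ≤ A12 + C12 := by
  have h0 := h.d_ne0
  by_contra hc
  have h1 := h.p12.1
  have h1' : 6 ≤ (F1 + F2) + (B1 + B2) := by
    by_contra h6
    have := h.p12.2.1 (by omega)
    omega
  have h2 := h.p34.1
  have h3 := h.t123.1
  have h4 := h.t124.1
  have h5 := h.tot
  have h6 : D = 0 := by omega
  have h7 := h.p34.2.2
  have h8 := h.swap23.swap12.swap34.swap23.d_ne0
  omega

theorem all2 (h : Side F1 F2 F3 F4 B1 B2 B3 B4 A12 A13 A14 A23 A24 A34 C12 C13 C14 C23 C24 C34 D) :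
    2 ≤ A12 + C12 ∧ 2 ≤ A13 + C13 ∧ 2 ≤ A14 + C14 ∧ 2 ≤ A23 + C23 ∧ 2 ≤ A24 + C24 ∧
      2 ≤ A34 + C34 :=
  ⟨h.d_ne1, h.swap23.d_ne1, h.swap34.swap23.d_ne1, h.swap12.swap23.d_ne1,
    h.swap12.swap34.swap23.d_ne1, h.swap23.swap12.swap34.swap23.d_ne1⟩

/-- for `D ≤ 1` -/
theorem pair1 {F1 F2 B1 B2 A C D : ℕ} (h : PairOK F1 F2 B1 B2 A C D) (hd : 2 ≤ A + C) (hD : D ≤ 1) :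
    7 ≤ (F1 + F2) + (B1 + B2) + (A + C) ∨ 4 ≤ A + C := by
  have h1 := h.1
  by_contra hc
  have := h.2.1 (by omega)
  omega

theorem d3of (h : Side F1 F2 F3 F4 B1 B2 B3 B4 A12 A13 A14 A23 A24 A34 C12 C13 C14 C23 C24 C34 D)
    (hD : D = 1) : A12 + C12 ≤ 3 := by
  obtain ⟨d1, d2, d3, d4, d5, d6⟩ := h.all2
  by_contra hc
  have h5 := h.tot
  have h1 := h.p13.1
  have h2 := h.p24.1
  have h3 := h.p14.1
  have h4 := h.p23.1
  have q1 := pair1 h.p13 d2 (by omega)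
  have q2 := pair1 h.p24 d5 (by omega)
  omega

theorem D_ne1 (h : Side F1 F2 F3 F4 B1 B2 B3 B4 A12 A13 A14 A23 A24 A34 C12 C13 C14 C23 C24 C34 D) :
    D ≠ 1 := by
  intro hD
  obtain ⟨d1, d2, d3, d4, d5, d6⟩ := h.all2
  have e1 := h.d3of hD
  have e2 := h.swap23.d3of hD
  have e3 := h.swap34.swap23.d3of hD
  have e4 := h.swap12.swap23.d3of hD
  have e5 := h.swap12.swap34.swap23.d3of hD
  have e6 := h.swap23.swap12.swap34.swap23.d3of hD
  have q1 := (pair1 h.p12 d1 (by omega)).resolve_right (by omega)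
  have q2 := (pair1 h.p13 d2 (by omega)).resolve_right (by omega)
  have q3 := (pair1 h.p14 d3 (by omega)).resolve_right (by omega)
  have q4 := (pair1 h.p23 d4 (by omega)).resolve_right (by omega)
  have q5 := (pair1 h.p24 d5 (by omega)).resolve_right (by omega)
  have q6 := (pair1 h.p34 d6 (by omega)).resolve_right (by omega)
  have h5 := h.tot
  omega

/-- the configuration `α` with special index `1` -/
def Alpha (A12 A13 A14 A23 A24 A34 : ℕ) : Prop :=
  A12 = 0 ∧ A13 = 0 ∧ A14 = 0 ∧ A23 = 2 ∧ A24 = 2 ∧ A34 = 2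

theorem D0 (h : Side F1 F2 F3 F4 B1 B2 B3 B4 A12 A13 A14 A23 A24 A34 C12 C13 C14 C23 C24 C34 D)
    (hD : D = 0) : A12 + C12 = 2 ∧ A13 + C13 = 2 ∧ A14 + C14 = 2 ∧ A23 + C23 = 2 ∧ A24 + C24 = 2 ∧
      A34 + C34 = 2 := by
  obtain ⟨d1, d2, d3, d4, d5, d6⟩ := h.all2
  have q1 := h.p12.2.2
  have q2 := h.p13.2.2
  have q3 := h.p14.2.2
  have q4 := h.p23.2.2
  have q5 := h.p24.2.2
  have q6 := h.p34.2.2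
  have h5 := h.tot
  have hS : (A12 + C12) + (A13 + C13) + (A14 + C14) + (A23 + C23) + (A24 + C24) + (A34 + C34) ≤ 13 := by
    omega
  have key : ∀ {F1 F2 F3 F4 B1 B2 B3 B4 A12 A13 A14 A23 A24 A34 C12 C13 C14 C23 C24 C34 : ℕ},
      Side F1 F2 F3 F4 B1 B2 B3 B4 A12 A13 A14 A23 A24 A34 C12 C13 C14 C23 C24 C34 D →
      (A12 + C12) + (A13 + C13) + (A14 + C14) + (A23 + C23) + (A24 + C24) + (A34 + C34) ≤ 13 →
      A12 + C12 = 2 := by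
    clear * - hD
    intro F1 F2 F3 F4 B1 B2 B3 B4 A12 A13 A14 A23 A24 A34 C12 C13 C14 C23 C24 C34 h hS
    obtain ⟨d1, d2, d3, d4, d5, d6⟩ := h.all2
    by_contra hc
    have q1 := h.p12.2.2
    have q2 := h.p13.2.2
    have q3 := h.p14.2.2
    have q4 := h.p23.2.2
    have q5 := h.p24.2.2
    have q6 := h.p34.2.2
    have h5 := h.tot
    omega
  refine ⟨key h hS, key h.swap23 (by omega), key h.swap34.swap23 (by omega), key h.swap12.swap23 (by omega),
    key h.swap12.swap34.swap23 (by omega), key h.swap23.swap12.swap34.swap23 (by omega)⟩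

theorem alpha1 (h : Side F1 F2 F3 F4 B1 B2 B3 B4 A12 A13 A14 A23 A24 A34 C12 C13 C14 C23 C24 C34 D)
    (hD : D = 0) (hf : F1 + B1 ≤ 2) : Alpha A12 A13 A14 A23 A24 A34 := by
  obtain ⟨d1, d2, d3, d4, d5, d6⟩ := h.D0 hD
  have q1 := h.p12.2.2
  have q2 := h.p13.2.2
  have q3 := h.p14.2.2
  have h5 := h.tot
  have t1 := h.t123.2.1
  have t2 := h.t124.2.1
  have t3 := h.t134.2.1
  have a1 : A12 = 0 := by omega
  have a2 : A13 = 0 := by omega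
  have a3 : A14 = 0 := by omega
  refine ⟨a1, a2, a3, by omega, by omega, by omega⟩

theorem alpha (h : Side F1 F2 F3 F4 B1 B2 B3 B4 A12 A13 A14 A23 A24 A34 C12 C13 C14 C23 C24 C34 D)
    (hD : D = 0) :
    Alpha A12 A13 A14 A23 A24 A34 ∨ Alpha A12 A23 A24 A13 A14 A34 ∨
    Alpha A13 A23 A34 A12 A14 A24 ∨ Alpha A14 A24 A34 A12 A13 A23 := by
  have h5 := h.tot
  obtain ⟨d1, d2, d3, d4, d5, d6⟩ := h.D0 hD
  have : F1 + B1 ≤ 2 ∨ F2 + B2 ≤ 2 ∨ F3 + B3 ≤ 2 ∨ F4 + B4 ≤ 2 := by omega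
  rcases this with hf | hf | hf | hf
  · exact Or.inl (h.alpha1 hD hf)
  · exact Or.inr (Or.inl (h.swap12.alpha1 hD hf))
  · exact Or.inr (Or.inr (Or.inl (h.swap23.swap12.alpha1 hD hf)))
  · exact Or.inr (Or.inr (Or.inr (h.swap34.swap23.swap12.alpha1 hD hf)))

theorem tight {F1 F2 B1 B2 A C D : ℕ} (h : PairOK F1 F2 B1 B2 A C D) (hd : 2 ≤ A + C)
    (hd' : A + C ≤ 3) (ht : (F1 + F2) + (B1 + B2) + (A + C) ≤ 6) : A = 2 ∧ B1 = 0 ∧ B2 = 0 := by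
  have h1 := h.1
  have := h.2.1 (by omega)
  omega

/-- the configuration `γ` is impossible or has many crossings -/
theorem gam (h : Side F1 F2 F3 F4 B1 B2 B3 B4 A12 A13 A14 A23 A24 A34 C12 C13 C14 C23 C24 C34 D)
    (hD : 2 ≤ D) (h3 : 3 ≤ A12 + C12) :
    14 ≤ (A12 + A13 + A14 + A23 + A24 + A34) + (B1 + B2 + B3 + B4) + D ∧
    (A12 + A13 + A14 + A23 + A24 + A34) + (C12 + C13 + C14 + C23 + C24 + C34) ≤ 13 := by
  obtain ⟨d1, d2, d3, d4, d5, d6⟩ := h.all2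
  have h5 := h.tot
  have r1 := h.p12.1
  have r2 := h.p13.1
  have r3 := h.p14.1
  have r4 := h.p23.1
  have r5 := h.p24.1
  have r6 := h.p34.1
  have t2 := tight h.p13 d2 (by omega) (by omega)
  have t3 := tight h.p14 d3 (by omega) (by omega)
  have t4 := tight h.p23 d4 (by omega) (by omega)
  have t5 := tight h.p24 d5 (by omega) (by omega)
  have t6 := tight h.p34 d6 (by omega) (by omega)
  have k := h.t123.2.2
  refine ⟨?_, ?_⟩ <;> omega

/-- three tight stars -/
theorem beta1 (h : Side F1 F2 F3 F4 B1 B2 B3 B4 A12 A13 A14 A23 A24 A34 C12 C13 C14 C23 C24 C34 D)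
    (hD : 2 ≤ D) (h1 : A12 + C12 = 2) (h2 : A13 + C13 = 2) (h3 : A14 + C14 = 2) (h4 : A23 + C23 = 2)
    (h5 : A24 + C24 = 2) (h6 : A34 + C34 = 2)
    (f1 : F1 + B1 ≤ 2) (f2 : F2 + B2 ≤ 2) (f3 : F3 + B3 ≤ 2) (f4 : F4 + B4 ≤ 3) :
    13 ≤ (A12 + A13 + A14 + A23 + A24 + A34) + (B1 + B2 + B3 + B4) + D := by
  have t1 := tight h.p12 (by omega) (by omega) (by omega)
  have t2 := tight h.p13 (by omega) (by omega) (by omega)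
  have t4 := tight h.p23 (by omega) (by omega) (by omega)
  have k1 := h.t124.2.2
  have k2 := h.t134.2.2
  have k3 := h.t234.2.2
  by_cases hD2 : D = 2
  · omega
  · have h5 := h.tot
    have r1 := h.p14.1
    have r2 := h.p12.1
    have r3 := h.p13.1
    have r4 := h.p23.1
    have t3 := tight h.p14 (by omega) (by omega) (by omega)
    have t5 := tight h.p24 (by omega) (by omega) (by omega)
    have t6 := tight h.p34 (by omega) (by omega) (by omega)
    omega

theorem D2 (h : Side F1 F2 F3 F4 B1 B2 B3 B4 A12 A13 A14 A23 A24 A34 C12 C13 C14 C23 C24 C34 D)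
    (hD : 2 ≤ D) :
    (A12 + A13 + A14 + A23 + A24 + A34) + (C12 + C13 + C14 + C23 + C24 + C34) ≤ 13 ∧
    (14 ≤ (A12 + A13 + A14 + A23 + A24 + A34) + (B1 + B2 + B3 + B4) + D ∨
     (13 ≤ (A12 + A13 + A14 + A23 + A24 + A34) + (B1 + B2 + B3 + B4) + D ∧
      (A12 + A13 + A14 + A23 + A24 + A34) + (C12 + C13 + C14 + C23 + C24 + C34) = 12)) := by
  obtain ⟨d1, d2, d3, d4, d5, d6⟩ := h.all2
  by_cases e1 : A12 + C12 = 2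
  swap
  · have := h.gam hD (by omega)
    omega
  by_cases e2 : A13 + C13 = 2
  swap
  · have := h.swap23.gam hD (by omega)
    omega
  by_cases e3 : A14 + C14 = 2
  swap
  · have := h.swap34.swap23.gam hD (by omega)
    omega
  by_cases e4 : A23 + C23 = 2
  swap
  · have := h.swap12.swap23.gam hD (by omega)
    omega
  by_cases e5 : A24 + C24 = 2
  swap
  · have := h.swap12.swap34.swap23.gam hD (by omega)
    omega
  by_cases e6 : A34 + C34 = 2
  swap
  · have := h.swap23.swap12.swap34.swap23.gam hD (by omega)
    omega
  have h5 := h.tot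
  have r1 := h.p12.1
  have r2 := h.p13.1
  have r3 := h.p14.1
  have r4 := h.p23.1
  have r5 := h.p24.1
  have r6 := h.p34.1
  have f0 : 2 ≤ F1 + B1 ∧ 2 ≤ F2 + B2 ∧ 2 ≤ F3 + B3 ∧ 2 ≤ F4 + B4 := by
    refine ⟨?_, ?_, ?_, ?_⟩ <;> omega
  have hS : (A12 + A13 + A14 + A23 + A24 + A34) + (C12 + C13 + C14 + C23 + C24 + C34) = 12 := by omega
  refine ⟨hS.le.trans (by norm_num), Or.inr ⟨?_, hS⟩⟩
  by_cases g1 : 3 ≤ F1 + B1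
  · have := h.swap12.swap23.swap34.beta1 hD (by omega) (by omega) (by omega) (by omega) (by omega)
      (by omega) (by omega) (by omega) (by omega) (by omega)
    omega
  by_cases g2 : 3 ≤ F2 + B2
  · have := h.swap23.swap34.beta1 hD (by omega) (by omega) (by omega) (by omega) (by omega)
      (by omega) (by omega) (by omega) (by omega) (by omega)
    omega
  by_cases g3 : 3 ≤ F3 + B3
  · have := h.swap34.beta1 hD (by omega) (by omega) (by omega) (by omega) (by omega)
      (by omega) (by omega) (by omega) (by omega) (by omega)
    omega
  exact h.beta1 hD (by omega) (by omega) (by omega) (by omega) (by omega)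
      (by omega) (by omega) (by omega) (by omega) (by omega)

end Side
/-! ### Sums of `K_{3,3}` counts -/

theorem tr33 (a0_0 a0_1 a0_2 a1_0 a1_1 a1_2 a2_0 a2_1 a2_2 : ℕ) :
    (a0_0 + a0_1 + a0_2) + (a1_0 + a1_1 + a1_2) + (a2_0 + a2_1 + a2_2) =
    (a0_0 + a1_0 + a2_0) + (a0_1 + a1_1 + a2_1) + (a0_2 + a1_2 + a2_2) := by
  ring

theorem tr3x10 (a0_0 a0_1 a0_2 a0_3 a0_4 a0_5 a0_6 a0_7 a0_8 a0_9 a1_0 a1_1 a1_2 a1_3 a1_4 a1_5 a1_6 a1_7 a1_8 a1_9 a2_0 a2_1 a2_2 a2_3 a2_4 a2_5 a2_6 a2_7 a2_8 a2_9 : ℕ) :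
    (a0_0 + a0_1 + a0_2 + a0_3 + a0_4 + a0_5 + a0_6 + a0_7 + a0_8 + a0_9) + (a1_0 + a1_1 + a1_2 + a1_3 + a1_4 + a1_5 + a1_6 + a1_7 + a1_8 + a1_9) + (a2_0 + a2_1 + a2_2 + a2_3 + a2_4 + a2_5 + a2_6 + a2_7 + a2_8 + a2_9) =
    (a0_0 + a1_0 + a2_0) + (a0_1 + a1_1 + a2_1) + (a0_2 + a1_2 + a2_2) + (a0_3 + a1_3 + a2_3) + (a0_4 + a1_4 + a2_4) + (a0_5 + a1_5 + a2_5) + (a0_6 + a1_6 + a2_6) + (a0_7 + a1_7 + a2_7) + (a0_8 + a1_8 + a2_8) + (a0_9 + a1_9 + a2_9) := by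
  ring

theorem tr3x6 (a0_0 a0_1 a0_2 a0_3 a0_4 a0_5 a1_0 a1_1 a1_2 a1_3 a1_4 a1_5 a2_0 a2_1 a2_2 a2_3 a2_4 a2_5 : ℕ) :
    (a0_0 + a0_1 + a0_2 + a0_3 + a0_4 + a0_5) + (a1_0 + a1_1 + a1_2 + a1_3 + a1_4 + a1_5) + (a2_0 + a2_1 + a2_2 + a2_3 + a2_4 + a2_5) =
    (a0_0 + a1_0 + a2_0) + (a0_1 + a1_1 + a2_1) + (a0_2 + a1_2 + a2_2) + (a0_3 + a1_3 + a2_3) + (a0_4 + a1_4 + a2_4) + (a0_5 + a1_5 + a2_5) := by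
  ring

theorem tr6x10 (a0_0 a0_1 a0_2 a0_3 a0_4 a0_5 a0_6 a0_7 a0_8 a0_9 a1_0 a1_1 a1_2 a1_3 a1_4 a1_5 a1_6 a1_7 a1_8 a1_9 a2_0 a2_1 a2_2 a2_3 a2_4 a2_5 a2_6 a2_7 a2_8 a2_9 a3_0 a3_1 a3_2 a3_3 a3_4 a3_5 a3_6 a3_7 a3_8 a3_9 a4_0 a4_1 a4_2 a4_3 a4_4 a4_5 a4_6 a4_7 a4_8 a4_9 a5_0 a5_1 a5_2 a5_3 a5_4 a5_5 a5_6 a5_7 a5_8 a5_9 : ℕ) :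
    (a0_0 + a0_1 + a0_2 + a0_3 + a0_4 + a0_5 + a0_6 + a0_7 + a0_8 + a0_9) + (a1_0 + a1_1 + a1_2 + a1_3 + a1_4 + a1_5 + a1_6 + a1_7 + a1_8 + a1_9) + (a2_0 + a2_1 + a2_2 + a2_3 + a2_4 + a2_5 + a2_6 + a2_7 + a2_8 + a2_9) + (a3_0 + a3_1 + a3_2 + a3_3 + a3_4 + a3_5 + a3_6 + a3_7 + a3_8 + a3_9) + (a4_0 + a4_1 + a4_2 + a4_3 + a4_4 + a4_5 + a4_6 + a4_7 + a4_8 + a4_9) + (a5_0 + a5_1 + a5_2 + a5_3 + a5_4 + a5_5 + a5_6 + a5_7 + a5_8 + a5_9) =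
    (a0_0 + a1_0 + a2_0 + a3_0 + a4_0 + a5_0) + (a0_1 + a1_1 + a2_1 + a3_1 + a4_1 + a5_1) + (a0_2 + a1_2 + a2_2 + a3_2 + a4_2 + a5_2) + (a0_3 + a1_3 + a2_3 + a3_3 + a4_3 + a5_3) + (a0_4 + a1_4 + a2_4 + a3_4 + a4_4 + a5_4) + (a0_5 + a1_5 + a2_5 + a3_5 + a4_5 + a5_5) + (a0_6 + a1_6 + a2_6 + a3_6 + a4_6 + a5_6) + (a0_7 + a1_7 + a2_7 + a3_7 + a4_7 + a5_7) + (a0_8 + a1_8 + a2_8 + a3_8 + a4_8 + a5_8) + (a0_9 + a1_9 + a2_9 + a3_9 + a4_9 + a5_9) := by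
  ring

theorem tr66 (a0_0 a0_1 a0_2 a0_3 a0_4 a0_5 a1_0 a1_1 a1_2 a1_3 a1_4 a1_5 a2_0 a2_1 a2_2 a2_3 a2_4 a2_5 a3_0 a3_1 a3_2 a3_3 a3_4 a3_5 a4_0 a4_1 a4_2 a4_3 a4_4 a4_5 a5_0 a5_1 a5_2 a5_3 a5_4 a5_5 : ℕ) :
    (a0_0 + a0_1 + a0_2 + a0_3 + a0_4 + a0_5) + (a1_0 + a1_1 + a1_2 + a1_3 + a1_4 + a1_5) + (a2_0 + a2_1 + a2_2 + a2_3 + a2_4 + a2_5) + (a3_0 + a3_1 + a3_2 + a3_3 + a3_4 + a3_5) + (a4_0 + a4_1 + a4_2 + a4_3 + a4_4 + a4_5) + (a5_0 + a5_1 + a5_2 + a5_3 + a5_4 + a5_5) =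
    (a0_0 + a1_0 + a2_0 + a3_0 + a4_0 + a5_0) + (a0_1 + a1_1 + a2_1 + a3_1 + a4_1 + a5_1) + (a0_2 + a1_2 + a2_2 + a3_2 + a4_2 + a5_2) + (a0_3 + a1_3 + a2_3 + a3_3 + a4_3 + a5_3) + (a0_4 + a1_4 + a2_4 + a3_4 + a4_4 + a5_4) + (a0_5 + a1_5 + a2_5 + a3_5 + a4_5 + a5_5) := by
  ring

theorem tr44 (a0_0 a0_1 a0_2 a0_3 a1_0 a1_1 a1_2 a1_3 a2_0 a2_1 a2_2 a2_3 a3_0 a3_1 a3_2 a3_3 : ℕ) :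
    (a0_0 + a0_1 + a0_2 + a0_3) + (a1_0 + a1_1 + a1_2 + a1_3) + (a2_0 + a2_1 + a2_2 + a2_3) + (a3_0 + a3_1 + a3_2 + a3_3) =
    (a0_0 + a1_0 + a2_0 + a3_0) + (a0_1 + a1_1 + a2_1 + a3_1) + (a0_2 + a1_2 + a2_2 + a3_2) + (a0_3 + a1_3 + a2_3 + a3_3) := by
  ring

theorem tr46 (a0_0 a0_1 a0_2 a0_3 a0_4 a0_5 a1_0 a1_1 a1_2 a1_3 a1_4 a1_5 a2_0 a2_1 a2_2 a2_3 a2_4 a2_5 a3_0 a3_1 a3_2 a3_3 a3_4 a3_5 : ℕ) :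
    (a0_0 + a0_1 + a0_2 + a0_3 + a0_4 + a0_5) + (a1_0 + a1_1 + a1_2 + a1_3 + a1_4 + a1_5) + (a2_0 + a2_1 + a2_2 + a2_3 + a2_4 + a2_5) + (a3_0 + a3_1 + a3_2 + a3_3 + a3_4 + a3_5) =
    (a0_0 + a1_0 + a2_0 + a3_0) + (a0_1 + a1_1 + a2_1 + a3_1) + (a0_2 + a1_2 + a2_2 + a3_2) + (a0_3 + a1_3 + a2_3 + a3_3) + (a0_4 + a1_4 + a2_4 + a3_4) + (a0_5 + a1_5 + a2_5 + a3_5) := by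
  ring

/-- crossings between the stars of `u` and `v` at the leaves `W` -/
def H5 {m : ℕ} (c : Fin m → Fin m → Fin m → Fin m → ℕ) (W : Fin 5 → Fin m) (u v : Fin m) : ℕ :=
  q2 c u v (W 0) (W 1) + q2 c u v (W 0) (W 2) + q2 c u v (W 0) (W 3) + q2 c u v (W 0) (W 4) + q2 c u v (W 1) (W 2) + q2 c u v (W 1) (W 3) + q2 c u v (W 1) (W 4) + q2 c u v (W 2) (W 3) + q2 c u v (W 2) (W 4) + q2 c u v (W 3) (W 4)

def H6 {m : ℕ} (c : Fin m → Fin m → Fin m → Fin m → ℕ) (W : Fin 6 → Fin m) (u v : Fin m) : ℕ :=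
  q2 c u v (W 0) (W 1) + q2 c u v (W 0) (W 2) + q2 c u v (W 0) (W 3) + q2 c u v (W 0) (W 4) + q2 c u v (W 0) (W 5) + q2 c u v (W 1) (W 2) + q2 c u v (W 1) (W 3) + q2 c u v (W 1) (W 4) + q2 c u v (W 1) (W 5) + q2 c u v (W 2) (W 3) + q2 c u v (W 2) (W 4) + q2 c u v (W 2) (W 5) + q2 c u v (W 3) (W 4) + q2 c u v (W 3) (W 5) + q2 c u v (W 4) (W 5)

def gg {m : ℕ} (c : Fin m → Fin m → Fin m → Fin m → ℕ) (U : Fin 3 → Fin m) (w w' : Fin m) : ℕ :=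
  q2 c (U 0) (U 1) w w' + q2 c (U 0) (U 2) w w' + q2 c (U 1) (U 2) w w'

theorem XSys.k33g {m k : ℕ} {col : Fin m → ℕ} {c} (h : XSys col c) (U : Fin 3 → Fin m)
    (W : Fin k → Fin m) (hU : Function.Injective U) (hW : Function.Injective W)
    (hc : ∀ i j, col (U i) ≠ col (W j)) (i j l : Fin k) (hij : i ≠ j) (hil : i ≠ l) (hjl : j ≠ l) :
    1 ≤ gg c U (W i) (W j) + gg c U (W i) (W l) + gg c U (W j) (W l) := by
  have hne : ∀ i j, U i ≠ W j := fun i j e => hc i j (congrArg col e)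
  have h01 : U 0 ≠ U 1 := hU.ne (by decide)
  have h02 : U 0 ≠ U 2 := hU.ne (by decide)
  have h12 : U 1 ≠ U 2 := hU.ne (by decide)
  have w1 := hW.ne hij
  have w2 := hW.ne hil
  have w3 := hW.ne hjl
  have inj : Function.Injective ![U 0, U 1, U 2, W i, W j, W l] := by
    rw [← List.nodup_ofFn]
    simp [List.ofFn_succ, h01, h02, h12, w1, w2, w3, hne]
  have := h.k33_odd (U 0) (U 1) (U 2) (W i) (W j) (W l) inj (by
    intro a ha b hb
    simp only [List.mem_cons, List.not_mem_nil, or_false] at ha hb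
    rcases ha with rfl | rfl | rfl <;> rcases hb with rfl | rfl | rfl <;> exact hc _ _)
  unfold s33 at this
  rw [tr33] at this
  unfold gg
  omega

theorem ar35 {p01 p02 p03 p04 p12 p13 p14 p23 p24 p34 : ℕ} (h012 : 1 ≤ p01 + p02 + p12) (h013 : 1 ≤ p01 + p03 + p13) (h014 : 1 ≤ p01 + p04 + p14) (h023 : 1 ≤ p02 + p03 + p23) (h024 : 1 ≤ p02 + p04 + p24) (h034 : 1 ≤ p03 + p04 + p34) (h123 : 1 ≤ p12 + p13 + p23) (h124 : 1 ≤ p12 + p14 + p24) (h134 : 1 ≤ p13 + p14 + p34) (h234 : 1 ≤ p23 + p24 + p34) :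
    4 ≤ p01 + p02 + p03 + p04 + p12 + p13 + p14 + p23 + p24 + p34 := by
  omega

theorem ar36 {p01 p02 p03 p04 p05 p12 p13 p14 p15 p23 p24 p25 p34 p35 p45 : ℕ} (h0 : 4 ≤ p12 + p13 + p14 + p15 + p23 + p24 + p25 + p34 + p35 + p45) (h1 : 4 ≤ p02 + p03 + p04 + p05 + p23 + p24 + p25 + p34 + p35 + p45) (h2 : 4 ≤ p01 + p03 + p04 + p05 + p13 + p14 + p15 + p34 + p35 + p45) (h3 : 4 ≤ p01 + p02 + p04 + p05 + p12 + p14 + p15 + p24 + p25 + p45) (h4 : 4 ≤ p01 + p02 + p03 + p05 + p12 + p13 + p15 + p23 + p25 + p35) (h5 : 4 ≤ p01 + p02 + p03 + p04 + p12 + p13 + p14 + p23 + p24 + p34) :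
    6 ≤ p01 + p02 + p03 + p04 + p05 + p12 + p13 + p14 + p15 + p23 + p24 + p25 + p34 + p35 + p45 := by
  omega

theorem XSys.k35g {m : ℕ} {col : Fin m → ℕ} {c} (h : XSys col c) (U : Fin 3 → Fin m)
    (W : Fin 5 → Fin m) (hU : Function.Injective U) (hW : Function.Injective W)
    (hc : ∀ i j, col (U i) ≠ col (W j)) :
    4 ≤ gg c U (W 0) (W 1) + gg c U (W 0) (W 2) + gg c U (W 0) (W 3) + gg c U (W 0) (W 4) + gg c U (W 1) (W 2) + gg c U (W 1) (W 3) + gg c U (W 1) (W 4) + gg c U (W 2) (W 3) + gg c U (W 2) (W 4) + gg c U (W 3) (W 4) :=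
  ar35 (h.k33g U W hU hW hc 0 1 2 (by decide) (by decide) (by decide)) (h.k33g U W hU hW hc 0 1 3 (by decide) (by decide) (by decide)) (h.k33g U W hU hW hc 0 1 4 (by decide) (by decide) (by decide)) (h.k33g U W hU hW hc 0 2 3 (by decide) (by decide) (by decide)) (h.k33g U W hU hW hc 0 2 4 (by decide) (by decide) (by decide)) (h.k33g U W hU hW hc 0 3 4 (by decide) (by decide) (by decide)) (h.k33g U W hU hW hc 1 2 3 (by decide) (by decide) (by decide)) (h.k33g U W hU hW hc 1 2 4 (by decide) (by decide) (by decide)) (h.k33g U W hU hW hc 1 3 4 (by decide) (by decide) (by decide)) (h.k33g U W hU hW hc 2 3 4 (by decide) (by decide) (by decide))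

theorem XSys.k35 {m : ℕ} {col : Fin m → ℕ} {c} (h : XSys col c) (U : Fin 3 → Fin m)
    (W : Fin 5 → Fin m) (hU : Function.Injective U) (hW : Function.Injective W)
    (hc : ∀ i j, col (U i) ≠ col (W j)) :
    4 ≤ H5 c W (U 0) (U 1) + H5 c W (U 0) (U 2) + H5 c W (U 1) (U 2) := by
  unfold H5
  rw [tr3x10]
  exact h.k35g U W hU hW hc

theorem XSys.k36g {m : ℕ} {col : Fin m → ℕ} {c} (h : XSys col c) (U : Fin 3 → Fin m)
    (W : Fin 6 → Fin m) (hU : Function.Injective U) (hW : Function.Injective W)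
    (hc : ∀ i j, col (U i) ≠ col (W j)) :
    6 ≤ gg c U (W 0) (W 1) + gg c U (W 0) (W 2) + gg c U (W 0) (W 3) + gg c U (W 0) (W 4) + gg c U (W 0) (W 5) + gg c U (W 1) (W 2) + gg c U (W 1) (W 3) + gg c U (W 1) (W 4) + gg c U (W 1) (W 5) + gg c U (W 2) (W 3) + gg c U (W 2) (W 4) + gg c U (W 2) (W 5) + gg c U (W 3) (W 4) + gg c U (W 3) (W 5) + gg c U (W 4) (W 5) :=
  ar36 (h.k35g U (fun i => W (Fin.succAbove 0 i)) hU (hW.comp Fin.succAbove_right_injective) (fun i j => hc i _))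
    (h.k35g U (fun i => W (Fin.succAbove 1 i)) hU (hW.comp Fin.succAbove_right_injective) (fun i j => hc i _))
    (h.k35g U (fun i => W (Fin.succAbove 2 i)) hU (hW.comp Fin.succAbove_right_injective) (fun i j => hc i _))
    (h.k35g U (fun i => W (Fin.succAbove 3 i)) hU (hW.comp Fin.succAbove_right_injective) (fun i j => hc i _))
    (h.k35g U (fun i => W (Fin.succAbove 4 i)) hU (hW.comp Fin.succAbove_right_injective) (fun i j => hc i _))
    (h.k35g U (fun i => W (Fin.succAbove 5 i)) hU (hW.comp Fin.succAbove_right_injective) (fun i j => hc i _))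

theorem XSys.k43g {m : ℕ} {col : Fin m → ℕ} {c} (h : XSys col c) (U : Fin 3 → Fin m)
    (W : Fin 4 → Fin m) (hU : Function.Injective U) (hW : Function.Injective W)
    (hc : ∀ i j, col (U i) ≠ col (W j)) :
    2 ≤ gg c U (W 0) (W 1) + gg c U (W 0) (W 2) + gg c U (W 0) (W 3) + gg c U (W 1) (W 2) + gg c U (W 1) (W 3) +
      gg c U (W 2) (W 3) := by
  have h1 := h.k33g U W hU hW hc 0 1 2 (by decide) (by decide) (by decide)
  have h2 := h.k33g U W hU hW hc 0 1 3 (by decide) (by decide) (by decide)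
  have h3 := h.k33g U W hU hW hc 0 2 3 (by decide) (by decide) (by decide)
  have h4 := h.k33g U W hU hW hc 1 2 3 (by decide) (by decide) (by decide)
  generalize gg c U (W 0) (W 1) = p01 at *
  generalize gg c U (W 0) (W 2) = p02 at *
  generalize gg c U (W 0) (W 3) = p03 at *
  generalize gg c U (W 1) (W 2) = p12 at *
  generalize gg c U (W 1) (W 3) = p13 at *
  generalize gg c U (W 2) (W 3) = p23 at *
  omega

theorem ar45 {p01 p02 p03 p12 p13 p23 : ℕ} (h1 : 4 ≤ p01 + p02 + p12) (h2 : 4 ≤ p01 + p03 + p13)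
    (h3 : 4 ≤ p02 + p03 + p23) (h4 : 4 ≤ p12 + p13 + p23) :
    8 ≤ p01 + p02 + p03 + p12 + p13 + p23 := by omega

/-! ### The ten vertex system -/

def col10 : Fin 10 → ℕ := ![0, 1, 2, 2, 2, 2, 3, 3, 3, 3]

theorem inj8 : ∀ y y' : Fin 10, 6 ≤ y → 6 ≤ y' → y ≠ y' →
    Function.Injective (![0, 1, y, y', 2, 3, 4, 5] : Fin 8 → Fin 10) := by decide +kernel

theorem col8_10 : ∀ y y' : Fin 10, 6 ≤ y → 6 ≤ y' → ∀ i j : Fin 8, col8 i ≠ col8 j →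
    col10 ((![0, 1, y, y', 2, 3, 4, 5] : Fin 8 → Fin 10) i) ≠
      col10 ((![0, 1, y, y', 2, 3, 4, 5] : Fin 8 → Fin 10) j) := by decide +kernel

theorem pairOK10 {c} (h : XSys col10 c) (y y' : Fin 10) (hy : 6 ≤ y) (hy' : 6 ≤ y') (hne : y ≠ y') :
    PairOK (fS c 0 1 2 3 4 5 y) (fS c 0 1 2 3 4 5 y') (bS c 0 1 2 3 4 5 y) (bS c 0 1 2 3 4 5 y')
      (aS c 2 3 4 5 y y') (cS c 0 1 2 3 4 5 y y') (aS c 2 3 4 5 0 1) :=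
  k1142_8 (h.comap ![0, 1, y, y', 2, 3, 4, 5] (inj8 y y' hy hy' hne) col8 (col8_10 y y' hy hy'))

theorem aS_swap {m : ℕ} {col : Fin m → ℕ} {c} (h : XSys col c) (x1 x2 x3 x4 y y' : Fin m) :
    aS c x1 x2 x3 x4 y y' = q2 c y y' x1 x2 + q2 c y y' x1 x3 + q2 c y y' x1 x4 + q2 c y y' x2 x3 +
      q2 c y y' x2 x4 + q2 c y y' x3 x4 := by
  unfold aS
  rw [h.q2_swap x1 x2, h.q2_swap x1 x3, h.q2_swap x1 x4, h.q2_swap x2 x3, h.q2_swap x2 x4,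
    h.q2_swap x3 x4]

theorem bS_eq {m : ℕ} (c : Fin m → Fin m → Fin m → Fin m → ℕ) (a b x1 x2 x3 x4 y : Fin m) :
    bS c a b x1 x2 x3 x4 y = aS c x1 x2 x3 x4 a y + aS c x1 x2 x3 x4 b y :=
  rear6 _ _ _ _ _ _ _ _ _ _ _ _

theorem rear36 (r0_01 r0_02 r0_03 r0_04 r0_05 r0_12 r0_13 r0_14 r0_15 r0_23 r0_24 r0_25 r0_34 r0_35 r0_45 r1_01 r1_02 r1_03 r1_04 r1_05 r1_12 r1_13 r1_14 r1_15 r1_23 r1_24 r1_25 r1_34 r1_35 r1_45 r2_01 r2_02 r2_03 r2_04 r2_05 r2_12 r2_13 r2_14 r2_15 r2_23 r2_24 r2_25 r2_34 r2_35 r2_45 : ℕ) :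
    (r0_01 + r1_01 + r2_01) + (r0_02 + r1_02 + r2_02) + (r0_03 + r1_03 + r2_03) + (r0_04 + r1_04 + r2_04) + (r0_05 + r1_05 + r2_05) + (r0_12 + r1_12 + r2_12) + (r0_13 + r1_13 + r2_13) + (r0_14 + r1_14 + r2_14) + (r0_15 + r1_15 + r2_15) + (r0_23 + r1_23 + r2_23) + (r0_24 + r1_24 + r2_24) + (r0_25 + r1_25 + r2_25) + (r0_34 + r1_34 + r2_34) + (r0_35 + r1_35 + r2_35) + (r0_45 + r1_45 + r2_45) =
    ((r0_23 + r0_24 + r0_25 + r0_34 + r0_35 + r0_45) + ((r0_02 + r0_12) + (r0_03 + r0_13) + (r0_04 + r0_14) + (r0_05 + r0_15) + r0_01)) + ((r1_23 + r1_24 + r1_25 + r1_34 + r1_35 + r1_45) + ((r1_02 + r1_12) + (r1_03 + r1_13) + (r1_04 + r1_14) + (r1_05 + r1_15) + r1_01)) + ((r2_23 + r2_24 + r2_25 + r2_34 + r2_35 + r2_45) + ((r2_02 + r2_12) + (r2_03 + r2_13) + (r2_04 + r2_14) + (r2_05 + r2_15) + r2_01)) := by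
  ring

theorem arK45 (D p1 p2 p3 r1 r2 r3 a12 a13 a23 : ℕ) :
    D + p1 + p2 + p3 + r1 + r2 + r3 + a12 + a13 + a23 =
      a12 + a13 + a23 + ((p1 + r1) + (p2 + r2) + (p3 + r3)) + D := by ring

theorem injY : ∀ y1 y2 y3 : Fin 10, y1 ≠ y2 → y1 ≠ y3 → y2 ≠ y3 →
    Function.Injective (![y1, y2, y3] : Fin 3 → Fin 10) := by
  intro y1 y2 y3 h1 h2 h3
  rw [← List.nodup_ofFn]
  simp [List.ofFn_succ, h1, h2, h3]

theorem injW : ∀ y1 y2 y3 : Fin 10, 6 ≤ y1 → 6 ≤ y2 → 6 ≤ y3 → y1 ≠ y2 → y1 ≠ y3 → y2 ≠ y3 →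
    Function.Injective (![0, 1, y1, y2, y3] : Fin 5 → Fin 10) := by
  intro y1 y2 y3 h1 h2 h3 h12 h13 h23
  have e0 : ∀ y : Fin 10, 6 ≤ y → (0 : Fin 10) ≠ y ∧ (1 : Fin 10) ≠ y := by decide
  rw [← List.nodup_ofFn]
  simp [List.ofFn_succ, h12, h13, h23, (e0 y1 h1).1, (e0 y2 h2).1, (e0 y3 h3).1, (e0 y1 h1).2, (e0 y2 h2).2, (e0 y3 h3).2]

theorem colY1 : ∀ y : Fin 10, 6 ≤ y → ∀ j : Fin 6, col10 y ≠ col10 ((![0, 1, 2, 3, 4, 5] : Fin 6 → Fin 10) j) := by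
  decide +kernel

theorem colY2 : ∀ y : Fin 10, 6 ≤ y → ∀ j : Fin 4, col10 y ≠ col10 ((![2, 3, 4, 5] : Fin 4 → Fin 10) j) := by
  decide +kernel

theorem colX : ∀ x : Fin 10, 2 ≤ x → x < 6 → (col10 x ≠ col10 0 ∧ col10 x ≠ col10 1) ∧
    ∀ y : Fin 10, 6 ≤ y → col10 x ≠ col10 y := by decide +kernel

theorem forall3 {P : Fin 10 → Prop} {y1 y2 y3 : Fin 10} (h1 : P y1) (h2 : P y2) (h3 : P y3) :
    ∀ i : Fin 3, P ((![y1, y2, y3] : Fin 3 → Fin 10) i) := by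
  intro i
  fin_cases i <;> assumption

theorem forall5 {P : Fin 10 → Prop} {y0 y y1 y2 y3 : Fin 10} (ha : P y0) (hb : P y) (h1 : P y1) (h2 : P y2) (h3 : P y3) :
    ∀ i : Fin 5, P ((![y0, y, y1, y2, y3] : Fin 5 → Fin 10) i) := by
  intro i
  fin_cases i <;> assumption

theorem triOK10 {c} (h : XSys col10 c) (y1 y2 y3 : Fin 10) (h1 : 6 ≤ y1) (h2 : 6 ≤ y2) (h3 : 6 ≤ y3)
    (h12 : y1 ≠ y2) (h13 : y1 ≠ y3) (h23 : y2 ≠ y3) :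
    TriOK (bS c 0 1 2 3 4 5 y1) (bS c 0 1 2 3 4 5 y2) (bS c 0 1 2 3 4 5 y3)
      (aS c 2 3 4 5 y1 y2) (aS c 2 3 4 5 y1 y3) (aS c 2 3 4 5 y2 y3)
      (cS c 0 1 2 3 4 5 y1 y2) (cS c 0 1 2 3 4 5 y1 y3) (cS c 0 1 2 3 4 5 y2 y3)
      (aS c 2 3 4 5 0 1) := by
  refine ⟨?_, ?_, ?_⟩
  · have k := h.k36g ![y1, y2, y3] ![0, 1, 2, 3, 4, 5] (injY y1 y2 y3 h12 h13 h23) (by decide +kernel)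
      (forall3 (P := fun y => ∀ j : Fin 6, col10 y ≠ col10 ((![0, 1, 2, 3, 4, 5] : Fin 6 → Fin 10) j)) (colY1 y1 h1) (colY1 y2 h2) (colY1 y3 h3))
    rw [aS_swap h, aS_swap h, aS_swap h]
    refine le_of_le_of_eq k ?_
    exact rear36 _ _ _ _ _ _ _ _ _ _ _ _ _ _ _ _ _ _ _ _ _ _ _ _ _ _ _ _ _ _ _ _ _ _ _ _ _ _ _ _ _ _ _ _ _
  · have k := h.k43g ![y1, y2, y3] ![2, 3, 4, 5] (injY y1 y2 y3 h12 h13 h23) (by decide +kernel)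
      (forall3 (P := fun y => ∀ j : Fin 4, col10 y ≠ col10 ((![2, 3, 4, 5] : Fin 4 → Fin 10) j)) (colY2 y1 h1) (colY2 y2 h2) (colY2 y3 h3))
    rw [aS_swap h, aS_swap h, aS_swap h]
    refine le_of_le_of_eq k ?_
    exact (tr3x6 _ _ _ _ _ _ _ _ _ _ _ _ _ _ _ _ _ _).symm
  · have hW := injW y1 y2 y3 h1 h2 h3 h12 h13 h23
    have hx : ∀ x : Fin 10, 2 ≤ x → x < 6 → ∀ j : Fin 5, col10 x ≠
        col10 ((![0, 1, y1, y2, y3] : Fin 5 → Fin 10) j) := fun x hx hx' =>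
      forall5 (P := fun y => col10 x ≠ col10 y) (colX x hx hx').1.1 (colX x hx hx').1.2 ((colX x hx hx').2 y1 h1) ((colX x hx hx').2 y2 h2)
        ((colX x hx hx').2 y3 h3)
    have x2 := hx 2 (by decide) (by decide)
    have x3 := hx 3 (by decide) (by decide)
    have x4 := hx 4 (by decide) (by decide)
    have x5 := hx 5 (by decide) (by decide)
    have k1 := h.k35 ![2, 3, 4] ![0, 1, y1, y2, y3] (by decide +kernel) hW (forall3 (P := fun x => ∀ j : Fin 5, col10 x ≠ col10 ((![0, 1, y1, y2, y3] : Fin 5 → Fin 10) j)) x2 x3 x4)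
    have k2 := h.k35 ![2, 3, 5] ![0, 1, y1, y2, y3] (by decide +kernel) hW (forall3 (P := fun x => ∀ j : Fin 5, col10 x ≠ col10 ((![0, 1, y1, y2, y3] : Fin 5 → Fin 10) j)) x2 x3 x5)
    have k3 := h.k35 ![2, 4, 5] ![0, 1, y1, y2, y3] (by decide +kernel) hW (forall3 (P := fun x => ∀ j : Fin 5, col10 x ≠ col10 ((![0, 1, y1, y2, y3] : Fin 5 → Fin 10) j)) x2 x4 x5)
    have k4 := h.k35 ![3, 4, 5] ![0, 1, y1, y2, y3] (by decide +kernel) hW (forall3 (P := fun x => ∀ j : Fin 5, col10 x ≠ col10 ((![0, 1, y1, y2, y3] : Fin 5 → Fin 10) j)) x3 x4 x5)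
    have k := ar45 k1 k2 k3 k4
    unfold H5 at k
    rw [tr6x10] at k
    rw [bS_eq, bS_eq, bS_eq]
    refine le_of_le_of_eq k ?_
    exact arK45 _ _ _ _ _ _ _ _ _ _

theorem tr6x5 (a0_0 a0_1 a0_2 a0_3 a0_4 a1_0 a1_1 a1_2 a1_3 a1_4 a2_0 a2_1 a2_2 a2_3 a2_4 a3_0 a3_1 a3_2 a3_3 a3_4 a4_0 a4_1 a4_2 a4_3 a4_4 a5_0 a5_1 a5_2 a5_3 a5_4 : ℕ) :
    (a0_0 + a0_1 + a0_2 + a0_3 + a0_4) + (a1_0 + a1_1 + a1_2 + a1_3 + a1_4) + (a2_0 + a2_1 + a2_2 + a2_3 + a2_4) + (a3_0 + a3_1 + a3_2 + a3_3 + a3_4) + (a4_0 + a4_1 + a4_2 + a4_3 + a4_4) + (a5_0 + a5_1 + a5_2 + a5_3 + a5_4) =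
    (a0_0 + a1_0 + a2_0 + a3_0 + a4_0 + a5_0) + (a0_1 + a1_1 + a2_1 + a3_1 + a4_1 + a5_1) + (a0_2 + a1_2 + a2_2 + a3_2 + a4_2 + a5_2) + (a0_3 + a1_3 + a2_3 + a3_3 + a4_3 + a5_3) + (a0_4 + a1_4 + a2_4 + a3_4 + a4_4 + a5_4) := by
  ring

/-- the total number of odd pairs -/
def T10 (c : Fin 10 → Fin 10 → Fin 10 → Fin 10 → ℕ) : ℕ :=
  aS c 2 3 4 5 0 1 + ((fS c 0 1 2 3 4 5 6 + fS c 0 1 2 3 4 5 7 + fS c 0 1 2 3 4 5 8 + fS c 0 1 2 3 4 5 9) +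
    (bS c 0 1 2 3 4 5 6 + bS c 0 1 2 3 4 5 7 + bS c 0 1 2 3 4 5 8 + bS c 0 1 2 3 4 5 9)) +
  ((aS c 2 3 4 5 6 7 + aS c 2 3 4 5 6 8 + aS c 2 3 4 5 6 9 + aS c 2 3 4 5 7 8 + aS c 2 3 4 5 7 9 + aS c 2 3 4 5 8 9) +
   (cS c 0 1 2 3 4 5 6 7 + cS c 0 1 2 3 4 5 6 8 + cS c 0 1 2 3 4 5 6 9 + cS c 0 1 2 3 4 5 7 8 + cS c 0 1 2 3 4 5 7 9 + cS c 0 1 2 3 4 5 8 9))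

theorem side10 {c} (h : XSys col10 c) (hT : T10 c ≤ 23) :
    Side (fS c 0 1 2 3 4 5 6) (fS c 0 1 2 3 4 5 7) (fS c 0 1 2 3 4 5 8) (fS c 0 1 2 3 4 5 9) (bS c 0 1 2 3 4 5 6) (bS c 0 1 2 3 4 5 7) (bS c 0 1 2 3 4 5 8) (bS c 0 1 2 3 4 5 9) (aS c 2 3 4 5 6 7) (aS c 2 3 4 5 6 8) (aS c 2 3 4 5 6 9) (aS c 2 3 4 5 7 8) (aS c 2 3 4 5 7 9) (aS c 2 3 4 5 8 9) (cS c 0 1 2 3 4 5 6 7) (cS c 0 1 2 3 4 5 6 8) (cS c 0 1 2 3 4 5 6 9) (cS c 0 1 2 3 4 5 7 8) (cS c 0 1 2 3 4 5 7 9) (cS c 0 1 2 3 4 5 8 9) (aS c 2 3 4 5 0 1) where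
  p12 := pairOK10 h 6 7 (by decide) (by decide) (by decide)
  p13 := pairOK10 h 6 8 (by decide) (by decide) (by decide)
  p14 := pairOK10 h 6 9 (by decide) (by decide) (by decide)
  p23 := pairOK10 h 7 8 (by decide) (by decide) (by decide)
  p24 := pairOK10 h 7 9 (by decide) (by decide) (by decide)
  p34 := pairOK10 h 8 9 (by decide) (by decide) (by decide)
  t123 := triOK10 h 6 7 8 (by decide) (by decide) (by decide) (by decide) (by decide) (by decide)
  t124 := triOK10 h 6 7 9 (by decide) (by decide) (by decide) (by decide) (by decide) (by decide)
  t134 := triOK10 h 6 8 9 (by decide) (by decide) (by decide) (by decide) (by decide) (by decide)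
  t234 := triOK10 h 7 8 9 (by decide) (by decide) (by decide) (by decide) (by decide) (by decide)
  tot := hT

theorem Csum (c : Fin 10 → Fin 10 → Fin 10 → Fin 10 → ℕ) :
    cS c 0 1 2 3 4 5 6 7 + cS c 0 1 2 3 4 5 6 8 + cS c 0 1 2 3 4 5 6 9 + cS c 0 1 2 3 4 5 7 8 + cS c 0 1 2 3 4 5 7 9 + cS c 0 1 2 3 4 5 8 9 =
    bS c 0 1 6 7 8 9 2 + bS c 0 1 6 7 8 9 3 + bS c 0 1 6 7 8 9 4 + bS c 0 1 6 7 8 9 5 + aS c 6 7 8 9 0 1 :=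
  tr6x5 _ _ _ _ _ _ _ _ _ _ _ _ _ _ _ _ _ _ _ _ _ _ _ _ _ _ _ _ _ _

theorem Csum' (c : Fin 10 → Fin 10 → Fin 10 → Fin 10 → ℕ) :
    cS c 0 1 6 7 8 9 2 3 + cS c 0 1 6 7 8 9 2 4 + cS c 0 1 6 7 8 9 2 5 + cS c 0 1 6 7 8 9 3 4 + cS c 0 1 6 7 8 9 3 5 + cS c 0 1 6 7 8 9 4 5 =
    bS c 0 1 2 3 4 5 6 + bS c 0 1 2 3 4 5 7 + bS c 0 1 2 3 4 5 8 + bS c 0 1 2 3 4 5 9 + aS c 2 3 4 5 0 1 :=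
  tr6x5 _ _ _ _ _ _ _ _ _ _ _ _ _ _ _ _ _ _ _ _ _ _ _ _ _ _ _ _ _ _

theorem Asum {c : Fin 10 → Fin 10 → Fin 10 → Fin 10 → ℕ} (h : XSys col10 c) :
    aS c 2 3 4 5 6 7 + aS c 2 3 4 5 6 8 + aS c 2 3 4 5 6 9 + aS c 2 3 4 5 7 8 + aS c 2 3 4 5 7 9 + aS c 2 3 4 5 8 9 =
    aS c 6 7 8 9 2 3 + aS c 6 7 8 9 2 4 + aS c 6 7 8 9 2 5 + aS c 6 7 8 9 3 4 + aS c 6 7 8 9 3 5 + aS c 6 7 8 9 4 5 := by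
  rw [aS_swap h 2 3 4 5, aS_swap h 2 3 4 5, aS_swap h 2 3 4 5, aS_swap h 2 3 4 5, aS_swap h 2 3 4 5, aS_swap h 2 3 4 5]
  exact tr66 _ _ _ _ _ _ _ _ _ _ _ _ _ _ _ _ _ _ _ _ _ _ _ _ _ _ _ _ _ _ _ _ _ _ _ _

theorem rearF44 (g26 g27 g28 g29 g36 g37 g38 g39 g46 g47 g48 g49 g56 g57 g58 g59 q26 q27 q28 q29 q36 q37 q38 q39 q46 q47 q48 q49 q56 q57 q58 q59 : ℕ) :
    ((g26 + g36 + g46 + g56) + (q26 + q36 + q46 + q56)) + ((g27 + g37 + g47 + g57) + (q27 + q37 + q47 + q57)) + ((g28 + g38 + g48 + g58) + (q28 + q38 + q48 + q58)) + ((g29 + g39 + g49 + g59) + (q29 + q39 + q49 + q59)) =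
    ((g26 + g27 + g28 + g29) + (q26 + q27 + q28 + q29)) + ((g36 + g37 + g38 + g39) + (q36 + q37 + q38 + q39)) + ((g46 + g47 + g48 + g49) + (q46 + q47 + q48 + q49)) + ((g56 + g57 + g58 + g59) + (q56 + q57 + q58 + q59)) := by
  ring

theorem Fsum {c : Fin 10 → Fin 10 → Fin 10 → Fin 10 → ℕ} (h : XSys col10 c) :
    fS c 0 1 2 3 4 5 6 + fS c 0 1 2 3 4 5 7 + fS c 0 1 2 3 4 5 8 + fS c 0 1 2 3 4 5 9 =
    fS c 0 1 6 7 8 9 2 + fS c 0 1 6 7 8 9 3 + fS c 0 1 6 7 8 9 4 + fS c 0 1 6 7 8 9 5 := by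
  unfold fS
  rw [h.s1 2 6 0 1, h.q2_comm1 2 6 0 1, h.s1 2 7 0 1, h.q2_comm1 2 7 0 1, h.s1 2 8 0 1, h.q2_comm1 2 8 0 1, h.s1 2 9 0 1, h.q2_comm1 2 9 0 1, h.s1 3 6 0 1, h.q2_comm1 3 6 0 1, h.s1 3 7 0 1, h.q2_comm1 3 7 0 1, h.s1 3 8 0 1, h.q2_comm1 3 8 0 1, h.s1 3 9 0 1, h.q2_comm1 3 9 0 1, h.s1 4 6 0 1, h.q2_comm1 4 6 0 1, h.s1 4 7 0 1, h.q2_comm1 4 7 0 1, h.s1 4 8 0 1, h.q2_comm1 4 8 0 1, h.s1 4 9 0 1, h.q2_comm1 4 9 0 1, h.s1 5 6 0 1, h.q2_comm1 5 6 0 1, h.s1 5 7 0 1, h.q2_comm1 5 7 0 1, h.s1 5 8 0 1, h.q2_comm1 5 8 0 1, h.s1 5 9 0 1, h.q2_comm1 5 9 0 1]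
  exact rearF44 _ _ _ _ _ _ _ _ _ _ _ _ _ _ _ _ _ _ _ _ _ _ _ _ _ _ _ _ _ _ _ _

def sw10 : Fin 10 → Fin 10 := ![0, 1, 6, 7, 8, 9, 2, 3, 4, 5]

theorem arT {D E F F' B B' A A' C C' : ℕ} (h1 : C = B' + E) (h2 : C' = B + D) (h3 : A = A') (h4 : F = F') :
    E + (F' + B') + (A' + C') = D + (F + B) + (A + C) := by omega

theorem T10_swap {c : Fin 10 → Fin 10 → Fin 10 → Fin 10 → ℕ} (h : XSys col10 c) :
    T10 (fun u v w z => c (sw10 u) (sw10 v) (sw10 w) (sw10 z)) = T10 c :=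
  arT (Csum c) (Csum' c) (Asum h) (Fsum h)

theorem arC00 {m23_67 m23_68 m23_69 m23_78 m23_79 m23_89 m24_67 m24_68 m24_69 m24_78 m24_79 m24_89 m25_67 m25_68 m25_69 m25_78 m25_79 m25_89 m34_67 m34_68 m34_69 m34_78 m34_79 m34_89 m35_67 m35_68 m35_69 m35_78 m35_79 m35_89 m45_67 m45_68 m45_69 m45_78 m45_79 m45_89 : ℕ} (hr : m23_67 + m24_67 + m25_67 + m34_67 + m35_67 + m45_67 = 0 ∧ m23_68 + m24_68 + m25_68 + m34_68 + m35_68 + m45_68 = 0 ∧ m23_69 + m24_69 + m25_69 + m34_69 + m35_69 + m45_69 = 0 ∧ m23_78 + m24_78 + m25_78 + m34_78 + m35_78 + m45_78 = 2 ∧ m23_79 + m24_79 + m25_79 + m34_79 + m35_79 + m45_79 = 2 ∧ m23_89 + m24_89 + m25_89 + m34_89 + m35_89 + m45_89 = 2)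
    (hc : m23_67 + m23_68 + m23_69 + m23_78 + m23_79 + m23_89 = 0 ∧ m24_67 + m24_68 + m24_69 + m24_78 + m24_79 + m24_89 = 0 ∧ m25_67 + m25_68 + m25_69 + m25_78 + m25_79 + m25_89 = 0 ∧ m34_67 + m34_68 + m34_69 + m34_78 + m34_79 + m34_89 = 2 ∧ m35_67 + m35_68 + m35_69 + m35_78 + m35_79 + m35_89 = 2 ∧ m45_67 + m45_68 + m45_69 + m45_78 + m45_79 + m45_89 = 2)
    (ho : ((m34_78 + m34_79 + m34_89) + (m35_78 + m35_79 + m35_89) + (m45_78 + m45_79 + m45_89)) % 2 = 1) : False := by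
  obtain ⟨r1, r2, r3, r4, r5, r6⟩ := hr
  obtain ⟨c1, c2, c3, -, -, -⟩ := hc
  simp only [Nat.add_eq_zero_iff] at r1 r2 r3 c1 c2 c3
  omega

theorem arC01 {m23_67 m23_68 m23_69 m23_78 m23_79 m23_89 m24_67 m24_68 m24_69 m24_78 m24_79 m24_89 m25_67 m25_68 m25_69 m25_78 m25_79 m25_89 m34_67 m34_68 m34_69 m34_78 m34_79 m34_89 m35_67 m35_68 m35_69 m35_78 m35_79 m35_89 m45_67 m45_68 m45_69 m45_78 m45_79 m45_89 : ℕ} (hr : m23_67 + m24_67 + m25_67 + m34_67 + m35_67 + m45_67 = 0 ∧ m23_68 + m24_68 + m25_68 + m34_68 + m35_68 + m45_68 = 0 ∧ m23_69 + m24_69 + m25_69 + m34_69 + m35_69 + m45_69 = 0 ∧ m23_78 + m24_78 + m25_78 + m34_78 + m35_78 + m45_78 = 2 ∧ m23_79 + m24_79 + m25_79 + m34_79 + m35_79 + m45_79 = 2 ∧ m23_89 + m24_89 + m25_89 + m34_89 + m35_89 + m45_89 = 2)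
    (hc : m23_67 + m23_68 + m23_69 + m23_78 + m23_79 + m23_89 = 0 ∧ m34_67 + m34_68 + m34_69 + m34_78 + m34_79 + m34_89 = 0 ∧ m35_67 + m35_68 + m35_69 + m35_78 + m35_79 + m35_89 = 0 ∧ m24_67 + m24_68 + m24_69 + m24_78 + m24_79 + m24_89 = 2 ∧ m25_67 + m25_68 + m25_69 + m25_78 + m25_79 + m25_89 = 2 ∧ m45_67 + m45_68 + m45_69 + m45_78 + m45_79 + m45_89 = 2)
    (ho : ((m24_78 + m24_79 + m24_89) + (m25_78 + m25_79 + m25_89) + (m45_78 + m45_79 + m45_89)) % 2 = 1) : False := by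
  obtain ⟨r1, r2, r3, r4, r5, r6⟩ := hr
  obtain ⟨c1, c2, c3, -, -, -⟩ := hc
  simp only [Nat.add_eq_zero_iff] at r1 r2 r3 c1 c2 c3
  omega

theorem arC02 {m23_67 m23_68 m23_69 m23_78 m23_79 m23_89 m24_67 m24_68 m24_69 m24_78 m24_79 m24_89 m25_67 m25_68 m25_69 m25_78 m25_79 m25_89 m34_67 m34_68 m34_69 m34_78 m34_79 m34_89 m35_67 m35_68 m35_69 m35_78 m35_79 m35_89 m45_67 m45_68 m45_69 m45_78 m45_79 m45_89 : ℕ} (hr : m23_67 + m24_67 + m25_67 + m34_67 + m35_67 + m45_67 = 0 ∧ m23_68 + m24_68 + m25_68 + m34_68 + m35_68 + m45_68 = 0 ∧ m23_69 + m24_69 + m25_69 + m34_69 + m35_69 + m45_69 = 0 ∧ m23_78 + m24_78 + m25_78 + m34_78 + m35_78 + m45_78 = 2 ∧ m23_79 + m24_79 + m25_79 + m34_79 + m35_79 + m45_79 = 2 ∧ m23_89 + m24_89 + m25_89 + m34_89 + m35_89 + m45_89 = 2)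
    (hc : m24_67 + m24_68 + m24_69 + m24_78 + m24_79 + m24_89 = 0 ∧ m34_67 + m34_68 + m34_69 + m34_78 + m34_79 + m34_89 = 0 ∧ m45_67 + m45_68 + m45_69 + m45_78 + m45_79 + m45_89 = 0 ∧ m23_67 + m23_68 + m23_69 + m23_78 + m23_79 + m23_89 = 2 ∧ m25_67 + m25_68 + m25_69 + m25_78 + m25_79 + m25_89 = 2 ∧ m35_67 + m35_68 + m35_69 + m35_78 + m35_79 + m35_89 = 2)
    (ho : ((m23_78 + m23_79 + m23_89) + (m25_78 + m25_79 + m25_89) + (m35_78 + m35_79 + m35_89)) % 2 = 1) : False := by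
  obtain ⟨r1, r2, r3, r4, r5, r6⟩ := hr
  obtain ⟨c1, c2, c3, -, -, -⟩ := hc
  simp only [Nat.add_eq_zero_iff] at r1 r2 r3 c1 c2 c3
  omega

theorem arC03 {m23_67 m23_68 m23_69 m23_78 m23_79 m23_89 m24_67 m24_68 m24_69 m24_78 m24_79 m24_89 m25_67 m25_68 m25_69 m25_78 m25_79 m25_89 m34_67 m34_68 m34_69 m34_78 m34_79 m34_89 m35_67 m35_68 m35_69 m35_78 m35_79 m35_89 m45_67 m45_68 m45_69 m45_78 m45_79 m45_89 : ℕ} (hr : m23_67 + m24_67 + m25_67 + m34_67 + m35_67 + m45_67 = 0 ∧ m23_68 + m24_68 + m25_68 + m34_68 + m35_68 + m45_68 = 0 ∧ m23_69 + m24_69 + m25_69 + m34_69 + m35_69 + m45_69 = 0 ∧ m23_78 + m24_78 + m25_78 + m34_78 + m35_78 + m45_78 = 2 ∧ m23_79 + m24_79 + m25_79 + m34_79 + m35_79 + m45_79 = 2 ∧ m23_89 + m24_89 + m25_89 + m34_89 + m35_89 + m45_89 = 2)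
    (hc : m25_67 + m25_68 + m25_69 + m25_78 + m25_79 + m25_89 = 0 ∧ m35_67 + m35_68 + m35_69 + m35_78 + m35_79 + m35_89 = 0 ∧ m45_67 + m45_68 + m45_69 + m45_78 + m45_79 + m45_89 = 0 ∧ m23_67 + m23_68 + m23_69 + m23_78 + m23_79 + m23_89 = 2 ∧ m24_67 + m24_68 + m24_69 + m24_78 + m24_79 + m24_89 = 2 ∧ m34_67 + m34_68 + m34_69 + m34_78 + m34_79 + m34_89 = 2)
    (ho : ((m23_78 + m23_79 + m23_89) + (m24_78 + m24_79 + m24_89) + (m34_78 + m34_79 + m34_89)) % 2 = 1) : False := by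
  obtain ⟨r1, r2, r3, r4, r5, r6⟩ := hr
  obtain ⟨c1, c2, c3, -, -, -⟩ := hc
  simp only [Nat.add_eq_zero_iff] at r1 r2 r3 c1 c2 c3
  omega

theorem arC10 {m23_67 m23_68 m23_69 m23_78 m23_79 m23_89 m24_67 m24_68 m24_69 m24_78 m24_79 m24_89 m25_67 m25_68 m25_69 m25_78 m25_79 m25_89 m34_67 m34_68 m34_69 m34_78 m34_79 m34_89 m35_67 m35_68 m35_69 m35_78 m35_79 m35_89 m45_67 m45_68 m45_69 m45_78 m45_79 m45_89 : ℕ} (hr : m23_67 + m24_67 + m25_67 + m34_67 + m35_67 + m45_67 = 0 ∧ m23_78 + m24_78 + m25_78 + m34_78 + m35_78 + m45_78 = 0 ∧ m23_79 + m24_79 + m25_79 + m34_79 + m35_79 + m45_79 = 0 ∧ m23_68 + m24_68 + m25_68 + m34_68 + m35_68 + m45_68 = 2 ∧ m23_69 + m24_69 + m25_69 + m34_69 + m35_69 + m45_69 = 2 ∧ m23_89 + m24_89 + m25_89 + m34_89 + m35_89 + m45_89 = 2)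
    (hc : m23_67 + m23_68 + m23_69 + m23_78 + m23_79 + m23_89 = 0 ∧ m24_67 + m24_68 + m24_69 + m24_78 + m24_79 + m24_89 = 0 ∧ m25_67 + m25_68 + m25_69 + m25_78 + m25_79 + m25_89 = 0 ∧ m34_67 + m34_68 + m34_69 + m34_78 + m34_79 + m34_89 = 2 ∧ m35_67 + m35_68 + m35_69 + m35_78 + m35_79 + m35_89 = 2 ∧ m45_67 + m45_68 + m45_69 + m45_78 + m45_79 + m45_89 = 2)
    (ho : ((m34_68 + m34_69 + m34_89) + (m35_68 + m35_69 + m35_89) + (m45_68 + m45_69 + m45_89)) % 2 = 1) : False := by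
  obtain ⟨r1, r2, r3, r4, r5, r6⟩ := hr
  obtain ⟨c1, c2, c3, -, -, -⟩ := hc
  simp only [Nat.add_eq_zero_iff] at r1 r2 r3 c1 c2 c3
  omega

theorem arC11 {m23_67 m23_68 m23_69 m23_78 m23_79 m23_89 m24_67 m24_68 m24_69 m24_78 m24_79 m24_89 m25_67 m25_68 m25_69 m25_78 m25_79 m25_89 m34_67 m34_68 m34_69 m34_78 m34_79 m34_89 m35_67 m35_68 m35_69 m35_78 m35_79 m35_89 m45_67 m45_68 m45_69 m45_78 m45_79 m45_89 : ℕ} (hr : m23_67 + m24_67 + m25_67 + m34_67 + m35_67 + m45_67 = 0 ∧ m23_78 + m24_78 + m25_78 + m34_78 + m35_78 + m45_78 = 0 ∧ m23_79 + m24_79 + m25_79 + m34_79 + m35_79 + m45_79 = 0 ∧ m23_68 + m24_68 + m25_68 + m34_68 + m35_68 + m45_68 = 2 ∧ m23_69 + m24_69 + m25_69 + m34_69 + m35_69 + m45_69 = 2 ∧ m23_89 + m24_89 + m25_89 + m34_89 + m35_89 + m45_89 = 2)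
    (hc : m23_67 + m23_68 + m23_69 + m23_78 + m23_79 + m23_89 = 0 ∧ m34_67 + m34_68 + m34_69 + m34_78 + m34_79 + m34_89 = 0 ∧ m35_67 + m35_68 + m35_69 + m35_78 + m35_79 + m35_89 = 0 ∧ m24_67 + m24_68 + m24_69 + m24_78 + m24_79 + m24_89 = 2 ∧ m25_67 + m25_68 + m25_69 + m25_78 + m25_79 + m25_89 = 2 ∧ m45_67 + m45_68 + m45_69 + m45_78 + m45_79 + m45_89 = 2)
    (ho : ((m24_68 + m24_69 + m24_89) + (m25_68 + m25_69 + m25_89) + (m45_68 + m45_69 + m45_89)) % 2 = 1) : False := by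
  obtain ⟨r1, r2, r3, r4, r5, r6⟩ := hr
  obtain ⟨c1, c2, c3, -, -, -⟩ := hc
  simp only [Nat.add_eq_zero_iff] at r1 r2 r3 c1 c2 c3
  omega

theorem arC12 {m23_67 m23_68 m23_69 m23_78 m23_79 m23_89 m24_67 m24_68 m24_69 m24_78 m24_79 m24_89 m25_67 m25_68 m25_69 m25_78 m25_79 m25_89 m34_67 m34_68 m34_69 m34_78 m34_79 m34_89 m35_67 m35_68 m35_69 m35_78 m35_79 m35_89 m45_67 m45_68 m45_69 m45_78 m45_79 m45_89 : ℕ} (hr : m23_67 + m24_67 + m25_67 + m34_67 + m35_67 + m45_67 = 0 ∧ m23_78 + m24_78 + m25_78 + m34_78 + m35_78 + m45_78 = 0 ∧ m23_79 + m24_79 + m25_79 + m34_79 + m35_79 + m45_79 = 0 ∧ m23_68 + m24_68 + m25_68 + m34_68 + m35_68 + m45_68 = 2 ∧ m23_69 + m24_69 + m25_69 + m34_69 + m35_69 + m45_69 = 2 ∧ m23_89 + m24_89 + m25_89 + m34_89 + m35_89 + m45_89 = 2)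
    (hc : m24_67 + m24_68 + m24_69 + m24_78 + m24_79 + m24_89 = 0 ∧ m34_67 + m34_68 + m34_69 + m34_78 + m34_79 + m34_89 = 0 ∧ m45_67 + m45_68 + m45_69 + m45_78 + m45_79 + m45_89 = 0 ∧ m23_67 + m23_68 + m23_69 + m23_78 + m23_79 + m23_89 = 2 ∧ m25_67 + m25_68 + m25_69 + m25_78 + m25_79 + m25_89 = 2 ∧ m35_67 + m35_68 + m35_69 + m35_78 + m35_79 + m35_89 = 2)
    (ho : ((m23_68 + m23_69 + m23_89) + (m25_68 + m25_69 + m25_89) + (m35_68 + m35_69 + m35_89)) % 2 = 1) : False := by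
  obtain ⟨r1, r2, r3, r4, r5, r6⟩ := hr
  obtain ⟨c1, c2, c3, -, -, -⟩ := hc
  simp only [Nat.add_eq_zero_iff] at r1 r2 r3 c1 c2 c3
  omega

theorem arC13 {m23_67 m23_68 m23_69 m23_78 m23_79 m23_89 m24_67 m24_68 m24_69 m24_78 m24_79 m24_89 m25_67 m25_68 m25_69 m25_78 m25_79 m25_89 m34_67 m34_68 m34_69 m34_78 m34_79 m34_89 m35_67 m35_68 m35_69 m35_78 m35_79 m35_89 m45_67 m45_68 m45_69 m45_78 m45_79 m45_89 : ℕ} (hr : m23_67 + m24_67 + m25_67 + m34_67 + m35_67 + m45_67 = 0 ∧ m23_78 + m24_78 + m25_78 + m34_78 + m35_78 + m45_78 = 0 ∧ m23_79 + m24_79 + m25_79 + m34_79 + m35_79 + m45_79 = 0 ∧ m23_68 + m24_68 + m25_68 + m34_68 + m35_68 + m45_68 = 2 ∧ m23_69 + m24_69 + m25_69 + m34_69 + m35_69 + m45_69 = 2 ∧ m23_89 + m24_89 + m25_89 + m34_89 + m35_89 + m45_89 = 2)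
    (hc : m25_67 + m25_68 + m25_69 + m25_78 + m25_79 + m25_89 = 0 ∧ m35_67 + m35_68 + m35_69 + m35_78 + m35_79 + m35_89 = 0 ∧ m45_67 + m45_68 + m45_69 + m45_78 + m45_79 + m45_89 = 0 ∧ m23_67 + m23_68 + m23_69 + m23_78 + m23_79 + m23_89 = 2 ∧ m24_67 + m24_68 + m24_69 + m24_78 + m24_79 + m24_89 = 2 ∧ m34_67 + m34_68 + m34_69 + m34_78 + m34_79 + m34_89 = 2)
    (ho : ((m23_68 + m23_69 + m23_89) + (m24_68 + m24_69 + m24_89) + (m34_68 + m34_69 + m34_89)) % 2 = 1) : False := by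
  obtain ⟨r1, r2, r3, r4, r5, r6⟩ := hr
  obtain ⟨c1, c2, c3, -, -, -⟩ := hc
  simp only [Nat.add_eq_zero_iff] at r1 r2 r3 c1 c2 c3
  omega

theorem arC20 {m23_67 m23_68 m23_69 m23_78 m23_79 m23_89 m24_67 m24_68 m24_69 m24_78 m24_79 m24_89 m25_67 m25_68 m25_69 m25_78 m25_79 m25_89 m34_67 m34_68 m34_69 m34_78 m34_79 m34_89 m35_67 m35_68 m35_69 m35_78 m35_79 m35_89 m45_67 m45_68 m45_69 m45_78 m45_79 m45_89 : ℕ} (hr : m23_68 + m24_68 + m25_68 + m34_68 + m35_68 + m45_68 = 0 ∧ m23_78 + m24_78 + m25_78 + m34_78 + m35_78 + m45_78 = 0 ∧ m23_89 + m24_89 + m25_89 + m34_89 + m35_89 + m45_89 = 0 ∧ m23_67 + m24_67 + m25_67 + m34_67 + m35_67 + m45_67 = 2 ∧ m23_69 + m24_69 + m25_69 + m34_69 + m35_69 + m45_69 = 2 ∧ m23_79 + m24_79 + m25_79 + m34_79 + m35_79 + m45_79 = 2)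
    (hc : m23_67 + m23_68 + m23_69 + m23_78 + m23_79 + m23_89 = 0 ∧ m24_67 + m24_68 + m24_69 + m24_78 + m24_79 + m24_89 = 0 ∧ m25_67 + m25_68 + m25_69 + m25_78 + m25_79 + m25_89 = 0 ∧ m34_67 + m34_68 + m34_69 + m34_78 + m34_79 + m34_89 = 2 ∧ m35_67 + m35_68 + m35_69 + m35_78 + m35_79 + m35_89 = 2 ∧ m45_67 + m45_68 + m45_69 + m45_78 + m45_79 + m45_89 = 2)
    (ho : ((m34_67 + m34_69 + m34_79) + (m35_67 + m35_69 + m35_79) + (m45_67 + m45_69 + m45_79)) % 2 = 1) : False := by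
  obtain ⟨r1, r2, r3, r4, r5, r6⟩ := hr
  obtain ⟨c1, c2, c3, -, -, -⟩ := hc
  simp only [Nat.add_eq_zero_iff] at r1 r2 r3 c1 c2 c3
  omega

theorem arC21 {m23_67 m23_68 m23_69 m23_78 m23_79 m23_89 m24_67 m24_68 m24_69 m24_78 m24_79 m24_89 m25_67 m25_68 m25_69 m25_78 m25_79 m25_89 m34_67 m34_68 m34_69 m34_78 m34_79 m34_89 m35_67 m35_68 m35_69 m35_78 m35_79 m35_89 m45_67 m45_68 m45_69 m45_78 m45_79 m45_89 : ℕ} (hr : m23_68 + m24_68 + m25_68 + m34_68 + m35_68 + m45_68 = 0 ∧ m23_78 + m24_78 + m25_78 + m34_78 + m35_78 + m45_78 = 0 ∧ m23_89 + m24_89 + m25_89 + m34_89 + m35_89 + m45_89 = 0 ∧ m23_67 + m24_67 + m25_67 + m34_67 + m35_67 + m45_67 = 2 ∧ m23_69 + m24_69 + m25_69 + m34_69 + m35_69 + m45_69 = 2 ∧ m23_79 + m24_79 + m25_79 + m34_79 + m35_79 + m45_79 = 2)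
    (hc : m23_67 + m23_68 + m23_69 + m23_78 + m23_79 + m23_89 = 0 ∧ m34_67 + m34_68 + m34_69 + m34_78 + m34_79 + m34_89 = 0 ∧ m35_67 + m35_68 + m35_69 + m35_78 + m35_79 + m35_89 = 0 ∧ m24_67 + m24_68 + m24_69 + m24_78 + m24_79 + m24_89 = 2 ∧ m25_67 + m25_68 + m25_69 + m25_78 + m25_79 + m25_89 = 2 ∧ m45_67 + m45_68 + m45_69 + m45_78 + m45_79 + m45_89 = 2)
    (ho : ((m24_67 + m24_69 + m24_79) + (m25_67 + m25_69 + m25_79) + (m45_67 + m45_69 + m45_79)) % 2 = 1) : False := by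
  obtain ⟨r1, r2, r3, r4, r5, r6⟩ := hr
  obtain ⟨c1, c2, c3, -, -, -⟩ := hc
  simp only [Nat.add_eq_zero_iff] at r1 r2 r3 c1 c2 c3
  omega

theorem arC22 {m23_67 m23_68 m23_69 m23_78 m23_79 m23_89 m24_67 m24_68 m24_69 m24_78 m24_79 m24_89 m25_67 m25_68 m25_69 m25_78 m25_79 m25_89 m34_67 m34_68 m34_69 m34_78 m34_79 m34_89 m35_67 m35_68 m35_69 m35_78 m35_79 m35_89 m45_67 m45_68 m45_69 m45_78 m45_79 m45_89 : ℕ} (hr : m23_68 + m24_68 + m25_68 + m34_68 + m35_68 + m45_68 = 0 ∧ m23_78 + m24_78 + m25_78 + m34_78 + m35_78 + m45_78 = 0 ∧ m23_89 + m24_89 + m25_89 + m34_89 + m35_89 + m45_89 = 0 ∧ m23_67 + m24_67 + m25_67 + m34_67 + m35_67 + m45_67 = 2 ∧ m23_69 + m24_69 + m25_69 + m34_69 + m35_69 + m45_69 = 2 ∧ m23_79 + m24_79 + m25_79 + m34_79 + m35_79 + m45_79 = 2)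
    (hc : m24_67 + m24_68 + m24_69 + m24_78 + m24_79 + m24_89 = 0 ∧ m34_67 + m34_68 + m34_69 + m34_78 + m34_79 + m34_89 = 0 ∧ m45_67 + m45_68 + m45_69 + m45_78 + m45_79 + m45_89 = 0 ∧ m23_67 + m23_68 + m23_69 + m23_78 + m23_79 + m23_89 = 2 ∧ m25_67 + m25_68 + m25_69 + m25_78 + m25_79 + m25_89 = 2 ∧ m35_67 + m35_68 + m35_69 + m35_78 + m35_79 + m35_89 = 2)
    (ho : ((m23_67 + m23_69 + m23_79) + (m25_67 + m25_69 + m25_79) + (m35_67 + m35_69 + m35_79)) % 2 = 1) : False := by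
  obtain ⟨r1, r2, r3, r4, r5, r6⟩ := hr
  obtain ⟨c1, c2, c3, -, -, -⟩ := hc
  simp only [Nat.add_eq_zero_iff] at r1 r2 r3 c1 c2 c3
  omega

theorem arC23 {m23_67 m23_68 m23_69 m23_78 m23_79 m23_89 m24_67 m24_68 m24_69 m24_78 m24_79 m24_89 m25_67 m25_68 m25_69 m25_78 m25_79 m25_89 m34_67 m34_68 m34_69 m34_78 m34_79 m34_89 m35_67 m35_68 m35_69 m35_78 m35_79 m35_89 m45_67 m45_68 m45_69 m45_78 m45_79 m45_89 : ℕ} (hr : m23_68 + m24_68 + m25_68 + m34_68 + m35_68 + m45_68 = 0 ∧ m23_78 + m24_78 + m25_78 + m34_78 + m35_78 + m45_78 = 0 ∧ m23_89 + m24_89 + m25_89 + m34_89 + m35_89 + m45_89 = 0 ∧ m23_67 + m24_67 + m25_67 + m34_67 + m35_67 + m45_67 = 2 ∧ m23_69 + m24_69 + m25_69 + m34_69 + m35_69 + m45_69 = 2 ∧ m23_79 + m24_79 + m25_79 + m34_79 + m35_79 + m45_79 = 2)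
    (hc : m25_67 + m25_68 + m25_69 + m25_78 + m25_79 + m25_89 = 0 ∧ m35_67 + m35_68 + m35_69 + m35_78 + m35_79 + m35_89 = 0 ∧ m45_67 + m45_68 + m45_69 + m45_78 + m45_79 + m45_89 = 0 ∧ m23_67 + m23_68 + m23_69 + m23_78 + m23_79 + m23_89 = 2 ∧ m24_67 + m24_68 + m24_69 + m24_78 + m24_79 + m24_89 = 2 ∧ m34_67 + m34_68 + m34_69 + m34_78 + m34_79 + m34_89 = 2)
    (ho : ((m23_67 + m23_69 + m23_79) + (m24_67 + m24_69 + m24_79) + (m34_67 + m34_69 + m34_79)) % 2 = 1) : False := by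
  obtain ⟨r1, r2, r3, r4, r5, r6⟩ := hr
  obtain ⟨c1, c2, c3, -, -, -⟩ := hc
  simp only [Nat.add_eq_zero_iff] at r1 r2 r3 c1 c2 c3
  omega

theorem arC30 {m23_67 m23_68 m23_69 m23_78 m23_79 m23_89 m24_67 m24_68 m24_69 m24_78 m24_79 m24_89 m25_67 m25_68 m25_69 m25_78 m25_79 m25_89 m34_67 m34_68 m34_69 m34_78 m34_79 m34_89 m35_67 m35_68 m35_69 m35_78 m35_79 m35_89 m45_67 m45_68 m45_69 m45_78 m45_79 m45_89 : ℕ} (hr : m23_69 + m24_69 + m25_69 + m34_69 + m35_69 + m45_69 = 0 ∧ m23_79 + m24_79 + m25_79 + m34_79 + m35_79 + m45_79 = 0 ∧ m23_89 + m24_89 + m25_89 + m34_89 + m35_89 + m45_89 = 0 ∧ m23_67 + m24_67 + m25_67 + m34_67 + m35_67 + m45_67 = 2 ∧ m23_68 + m24_68 + m25_68 + m34_68 + m35_68 + m45_68 = 2 ∧ m23_78 + m24_78 + m25_78 + m34_78 + m35_78 + m45_78 = 2)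
    (hc : m23_67 + m23_68 + m23_69 + m23_78 + m23_79 + m23_89 = 0 ∧ m24_67 + m24_68 + m24_69 + m24_78 + m24_79 + m24_89 = 0 ∧ m25_67 + m25_68 + m25_69 + m25_78 + m25_79 + m25_89 = 0 ∧ m34_67 + m34_68 + m34_69 + m34_78 + m34_79 + m34_89 = 2 ∧ m35_67 + m35_68 + m35_69 + m35_78 + m35_79 + m35_89 = 2 ∧ m45_67 + m45_68 + m45_69 + m45_78 + m45_79 + m45_89 = 2)
    (ho : ((m34_67 + m34_68 + m34_78) + (m35_67 + m35_68 + m35_78) + (m45_67 + m45_68 + m45_78)) % 2 = 1) : False := by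
  obtain ⟨r1, r2, r3, r4, r5, r6⟩ := hr
  obtain ⟨c1, c2, c3, -, -, -⟩ := hc
  simp only [Nat.add_eq_zero_iff] at r1 r2 r3 c1 c2 c3
  omega

theorem arC31 {m23_67 m23_68 m23_69 m23_78 m23_79 m23_89 m24_67 m24_68 m24_69 m24_78 m24_79 m24_89 m25_67 m25_68 m25_69 m25_78 m25_79 m25_89 m34_67 m34_68 m34_69 m34_78 m34_79 m34_89 m35_67 m35_68 m35_69 m35_78 m35_79 m35_89 m45_67 m45_68 m45_69 m45_78 m45_79 m45_89 : ℕ} (hr : m23_69 + m24_69 + m25_69 + m34_69 + m35_69 + m45_69 = 0 ∧ m23_79 + m24_79 + m25_79 + m34_79 + m35_79 + m45_79 = 0 ∧ m23_89 + m24_89 + m25_89 + m34_89 + m35_89 + m45_89 = 0 ∧ m23_67 + m24_67 + m25_67 + m34_67 + m35_67 + m45_67 = 2 ∧ m23_68 + m24_68 + m25_68 + m34_68 + m35_68 + m45_68 = 2 ∧ m23_78 + m24_78 + m25_78 + m34_78 + m35_78 + m45_78 = 2)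
    (hc : m23_67 + m23_68 + m23_69 + m23_78 + m23_79 + m23_89 = 0 ∧ m34_67 + m34_68 + m34_69 + m34_78 + m34_79 + m34_89 = 0 ∧ m35_67 + m35_68 + m35_69 + m35_78 + m35_79 + m35_89 = 0 ∧ m24_67 + m24_68 + m24_69 + m24_78 + m24_79 + m24_89 = 2 ∧ m25_67 + m25_68 + m25_69 + m25_78 + m25_79 + m25_89 = 2 ∧ m45_67 + m45_68 + m45_69 + m45_78 + m45_79 + m45_89 = 2)
    (ho : ((m24_67 + m24_68 + m24_78) + (m25_67 + m25_68 + m25_78) + (m45_67 + m45_68 + m45_78)) % 2 = 1) : False := by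
  obtain ⟨r1, r2, r3, r4, r5, r6⟩ := hr
  obtain ⟨c1, c2, c3, -, -, -⟩ := hc
  simp only [Nat.add_eq_zero_iff] at r1 r2 r3 c1 c2 c3
  omega

theorem arC32 {m23_67 m23_68 m23_69 m23_78 m23_79 m23_89 m24_67 m24_68 m24_69 m24_78 m24_79 m24_89 m25_67 m25_68 m25_69 m25_78 m25_79 m25_89 m34_67 m34_68 m34_69 m34_78 m34_79 m34_89 m35_67 m35_68 m35_69 m35_78 m35_79 m35_89 m45_67 m45_68 m45_69 m45_78 m45_79 m45_89 : ℕ} (hr : m23_69 + m24_69 + m25_69 + m34_69 + m35_69 + m45_69 = 0 ∧ m23_79 + m24_79 + m25_79 + m34_79 + m35_79 + m45_79 = 0 ∧ m23_89 + m24_89 + m25_89 + m34_89 + m35_89 + m45_89 = 0 ∧ m23_67 + m24_67 + m25_67 + m34_67 + m35_67 + m45_67 = 2 ∧ m23_68 + m24_68 + m25_68 + m34_68 + m35_68 + m45_68 = 2 ∧ m23_78 + m24_78 + m25_78 + m34_78 + m35_78 + m45_78 = 2)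
    (hc : m24_67 + m24_68 + m24_69 + m24_78 + m24_79 + m24_89 = 0 ∧ m34_67 + m34_68 + m34_69 + m34_78 + m34_79 + m34_89 = 0 ∧ m45_67 + m45_68 + m45_69 + m45_78 + m45_79 + m45_89 = 0 ∧ m23_67 + m23_68 + m23_69 + m23_78 + m23_79 + m23_89 = 2 ∧ m25_67 + m25_68 + m25_69 + m25_78 + m25_79 + m25_89 = 2 ∧ m35_67 + m35_68 + m35_69 + m35_78 + m35_79 + m35_89 = 2)
    (ho : ((m23_67 + m23_68 + m23_78) + (m25_67 + m25_68 + m25_78) + (m35_67 + m35_68 + m35_78)) % 2 = 1) : False := by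
  obtain ⟨r1, r2, r3, r4, r5, r6⟩ := hr
  obtain ⟨c1, c2, c3, -, -, -⟩ := hc
  simp only [Nat.add_eq_zero_iff] at r1 r2 r3 c1 c2 c3
  omega

theorem arC33 {m23_67 m23_68 m23_69 m23_78 m23_79 m23_89 m24_67 m24_68 m24_69 m24_78 m24_79 m24_89 m25_67 m25_68 m25_69 m25_78 m25_79 m25_89 m34_67 m34_68 m34_69 m34_78 m34_79 m34_89 m35_67 m35_68 m35_69 m35_78 m35_79 m35_89 m45_67 m45_68 m45_69 m45_78 m45_79 m45_89 : ℕ} (hr : m23_69 + m24_69 + m25_69 + m34_69 + m35_69 + m45_69 = 0 ∧ m23_79 + m24_79 + m25_79 + m34_79 + m35_79 + m45_79 = 0 ∧ m23_89 + m24_89 + m25_89 + m34_89 + m35_89 + m45_89 = 0 ∧ m23_67 + m24_67 + m25_67 + m34_67 + m35_67 + m45_67 = 2 ∧ m23_68 + m24_68 + m25_68 + m34_68 + m35_68 + m45_68 = 2 ∧ m23_78 + m24_78 + m25_78 + m34_78 + m35_78 + m45_78 = 2)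
    (hc : m25_67 + m25_68 + m25_69 + m25_78 + m25_79 + m25_89 = 0 ∧ m35_67 + m35_68 + m35_69 + m35_78 + m35_79 + m35_89 = 0 ∧ m45_67 + m45_68 + m45_69 + m45_78 + m45_79 + m45_89 = 0 ∧ m23_67 + m23_68 + m23_69 + m23_78 + m23_79 + m23_89 = 2 ∧ m24_67 + m24_68 + m24_69 + m24_78 + m24_79 + m24_89 = 2 ∧ m34_67 + m34_68 + m34_69 + m34_78 + m34_79 + m34_89 = 2)
    (ho : ((m23_67 + m23_68 + m23_78) + (m24_67 + m24_68 + m24_78) + (m34_67 + m34_68 + m34_78)) % 2 = 1) : False := by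
  obtain ⟨r1, r2, r3, r4, r5, r6⟩ := hr
  obtain ⟨c1, c2, c3, -, -, -⟩ := hc
  simp only [Nat.add_eq_zero_iff] at r1 r2 r3 c1 c2 c3
  omega

theorem coreB {c : Fin 10 → Fin 10 → Fin 10 → Fin 10 → ℕ} (h : XSys col10 c)
    (hr : Side.Alpha (aS c 2 3 4 5 6 7) (aS c 2 3 4 5 6 8) (aS c 2 3 4 5 6 9) (aS c 2 3 4 5 7 8) (aS c 2 3 4 5 7 9) (aS c 2 3 4 5 8 9) ∨
      Side.Alpha (aS c 2 3 4 5 6 7) (aS c 2 3 4 5 7 8) (aS c 2 3 4 5 7 9) (aS c 2 3 4 5 6 8) (aS c 2 3 4 5 6 9) (aS c 2 3 4 5 8 9) ∨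
      Side.Alpha (aS c 2 3 4 5 6 8) (aS c 2 3 4 5 7 8) (aS c 2 3 4 5 8 9) (aS c 2 3 4 5 6 7) (aS c 2 3 4 5 6 9) (aS c 2 3 4 5 7 9) ∨
      Side.Alpha (aS c 2 3 4 5 6 9) (aS c 2 3 4 5 7 9) (aS c 2 3 4 5 8 9) (aS c 2 3 4 5 6 7) (aS c 2 3 4 5 6 8) (aS c 2 3 4 5 7 8))
    (hc : Side.Alpha (aS c 6 7 8 9 2 3) (aS c 6 7 8 9 2 4) (aS c 6 7 8 9 2 5) (aS c 6 7 8 9 3 4) (aS c 6 7 8 9 3 5) (aS c 6 7 8 9 4 5) ∨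
      Side.Alpha (aS c 6 7 8 9 2 3) (aS c 6 7 8 9 3 4) (aS c 6 7 8 9 3 5) (aS c 6 7 8 9 2 4) (aS c 6 7 8 9 2 5) (aS c 6 7 8 9 4 5) ∨
      Side.Alpha (aS c 6 7 8 9 2 4) (aS c 6 7 8 9 3 4) (aS c 6 7 8 9 4 5) (aS c 6 7 8 9 2 3) (aS c 6 7 8 9 2 5) (aS c 6 7 8 9 3 5) ∨
      Side.Alpha (aS c 6 7 8 9 2 5) (aS c 6 7 8 9 3 5) (aS c 6 7 8 9 4 5) (aS c 6 7 8 9 2 3) (aS c 6 7 8 9 2 4) (aS c 6 7 8 9 3 4)) : False := by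
  simp only [aS_swap h 6 7 8 9] at hc
  unfold aS at hr
  unfold Side.Alpha at hr hc
  have ho : ∀ p q r x y z : Fin 10, (2 ≤ p ∧ p < q ∧ q < r ∧ r < 6 ∧ 6 ≤ x ∧ x < y ∧ y < z) →
      s33 c p q r x y z % 2 = 1 := by
    rintro p q r x y z ⟨h1, h2, h3, h4, h5, h6, h7⟩
    refine h.k33_odd p q r x y z ?_ ?_
    · rw [← List.nodup_ofFn]
      simp only [List.ofFn_succ, List.ofFn_zero]
      have : ([p, q, r, x, y, z] : List (Fin 10)).Nodup := by
        simp; omega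
      exact this
    · intro i hi j hj
      have hj' : 6 ≤ j := by
        simp only [List.mem_cons, List.not_mem_nil, or_false] at hj
        rcases hj with rfl | rfl | rfl <;> omega
      have hi' : 2 ≤ i ∧ i < 6 := by
        simp only [List.mem_cons, List.not_mem_nil, or_false] at hi
        rcases hi with rfl | rfl | rfl <;> constructor <;> omega
      exact (colX i hi'.1 hi'.2).2 j hj'
  rcases hr with hr | hr | hr | hr <;> rcases hc with hc | hc | hc | hc
  · exact arC00 hr hc (ho 3 4 5 7 8 9 (by decide))
  · exact arC01 hr hc (ho 2 4 5 7 8 9 (by decide))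
  · exact arC02 hr hc (ho 2 3 5 7 8 9 (by decide))
  · exact arC03 hr hc (ho 2 3 4 7 8 9 (by decide))
  · exact arC10 hr hc (ho 3 4 5 6 8 9 (by decide))
  · exact arC11 hr hc (ho 2 4 5 6 8 9 (by decide))
  · exact arC12 hr hc (ho 2 3 5 6 8 9 (by decide))
  · exact arC13 hr hc (ho 2 3 4 6 8 9 (by decide))
  · exact arC20 hr hc (ho 3 4 5 6 7 9 (by decide))
  · exact arC21 hr hc (ho 2 4 5 6 7 9 (by decide))
  · exact arC22 hr hc (ho 2 3 5 6 7 9 (by decide))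
  · exact arC23 hr hc (ho 2 3 4 6 7 9 (by decide))
  · exact arC30 hr hc (ho 3 4 5 6 7 8 (by decide))
  · exact arC31 hr hc (ho 2 4 5 6 7 8 (by decide))
  · exact arC32 hr hc (ho 2 3 5 6 7 8 (by decide))
  · exact arC33 hr hc (ho 2 3 4 6 7 8 (by decide))

theorem arFin {D E F F' B B' A A' C C' : ℕ} (h1 : C = B' + E) (h2 : C' = B + D) (h3 : A = A')
    (s0 : D = 0 → A + C = 12) (s2 : 2 ≤ D → A + C ≤ 13 ∧ (14 ≤ A + B + D ∨ (13 ≤ A + B + D ∧ A + C = 12)))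
    (s0' : E = 0 → A' + C' = 12)
    (s2' : 2 ≤ E → A' + C' ≤ 13 ∧ (14 ≤ A' + B' + E ∨ (13 ≤ A' + B' + E ∧ A' + C' = 12)))
    (hD : D ≠ 1) (hE : E ≠ 1) : D = 0 ∧ E = 0 := by
  rcases (by omega : D = 0 ∨ 2 ≤ D) with hd | hd
  · have := s0 hd
    rcases (by omega : E = 0 ∨ 2 ≤ E) with he | he
    · exact ⟨hd, he⟩
    · have := s2' he
      omega
  · have := s2 hd
    rcases (by omega : E = 0 ∨ 2 ≤ E) with he | he
    · have := s0' he
      omega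
    · have := s2' he
      omega

theorem ar12 {A1 A2 A3 A4 A5 A6 C1 C2 C3 C4 C5 C6 : ℕ} (h : A1 + C1 = 2 ∧ A2 + C2 = 2 ∧ A3 + C3 = 2 ∧
    A4 + C4 = 2 ∧ A5 + C5 = 2 ∧ A6 + C6 = 2) :
    (A1 + A2 + A3 + A4 + A5 + A6) + (C1 + C2 + C3 + C4 + C5 + C6) = 12 := by omega

theorem main10 {c : Fin 10 → Fin 10 → Fin 10 → Fin 10 → ℕ} (h : XSys col10 c) : 24 ≤ T10 c := by
  by_contra hT
  have s := side10 h (by omega)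
  have h' := h.comap sw10 (by decide +kernel) col10 (by decide +kernel)
  have s' := side10 h' (by rw [T10_swap h]; omega)
  obtain ⟨hD, hE⟩ := arFin (F := 0) (F' := 0) (Csum c) (Csum' c) (Asum h) (fun e => ar12 (s.D0 e)) s.D2
    (fun e => ar12 (s'.D0 e)) s'.D2 s.D_ne1 s'.D_ne1
  exact coreB h (s.alpha hD) (s'.alpha hE)

/-! ### Logarithmic lifts -/

theorem exists_loglift {A : Type*} [TopologicalSpace A] [SimplyConnectedSpace A]
    [LocallyPathConnectedSpace A] (a₀ : A) (f : A → ℂ) (hf : Continuous f) (h0 : ∀ a, f a ≠ 0) :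
    ∃ L : A → ℂ, Continuous L ∧ ∀ a, Complex.exp (L a) = f a := by
  obtain ⟨F, ⟨-, hF⟩, -⟩ := Complex.isCoveringMapOn_exp.existsUnique_continuousMap_lifts
    (⟨f, hf⟩ : C(A, ℂ)) (a₀ := a₀) (e₀ := Complex.log (f a₀)) (Complex.exp_log (h0 a₀)) (fun a => h0 a)
  exact ⟨F, F.continuous, fun a => congrFun hF a⟩

theorem loglift_unique {A : Type*} [TopologicalSpace A] [SimplyConnectedSpace A]
    [LocallyPathConnectedSpace A] {L M : A → ℂ} (hL : Continuous L) (hM : Continuous M)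
    (h : ∀ a, Complex.exp (L a) = Complex.exp (M a)) (a b : A) : L b - L a = M b - M a := by
  obtain ⟨F, -, hu⟩ := Complex.isCoveringMapOn_exp.existsUnique_continuousMap_lifts
    (⟨fun x => Complex.exp (L x), by fun_prop⟩ : C(A, ℂ)) (a₀ := a) (e₀ := L a) rfl
    (fun a => Complex.exp_ne_zero _)
  have h1 := hu ⟨L, hL⟩ ⟨rfl, rfl⟩
  have h2 := hu ⟨fun x => M x + (L a - M a), by fun_prop⟩ ⟨by simp, by
    funext x
    simp [Complex.exp_add, Complex.exp_sub, h]⟩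
  have h3 := DFunLike.congr_fun (h1.trans h2.symm) b
  simp only [ContinuousMap.coe_mk] at h3
  rw [h3]
  ring

/-- the total change of the logarithm of `g` over the unit interval is `d` -/
def IsW (g : ℝ → ℂ) (d : ℂ) : Prop :=
  ∃ L : ℝ → ℂ, Continuous L ∧ (∀ t, Complex.exp (L t) = g t) ∧ L 1 - L 0 = d

theorem IsW.exists {g : ℝ → ℂ} (hg : Continuous g) (h0 : ∀ t, g t ≠ 0) : ∃ d, IsW g d := by
  obtain ⟨L, h1, h2⟩ := exists_loglift 0 g hg h0
  exact ⟨_, L, h1, h2, rfl⟩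

theorem IsW.unique {g : ℝ → ℂ} {d d' : ℂ} (h : IsW g d) (h' : IsW g d') : d = d' := by
  obtain ⟨L, h1, h2, rfl⟩ := h
  obtain ⟨M, h3, h4, rfl⟩ := h'
  exact loglift_unique h1 h3 (fun a => by rw [h2, h4]) 0 1

theorem IsW.neg {g : ℝ → ℂ} {d : ℂ} (h : IsW g d) : IsW (fun t => - g t) d := by
  obtain ⟨L, h1, h2, rfl⟩ := h
  exact ⟨fun t => L t + Real.pi * Complex.I, by fun_prop, fun t => by
    rw [Complex.exp_add, h2, Complex.exp_pi_mul_I]; ring, by ring⟩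

theorem IsW.rev {g : ℝ → ℂ} {d : ℂ} (h : IsW g d) : IsW (fun t => g (1 - t)) (-d) := by
  obtain ⟨L, h1, h2, rfl⟩ := h
  exact ⟨fun t => L (1 - t), by fun_prop, fun t => h2 _, by simp⟩

theorem IsW.exp {g : ℝ → ℂ} {d : ℂ} (h : IsW g d) : Complex.exp d = g 1 / g 0 := by
  obtain ⟨L, h1, h2, rfl⟩ := h
  rw [Complex.exp_sub, h2, h2]

theorem IsW.square {e f : ℝ → ℂ} (he : Continuous e) (hf : Continuous f) (h : ∀ s t, e s ≠ f t)
    {a b c d : ℂ} (ha : IsW (fun t => e t - f 0) a) (hb : IsW (fun t => f t - e 1) b)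
    (hc : IsW (fun t => e t - f 1) c) (hd : IsW (fun t => f t - e 0) d) : a + b - c - d = 0 := by
  obtain ⟨F, h1, h2⟩ := exists_loglift (0 : ℝ × ℝ) (fun x => e x.1 - f x.2) (by fun_prop)
    (fun x => sub_ne_zero.2 (h _ _))
  have ea : F (1, 0) - F (0, 0) = a :=
    IsW.unique ⟨fun t => F (t, 0), by fun_prop, fun t => h2 _, rfl⟩ ha
  have ec : F (1, 1) - F (0, 1) = c :=
    IsW.unique ⟨fun t => F (t, 1), by fun_prop, fun t => h2 _, rfl⟩ hc
  have eb : F (1, 1) - F (1, 0) = b :=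
    IsW.unique ⟨fun t => F (1, t), by fun_prop, fun t => by rw [h2]; ring, rfl⟩ hb.neg
  have ed : F (0, 1) - F (0, 0) = d :=
    IsW.unique ⟨fun t => F (0, t), by fun_prop, fun t => by rw [h2]; ring, rfl⟩ hd.neg
  rw [← ea, ← eb, ← ec, ← ed]
  ring

/-! ### Crossing parities of a drawing -/

section parity

variable {V : Type*} {G : SimpleGraph V} (D : Drawing G)

/-- the point of the complex plane -/
noncomputable def toC (x : ℝ × ℝ) : ℂ := Complex.equivRealProdCLM.symm x

theorem toC_inj {x y : ℝ × ℝ} (h : toC x = toC y) : x = y :=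
  Complex.equivRealProdCLM.symm.injective h

theorem toC_cont : Continuous toC := Complex.equivRealProdCLM.symm.continuous

/-- clamping to the unit interval -/
noncomputable def cl (t : ℝ) : ℝ := (Set.projIcc (0 : ℝ) 1 zero_le_one t : ℝ)

theorem cl_mem (t : ℝ) : cl t ∈ Set.Icc (0 : ℝ) 1 := (Set.projIcc (0 : ℝ) 1 zero_le_one t).2

theorem cl_cont : Continuous cl := continuous_subtype_val.comp continuous_projIcc

theorem cl_zero : cl 0 = 0 := by simp [cl]

theorem cl_one : cl 1 = 1 := by simp [cl]

theorem cl_rev (t : ℝ) : cl (1 - t) = 1 - cl t := by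
  simp only [cl, Set.coe_projIcc]
  rcases le_total t 0 with h | h
  · rw [min_eq_left (by linarith), min_eq_right (by linarith), max_eq_right (by linarith),
      max_eq_left (by linarith)]; ring
  · rcases le_total t 1 with h' | h'
    · rw [min_eq_right (by linarith), min_eq_right (by linarith), max_eq_right (by linarith),
      max_eq_right (by linarith)]
    · rw [min_eq_right (by linarith), min_eq_left (by linarith), max_eq_left (by linarith),
      max_eq_right (by linarith)]; ring

/-- the arc as a curve in the complex plane -/
noncomputable def eC (u v : V) (t : ℝ) : ℂ := toC (D.arc u v (cl t))

theorem eC_cont {u v : V} (h : G.Adj u v) : Continuous (eC D u v) :=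
  toC_cont.comp ((D.arc_cont h).comp_continuous cl_cont cl_mem)

theorem eC_zero {u v : V} (h : G.Adj u v) : eC D u v 0 = toC (D.pos u) := by
  rw [eC, cl_zero, D.arc_zero h]

theorem eC_one {u v : V} (h : G.Adj u v) : eC D u v 1 = toC (D.pos v) := by
  rw [eC, cl_one, D.arc_one h]

theorem eC_rev {u v : V} (h : G.Adj u v) (t : ℝ) : eC D v u t = eC D u v (1 - t) := by
  rw [eC, eC, D.arc_symm h, cl_rev]

theorem eC_avoid {u v w : V} (h : G.Adj u v) (h1 : w ≠ u) (h2 : w ≠ v) (t : ℝ) :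
    eC D u v t - toC (D.pos w) ≠ 0 := by
  intro e
  exact D.arc_avoid h w h1 h2 ⟨cl t, cl_mem t, toC_inj (sub_eq_zero.1 e)⟩

open Classical in
/-- the total turn of the edge `uv` around `w` -/
noncomputable def alf (u v w : V) : ℂ :=
  if h : ∃ d, IsW (fun t => eC D u v t - toC (D.pos w)) d then h.choose else 0

theorem alf_spec {u v w : V} (h : G.Adj u v) (h1 : w ≠ u) (h2 : w ≠ v) :
    IsW (fun t => eC D u v t - toC (D.pos w)) (alf D u v w) := by
  have H := IsW.exists (g := fun t => eC D u v t - toC (D.pos w))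
    ((eC_cont D h).sub continuous_const) (eC_avoid D h h1 h2)
  rw [alf, dif_pos H]
  exact H.choose_spec

theorem alf_rev {u v w : V} (h : G.Adj u v) (h1 : w ≠ u) (h2 : w ≠ v) :
    alf D v u w = - alf D u v w := by
  refine (alf_spec D h.symm h2 h1).unique ?_
  have := (alf_spec D h h1 h2).rev
  simpa only [← eC_rev D h] using this

/-- the two pairs are independent edges -/
def Ind (G : SimpleGraph V) (u v w z : V) : Prop :=
  G.Adj u v ∧ G.Adj w z ∧ u ≠ w ∧ u ≠ z ∧ v ≠ w ∧ v ≠ z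

theorem Ind.s1 {u v w z : V} (h : Ind G u v w z) : Ind G v u w z :=
  ⟨h.1.symm, h.2.1, h.2.2.2.2.1, h.2.2.2.2.2, h.2.2.1, h.2.2.2.1⟩

theorem Ind.s2 {u v w z : V} (h : Ind G u v w z) : Ind G w z u v :=
  ⟨h.2.1, h.1, h.2.2.1.symm, h.2.2.2.2.1.symm, h.2.2.2.1.symm, h.2.2.2.2.2.symm⟩

/-- the total turn along the boundary of the square -/
noncomputable def omg (u v w z : V) : ℂ := alf D u v w + alf D w z v - alf D u v z - alf D w z u

theorem omg_s1 {u v w z : V} (h : Ind G u v w z) : omg D v u w z = - omg D u v w z := by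
  obtain ⟨h1, h2, h3, h4, h5, h6⟩ := h
  rw [omg, omg, alf_rev D h1 h3.symm h5.symm, alf_rev D h1 h4.symm h6.symm]
  ring

theorem omg_s2 (u v w z : V) : omg D w z u v = - omg D u v w z := by
  rw [omg, omg]
  ring

/-- the turn is an odd multiple of a full turn -/
def OddP (u v w z : V) : Prop :=
  Ind G u v w z ∧ ∃ k : ℤ, Odd k ∧ omg D u v w z = 2 * Real.pi * Complex.I * k

theorem OddP.s1 {u v w z : V} (h : OddP D u v w z) : OddP D v u w z := by
  obtain ⟨h1, k, h2, h3⟩ := h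
  exact ⟨h1.s1, -k, h2.neg, by rw [omg_s1 D h1, h3]; push_cast; ring⟩

theorem OddP.s2 {u v w z : V} (h : OddP D u v w z) : OddP D w z u v := by
  obtain ⟨h1, k, h2, h3⟩ := h
  exact ⟨h1.s2, -k, h2.neg, by rw [omg_s2 D, h3]; push_cast; ring⟩

theorem OddP.meet {u v w z : V} (h : OddP D u v w z) :
    ∃ s ∈ Set.Icc (0 : ℝ) 1, ∃ t ∈ Set.Icc (0 : ℝ) 1, D.arc u v s = D.arc w z t := by
  by_contra hne
  push Not at hne
  obtain ⟨⟨h1, h2, h3, h4, h5, h6⟩, k, hk, ho⟩ := h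
  have e0 : omg D u v w z = 0 := by
    refine IsW.square (eC_cont D h1) (eC_cont D h2) ?_ ?_ ?_ ?_ ?_
    · intro s t e
      exact hne _ (cl_mem s) _ (cl_mem t) (toC_inj e)
    · rw [eC_zero D h2]; exact alf_spec D h1 h3.symm h5.symm
    · rw [eC_one D h1]; exact alf_spec D h2 h5 h6
    · rw [eC_one D h2]; exact alf_spec D h1 h4.symm h6.symm
    · rw [eC_zero D h1]; exact alf_spec D h2 h3 h4
  rw [e0] at ho
  have := Complex.two_pi_I_ne_zero
  rcases mul_eq_zero.1 ho.symm with h | h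
  · exact this h
  · have : k = 0 := by exact_mod_cast h
    subst this
    simp at hk

/-- reference logarithms of the differences of the points `p` -/
noncomputable def tht {k : ℕ} (p : Fin k → ℂ) (i j : Fin k) : ℂ :=
  if i < j then Complex.log (p j - p i) else Complex.log (p i - p j) + Real.pi * Complex.I

theorem exp_tht {k : ℕ} {p : Fin k → ℂ} (hp : Function.Injective p) {i j : Fin k} (h : i ≠ j) :
    Complex.exp (tht p i j) = p j - p i := by
  have h1 : p j - p i ≠ 0 := sub_ne_zero.2 (hp.ne h.symm)
  have h2 : p i - p j ≠ 0 := sub_ne_zero.2 (hp.ne h)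
  unfold tht
  split_ifs
  · exact Complex.exp_log h1
  · rw [Complex.exp_add, Complex.exp_log h2, Complex.exp_pi_mul_I]
    ring

theorem tht_sub {k : ℕ} (p : Fin k → ℂ) {i j : Fin k} (h : i ≠ j) :
    tht p i j - tht p j i = Real.pi * Complex.I * (-1 + 2 * ((if j < i then 1 else 0 : ℤ) : ℂ)) := by
  unfold tht
  rcases lt_or_gt_of_ne h with h | h
  · rw [if_pos h, if_neg h.asymm, if_neg h.asymm]
    push_cast
    ring
  · rw [if_neg h.asymm, if_pos h, if_pos h]
    push_cast
    ring

theorem parity_top {k : ℕ} (q : Fin k → V) (hq : Function.Injective q) :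
    ∃ n : Fin k → Fin k → Fin k → ZMod 2, (∀ u v w, n u v w = n v u w) ∧
      ∀ u v w z, Ind G (q u) (q v) (q w) (q z) →
        (OddP D (q u) (q v) (q w) (q z) ↔ cpar n u v w z = 1) := by
  classical
  set p : Fin k → ℂ := fun i => toC (D.pos (q i)) with hp
  have pinj : Function.Injective p := fun i j h => hq (D.pos_inj (toC_inj h))
  have key : ∀ u v w, ∃ N : ℤ, (G.Adj (q u) (q v) ∧ w ≠ u ∧ w ≠ v) →
      alf D (q u) (q v) (q w) = tht p w v - tht p w u + 2 * Real.pi * Complex.I * N := by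
    intro u v w
    by_cases h : G.Adj (q u) (q v) ∧ w ≠ u ∧ w ≠ v
    · obtain ⟨h1, h2, h3⟩ := h
      have e := (alf_spec D h1 (hq.ne h2) (hq.ne h3)).exp
      rw [eC_one D h1, eC_zero D h1] at e
      have e' : Complex.exp (alf D (q u) (q v) (q w)) = Complex.exp (tht p w v - tht p w u) := by
        rw [e, Complex.exp_sub, exp_tht pinj h2, exp_tht pinj h3]
      obtain ⟨N, hN⟩ := Complex.exp_eq_exp_iff_exists_int.1 e'
      exact ⟨N, fun _ => by rw [hN]; ring⟩
    · exact ⟨0, fun h' => (h h').elim⟩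
  choose N hN using key
  have hpi := Complex.two_pi_I_ne_zero
  refine ⟨fun u v w => if G.Adj (q u) (q v) ∧ w ≠ u ∧ w ≠ v then (N u v w : ZMod 2) else 0, ?_, ?_⟩
  · intro u v w
    have hiff : (G.Adj (q u) (q v) ∧ w ≠ u ∧ w ≠ v) ↔ (G.Adj (q v) (q u) ∧ w ≠ v ∧ w ≠ u) := by
      rw [G.adj_comm]; tauto
    by_cases h : G.Adj (q u) (q v) ∧ w ≠ u ∧ w ≠ v
    · simp only [if_pos h, if_pos (hiff.1 h)]
      have e1 := hN u v w h
      have e2 := hN v u w (hiff.1 h)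
      rw [alf_rev D h.1 (hq.ne h.2.1) (hq.ne h.2.2), e1] at e2
      have e3 : (2 * Real.pi * Complex.I) * ((N u v w : ℂ) + N v u w) = 0 := by
        linear_combination -e2
      have e4 : N u v w + N v u w = 0 := by
        rcases mul_eq_zero.1 e3 with h | h
        · exact (hpi h).elim
        · exact_mod_cast h
      have e5 : N v u w = - N u v w := by omega
      rw [e5]
      push_cast
      exact (ZMod.neg_eq_self_mod_two _).symm
    · simp only [if_neg h, if_neg (mt hiff.2 h)]
  · intro u v w z hI
    have hI' := hI
    obtain ⟨h1, h2, h3, h4, h5, h6⟩ := hI'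
    have g3 : u ≠ w := fun e => h3 (by rw [e])
    have g4 : u ≠ z := fun e => h4 (by rw [e])
    have g5 : v ≠ w := fun e => h5 (by rw [e])
    have g6 : v ≠ z := fun e => h6 (by rw [e])
    have c1 : G.Adj (q u) (q v) ∧ w ≠ u ∧ w ≠ v := ⟨h1, g3.symm, g5.symm⟩
    have c2 : G.Adj (q w) (q z) ∧ v ≠ w ∧ v ≠ z := ⟨h2, g5, g6⟩
    have c3 : G.Adj (q u) (q v) ∧ z ≠ u ∧ z ≠ v := ⟨h1, g4.symm, g6.symm⟩
    have c4 : G.Adj (q w) (q z) ∧ u ≠ w ∧ u ≠ z := ⟨h2, g3, g4⟩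
    set K : ℤ := -2 + ((if v < w then 1 else 0) + (if w < u then 1 else 0) + (if z < v then 1 else 0) +
      (if u < z then 1 else 0)) + (N u v w + N w z v - N u v z - N w z u) with hK
    have ho : omg D (q u) (q v) (q w) (q z) = 2 * Real.pi * Complex.I * K := by
      rw [omg, hN _ _ _ c1, hN _ _ _ c2, hN _ _ _ c3, hN _ _ _ c4, hK]
      have t1 := tht_sub p g5.symm
      have t2 := tht_sub p g3
      have t3 := tht_sub p g6
      have t4 := tht_sub p g4.symm
      push_cast at t1 t2 t3 t4 ⊢
      linear_combination t1 + t2 + t3 + t4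
    have hc : (K : ZMod 2) = cpar (fun u v w => if G.Adj (q u) (q v) ∧ w ≠ u ∧ w ≠ v then (N u v w : ZMod 2) else 0) u v w z := by
      simp only [cpar, kap, if_pos c1, if_pos c2, if_pos c3, if_pos c4, hK]
      push_cast
      have e2 : (2 : ZMod 2) = 0 := by decide
      linear_combination (-1 - (N u v z : ZMod 2) - (N w z u : ZMod 2)) * e2
    have hodd : Odd K ↔ (K : ZMod 2) = 1 := ZMod.intCast_eq_one_iff_odd.symm
    rw [← hc, ← hodd]
    constructor
    · rintro ⟨-, k', hk', e⟩
      rw [ho] at e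
      have : (K : ℂ) = k' := mul_left_cancel₀ hpi e
      have : K = k' := by exact_mod_cast this
      rw [this]; exact hk'
    · intro h
      exact ⟨hI, K, h, ho⟩

open Classical in
/-- the crossing parity, as a number -/
noncomputable def cD {m : ℕ} (q : Fin m → V) (u v w z : Fin m) : ℕ :=
  if OddP D (q u) (q v) (q w) (q z) then 1 else 0

open Classical in
theorem xsys_of_drawing {m : ℕ} (col : Fin m → ℕ) (q : Fin m → V) (hq : Function.Injective q)
    (hc : ∀ i j, col i ≠ col j → G.Adj (q i) (q j)) : XSys col (cD D q) where
  s1 u v w z := by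
    unfold cD
    exact if_congr ⟨OddP.s1 D, OddP.s1 D⟩ rfl rfl
  s2 u v w z := by
    unfold cD
    exact if_congr ⟨OddP.s2 D, OddP.s2 D⟩ rfl rfl
  top k φ hφ := by
    obtain ⟨n, h1, h2⟩ := parity_top D (q ∘ φ) (hq.comp hφ)
    refine ⟨n, h1, fun u v w z a b c d e f => ?_⟩
    have hi := hq.comp hφ
    have := h2 u v w z ⟨hc _ _ e, hc _ _ f, hi.ne a, hi.ne b, hi.ne c, hi.ne d⟩
    unfold cD
    simp only [Function.comp] at this
    by_cases g : cpar n u v w z = 1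
    · rw [if_pos (this.2 g), g]; rfl
    · rw [if_neg (mt this.1 g)]
      have z2 : ∀ x : ZMod 2, x ≠ 1 → 0 = x.val := by decide
      exact z2 _ g

end parity

/-! ### Counting -/

abbrev Quad := Fin 10 × Fin 10 × Fin 10 × Fin 10

def q2L (u v p q : Fin 10) : List Quad := [(u, p, v, q), (u, q, v, p)]

def fL (y : Fin 10) : List Quad :=
  [2, 3, 4, 5].map (fun x => (x, y, 0, 1)) ++ [2, 3, 4, 5].flatMap (fun x => q2L x y 0 1)

def bL (y : Fin 10) : List Quad :=
  [(2, 3), (2, 4), (2, 5), (3, 4), (3, 5), (4, 5)].flatMap fun x : Fin 10 × Fin 10 =>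
    q2L x.1 x.2 0 y ++ q2L x.1 x.2 1 y

def aL (y y' : Fin 10) : List Quad :=
  [(2, 3), (2, 4), (2, 5), (3, 4), (3, 5), (4, 5)].flatMap fun x : Fin 10 × Fin 10 => q2L x.1 x.2 y y'

def cL (y y' : Fin 10) : List Quad :=
  ([2, 3, 4, 5].flatMap fun x => q2L y y' 0 x ++ q2L y y' 1 x) ++ q2L y y' 0 1

def tL : List Quad :=
  aL 0 1 ++ (([6, 7, 8, 9].flatMap fL) ++ ([6, 7, 8, 9].flatMap bL)) ++
    ([(6, 7), (6, 8), (6, 9), (7, 8), (7, 9), (8, 9)].flatMap (fun y : Fin 10 × Fin 10 => aL y.1 y.2) ++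
     [(6, 7), (6, 8), (6, 9), (7, 8), (7, 9), (8, 9)].flatMap (fun y : Fin 10 × Fin 10 => cL y.1 y.2))

def sm (c : Fin 10 → Fin 10 → Fin 10 → Fin 10 → ℕ) (l : List Quad) : ℕ :=
  (l.map fun q => c q.1 q.2.1 q.2.2.1 q.2.2.2).sum

theorem sm_app (c : Fin 10 → Fin 10 → Fin 10 → Fin 10 → ℕ) (l l' : List Quad) :
    sm c (l ++ l') = sm c l + sm c l' := by simp [sm]

theorem sm_nil (c : Fin 10 → Fin 10 → Fin 10 → Fin 10 → ℕ) : sm c [] = 0 := rfl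

theorem sm_q2 (c : Fin 10 → Fin 10 → Fin 10 → Fin 10 → ℕ) (u v p q : Fin 10) :
    sm c (q2L u v p q) = q2 c u v p q := by simp [sm, q2L, q2]

theorem sm_a (c : Fin 10 → Fin 10 → Fin 10 → Fin 10 → ℕ) (y y' : Fin 10) :
    sm c (aL y y') = aS c 2 3 4 5 y y' := by
  simp only [aL, List.flatMap_cons, List.flatMap_nil, sm_app, sm_nil, sm_q2, aS]
  ring

theorem sm_b (c : Fin 10 → Fin 10 → Fin 10 → Fin 10 → ℕ) (y : Fin 10) :
    sm c (bL y) = bS c 0 1 2 3 4 5 y := by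
  simp only [bL, List.flatMap_cons, List.flatMap_nil, sm_app, sm_nil, sm_q2, bS]
  ring

theorem sm_c (c : Fin 10 → Fin 10 → Fin 10 → Fin 10 → ℕ) (y y' : Fin 10) :
    sm c (cL y y') = cS c 0 1 2 3 4 5 y y' := by
  simp only [cL, List.flatMap_cons, List.flatMap_nil, sm_app, sm_nil, sm_q2, cS]
  ring

theorem sm_f (c : Fin 10 → Fin 10 → Fin 10 → Fin 10 → ℕ) (y : Fin 10) :
    sm c (fL y) = fS c 0 1 2 3 4 5 y := by
  rw [fL, sm_app, fS]
  congr 1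
  · simp [sm]
    ring
  · simp only [List.flatMap_cons, List.flatMap_nil, sm_app, sm_nil, sm_q2]
    ring

theorem sm_t (c : Fin 10 → Fin 10 → Fin 10 → Fin 10 → ℕ) : sm c tL = T10 c := by
  simp only [tL, List.flatMap_cons, List.flatMap_nil, sm_app, sm_nil, sm_a, sm_b, sm_c, sm_f, T10]
  ring

/-- the pair of edges of a quadruple -/
def qkey {V : Type*} (q : Fin 10 → V) (x : Quad) : Sym2 (Sym2 V) :=
  s(s(q x.1, q x.2.1), s(q x.2.2.1, q x.2.2.2))

/-- a numerical code, symmetric in the ends of the edges and in the two edges -/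
def qcode (x : Quad) : ℕ :=
  ((2 ^ x.1.val + 2 ^ x.2.1.val) + (2 ^ x.2.2.1.val + 2 ^ x.2.2.2.val)) * 2 ^ 30 +
    (2 ^ x.1.val + 2 ^ x.2.1.val) * (2 ^ x.2.2.1.val + 2 ^ x.2.2.2.val)

theorem tL_nodup : (tL.map qcode).Nodup := by decide +kernel

theorem qcode_of_qkey {V : Type*} {q : Fin 10 → V} (hq : Function.Injective q) {x y : Quad}
    (h : qkey q x = qkey q y) : qcode x = qcode y := by
  obtain ⟨a, b, c, d⟩ := x
  obtain ⟨a', b', c', d'⟩ := y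
  simp only [qkey, Sym2.eq_iff, hq.eq_iff] at h
  unfold qcode
  rcases h with ⟨h1, h2⟩ | ⟨h1, h2⟩ <;> rcases h1 with ⟨rfl, rfl⟩ | ⟨rfl, rfl⟩ <;>
    rcases h2 with ⟨rfl, rfl⟩ | ⟨rfl, rfl⟩ <;> simp only <;> ring

section lower

variable {V : Type*} {G : SimpleGraph V} {D : Drawing G}

theorem crossing_symm {e f : Sym2 V} {p : ℝ × ℝ} (h : D.IsCrossing e f p) : D.IsCrossing f e p :=
  ⟨h.2.1, h.1, h.2.2.1.symm, h.2.2.2.2.1, h.2.2.2.1, h.2.2.2.2.2.2, h.2.2.2.2.2.1⟩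

/-- in a good drawing a crossing is determined by the pair of edges -/
theorem crossings_snd_inj (hD : D.IsGood) :
    Set.InjOn Prod.snd (D.crossings G.edgeSet G.edgeSet) := by
  rintro ⟨p, s⟩ ⟨e, f, h1, -, -, h2⟩ ⟨p', s'⟩ ⟨e', f', h1', -, -, h2'⟩ hs
  simp only at hs h1 h1' h2 h2'
  subst hs
  rw [h1, Sym2.eq_iff] at h1'
  have : D.IsCrossing e f p' := by
    rcases h1' with ⟨rfl, rfl⟩ | ⟨rfl, rfl⟩
    · exact h2'
    · exact crossing_symm h2'
  have := hD.cross_once e f h2 this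
  rw [this]

/-- pairs of edges that cross -/
def crossPairs (D : Drawing G) : Set (Sym2 (Sym2 V)) :=
  {s | ∃ e f p, s = s(e, f) ∧ D.IsCrossing e f p}

theorem snd_image : Prod.snd '' D.crossings G.edgeSet G.edgeSet = crossPairs D := by
  ext s
  constructor
  · rintro ⟨⟨p, s⟩, ⟨e, f, h1, -, -, h2⟩, rfl⟩
    exact ⟨e, f, p, h1, h2⟩
  · rintro ⟨e, f, p, rfl, h⟩
    exact ⟨(p, s(e, f)), ⟨e, f, rfl, h.1, h.2.1, h⟩, rfl⟩

theorem crNum_eq (hD : D.IsGood) : D.crNum = (crossPairs D).ncard := by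
  rw [Drawing.crNum, Drawing.crBetween, Nat.card_coe_set_eq, ← snd_image,
    (crossings_snd_inj hD).ncard_image]

theorem OddP.cross {u v w z : V} (h : OddP D u v w z) : s(s(u, v), s(w, z)) ∈ crossPairs D := by
  obtain ⟨s, hs, t, ht, e⟩ := h.meet
  obtain ⟨h1, h2, h3, h4, h5, h6⟩ := h.1
  refine ⟨_, _, D.arc u v s, rfl, h1, h2, ?_, ⟨u, v, rfl, h1, s, hs, rfl⟩,
    ⟨w, z, rfl, h2, t, ht, e.symm⟩, ?_, ?_⟩
  · intro g
    rw [Sym2.eq_iff] at g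
    rcases g with ⟨g, -⟩ | ⟨g, -⟩
    · exact h3 g
    · exact h4 g
  · rintro ⟨x, hx, g⟩
    rw [Sym2.mem_iff] at hx
    rw [e] at g
    rcases hx with rfl | rfl
    · exact D.arc_avoid h2 _ h3 h4 ⟨t, ht, g⟩
    · exact D.arc_avoid h2 _ h5 h6 ⟨t, ht, g⟩
  · rintro ⟨x, hx, g⟩
    rw [Sym2.mem_iff] at hx
    rcases hx with rfl | rfl
    · exact D.arc_avoid h1 _ h3.symm h5.symm ⟨s, hs, g⟩
    · exact D.arc_avoid h1 _ h4.symm h6.symm ⟨s, hs, g⟩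

theorem sm_le_ncard [Finite V] {q : Fin 10 → V} (hq : Function.Injective q) (l : List Quad)
    (hl : (l.map qcode).Nodup) : sm (cD D q) l ≤ (crossPairs D).ncard := by
  classical
  suffices H : ∀ l : List Quad, (l.map qcode).Nodup → ∃ S : Finset (Sym2 (Sym2 V)),
      (∀ s ∈ S, s ∈ crossPairs D ∧ ∃ x ∈ l, s = qkey q x) ∧ sm (cD D q) l = S.card by
    obtain ⟨S, h1, h2⟩ := H l hl
    rw [h2, ← Set.ncard_coe_finset]
    exact Set.ncard_le_ncard (fun s hs => (h1 s hs).1) (Set.toFinite _)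
  intro l
  induction l with
  | nil => exact fun _ => ⟨∅, by simp, rfl⟩
  | cons x l ih =>
    intro hn
    rw [List.map_cons, List.nodup_cons] at hn
    obtain ⟨S, h1, h2⟩ := ih hn.2
    have hs : sm (cD D q) (x :: l) = cD D q x.1 x.2.1 x.2.2.1 x.2.2.2 + sm (cD D q) l := by simp [sm]
    by_cases ho : OddP D (q x.1) (q x.2.1) (q x.2.2.1) (q x.2.2.2)
    · refine ⟨insert (qkey q x) S, ?_, ?_⟩
      · intro s hs
        rcases Finset.mem_insert.1 hs with rfl | hs
        · exact ⟨ho.cross, x, by simp, rfl⟩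
        · obtain ⟨g1, y, g2, g3⟩ := h1 s hs
          exact ⟨g1, y, List.mem_cons_of_mem _ g2, g3⟩
      · rw [Finset.card_insert_of_notMem, hs, h2, cD, if_pos ho, add_comm]
        intro hx
        obtain ⟨-, y, g2, g3⟩ := h1 _ hx
        exact hn.1 (List.mem_map.2 ⟨y, g2, (qcode_of_qkey hq g3).symm⟩)
    · refine ⟨S, fun s hs => ?_, ?_⟩
      · obtain ⟨g1, y, g2, g3⟩ := h1 s hs
        exact ⟨g1, y, List.mem_cons_of_mem _ g2, g3⟩
      · rw [hs, h2, cD, if_neg ho, zero_add]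

theorem lower [Finite V] (hD : D.IsGood) (q : Fin 10 → V) (hq : Function.Injective q)
    (hc : ∀ i j, col10 i ≠ col10 j → G.Adj (q i) (q j)) : 24 ≤ D.crNum := by
  rw [crNum_eq hD]
  refine (main10 (xsys_of_drawing D col10 q hq hc)).trans ?_
  rw [← sm_t]
  exact sm_le_ncard hq tL tL_nodup

end lower

/-- the vertices of `K_{1,1,4,4}` -/
abbrev VK := Σ i : Fin 4, ![Fin 1, Fin 1, Fin 4, Fin 4] i

def vtx : Fin 10 → VK :=
  ![⟨0, (0 : Fin 1)⟩, ⟨1, (0 : Fin 1)⟩, ⟨2, (0 : Fin 4)⟩, ⟨2, (1 : Fin 4)⟩, ⟨2, (2 : Fin 4)⟩, ⟨2, (3 : Fin 4)⟩,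
    ⟨3, (0 : Fin 4)⟩, ⟨3, (1 : Fin 4)⟩, ⟨3, (2 : Fin 4)⟩, ⟨3, (3 : Fin 4)⟩]

/-- labels -/
def lab : VK → Fin 10
  | ⟨0, _⟩ => 0
  | ⟨1, _⟩ => 1
  | ⟨2, (x : Fin 4)⟩ => ![2, 3, 4, 5] x
  | ⟨3, (x : Fin 4)⟩ => ![6, 7, 8, 9] x

theorem lab_vtx (i : Fin 10) : lab (vtx i) = i := by
  revert i; decide +kernel

theorem vtx_fst (i : Fin 10) : ((vtx i).1 : ℕ) = col10 i := by
  revert i; decide +kernel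

theorem vtx_lab (v : VK) : vtx (lab v) = v := by
  obtain ⟨i, x⟩ := v
  fin_cases i
  · have : x = (0 : Fin 1) := Subsingleton.elim (α := Fin 1) _ _
    subst this; rfl
  · have : x = (0 : Fin 1) := Subsingleton.elim (α := Fin 1) _ _
    subst this; rfl
  · revert x
    change ∀ x : Fin 4, _
    intro x
    fin_cases x <;> rfl
  · revert x
    change ∀ x : Fin 4, _
    intro x
    fin_cases x <;> rfl

def labE : VK ≃ Fin 10 := ⟨lab, vtx, vtx_lab, lab_vtx⟩

theorem adj_iff (v w : VK) : (quadK 1 1 4 4).Adj v w ↔ col10 (lab v) ≠ col10 (lab w) := by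
  rw [← vtx_fst, ← vtx_fst, vtx_lab, vtx_lab]
  change v.1 ≠ w.1 ↔ _
  rw [Ne, Ne, Fin.ext_iff]

theorem lowerK (D : Drawing (quadK 1 1 4 4)) (hD : D.IsGood) : 24 ≤ D.crNum := by
  have : Finite VK := Finite.of_equiv _ labE.symm
  refine lower hD vtx labE.symm.injective fun i j h => ?_
  rw [adj_iff, lab_vtx, lab_vtx]
  exact h

/-! ### A drawing with 24 crossings -/

def PX : Fin 10 → ℤ := ![17, 4, 4, 10, 6, 0, 1, 9, 12, 0]

def PY : Fin 10 → ℤ := ![14, 16, 17, 12, 9, 19, 2, 15, 14, 0]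

/-- orientation of a triple of points -/
def ori (i j k : Fin 10) : ℤ := (PX j - PX i) * (PY k - PY i) - (PY j - PY i) * (PX k - PX i)

theorem ori_ne : ∀ i j k : Fin 10, i ≠ j → i ≠ k → j ≠ k → ori i j k ≠ 0 := by decide +kernel

theorem P_ne : ∀ i j : Fin 10, i ≠ j → PX i ≠ PX j ∨ PY i ≠ PY j := by decide +kernel

/-- the segments cross -/
def tst (e f : Fin 10 × Fin 10) : Prop :=
  ori e.1 e.2 f.1 * ori e.1 e.2 f.2 < 0 ∧ ori f.1 f.2 e.1 * ori f.1 f.2 e.2 < 0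

instance (e f : Fin 10 × Fin 10) : Decidable (tst e f) := by unfold tst; infer_instance

/-- coefficients of the line through two points -/
def lA (e : Fin 10 × Fin 10) : ℤ := -(PY e.2 - PY e.1)

def lB (e : Fin 10 × Fin 10) : ℤ := PX e.2 - PX e.1

def lC (e : Fin 10 × Fin 10) : ℤ := (PY e.2 - PY e.1) * PX e.1 - (PX e.2 - PX e.1) * PY e.1

def det3 (e f g : Fin 10 × Fin 10) : ℤ :=
  lA e * (lB f * lC g - lB g * lC f) - lB e * (lA f * lC g - lA g * lC f) +
    lC e * (lA f * lB g - lA g * lB f)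

def EL : List (Fin 10 × Fin 10) :=
  ((List.finRange 10).product (List.finRange 10)).filter fun e => e.1 < e.2 ∧ col10 e.1 ≠ col10 e.2

def CL : List ((Fin 10 × Fin 10) × (Fin 10 × Fin 10)) :=
  (EL.product EL).filter fun x => x.1.1 < x.2.1 ∧ tst x.1 x.2

theorem CL_length : CL.length = 24 := by decide +kernel

theorem no3 : ∀ e ∈ EL, ∀ f ∈ EL, tst e f → ∀ g ∈ EL, tst f g → tst e g → det3 e f g ≠ 0 := by
  decide +kernel

/-- points as real points -/
def pr (i : Fin 10) : ℝ × ℝ := ((PX i : ℝ), (PY i : ℝ))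

theorem pr_inj : Function.Injective pr := by
  intro i j h
  by_contra hne
  simp only [pr, Prod.mk.injEq, Int.cast_inj] at h
  rcases P_ne i j hne with g | g
  · exact g h.1
  · exact g h.2

/-- straight segments -/
def sg (i j : Fin 10) (t : ℝ) : ℝ × ℝ :=
  ((PX i : ℝ) + t * (PX j - PX i), (PY i : ℝ) + t * (PY j - PY i))

/-- orientation functional -/
def lin (i j : Fin 10) (p : ℝ × ℝ) : ℝ :=
  ((PX j : ℝ) - PX i) * (p.2 - PY i) - ((PY j : ℝ) - PY i) * (p.1 - PX i)

theorem lin_pr (i j k : Fin 10) : lin i j (pr k) = ori i j k := by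
  simp [lin, pr, ori]

theorem lin_sg (i j k l : Fin 10) (t : ℝ) : lin i j (sg k l t) = (1 - t) * ori i j k + t * ori i j l := by
  simp only [lin, sg, ori]
  push_cast
  ring

theorem lin_self (i j : Fin 10) (t : ℝ) : lin i j (sg i j t) = 0 := by
  simp only [lin, sg]
  ring

theorem lin_eq (e : Fin 10 × Fin 10) (p : ℝ × ℝ) : lin e.1 e.2 p = lA e * p.1 + lB e * p.2 + lC e := by
  simp only [lin, lA, lB, lC]
  push_cast
  ring

noncomputable def DK : Drawing (quadK 1 1 4 4) where
  pos v := pr (lab v)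
  pos_inj := pr_inj.comp labE.injective
  arc a b := sg (lab a) (lab b)
  arc_cont a b _ := by
    apply Continuous.continuousOn
    unfold sg
    fun_prop
  arc_zero a b _ := by simp [sg, pr]
  arc_one a b _ := by simp [sg, pr]
  arc_symm a b _ t := by
    simp only [sg, Prod.mk.injEq]
    constructor <;> ring
  arc_avoid a b h c hca hcb := by
    rintro ⟨t, -, e⟩
    have h1 := lin_self (lab a) (lab b) t
    change sg (lab a) (lab b) t = pr (lab c) at e
    rw [e, lin_pr] at h1
    have i := labE.injective
    exact ori_ne _ _ _ (fun g => h.ne (i g)) (fun g => hca (i g).symm) (fun g => hcb (i g).symm)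
      (by exact_mod_cast h1)

/-- a point of an edge -/
def onE (e : Fin 10 × Fin 10) (p : ℝ × ℝ) : Prop := ∃ t ∈ Set.Icc (0 : ℝ) 1, p = sg e.1 e.2 t

theorem sg_rev (i j : Fin 10) (t : ℝ) : sg j i t = sg i j (1 - t) := by
  simp only [sg, Prod.mk.injEq]
  constructor <;> ring

theorem onE_of {a b : VK} {p : ℝ × ℝ} (h : p ∈ DK.edgePoints s(a, b)) : onE (lab a, lab b) p := by
  obtain ⟨x, y, h1, -, t, ht, rfl⟩ := h
  rw [Sym2.eq_iff] at h1
  rcases h1 with ⟨rfl, rfl⟩ | ⟨rfl, rfl⟩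
  · exact ⟨t, ht, rfl⟩
  · exact ⟨1 - t, ⟨by linarith [ht.2], by linarith [ht.1]⟩, sg_rev _ _ _⟩

theorem mem_EL {i j : Fin 10} : (i, j) ∈ EL ↔ i < j ∧ col10 i ≠ col10 j := by
  simp [EL]

theorem edge_rep {e : Sym2 VK} (h : e ∈ (quadK 1 1 4 4).edgeSet) :
    ∃ x ∈ EL, e = s(vtx x.1, vtx x.2) := by
  induction e with
  | h a b =>
    have h' : (quadK 1 1 4 4).Adj a b := h
    rw [adj_iff] at h'
    have hne : lab a ≠ lab b := fun g => h' (by rw [g])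
    rcases lt_or_gt_of_ne hne with g | g
    · exact ⟨(lab a, lab b), mem_EL.2 ⟨g, h'⟩, by rw [vtx_lab, vtx_lab]⟩
    · exact ⟨(lab b, lab a), mem_EL.2 ⟨g, h'.symm⟩, by rw [vtx_lab, vtx_lab, Sym2.eq_swap]⟩

theorem DK_adj (e f : Sym2 VK) (h : ∃ a, a ∈ e ∧ a ∈ f) (p : ℝ × ℝ) : ¬ DK.IsCrossing e f p := by
  rintro ⟨h1, h2, h3, h4, h5, h6, -⟩
  obtain ⟨a, ⟨b, rfl⟩, ⟨d, rfl⟩⟩ := h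
  have hab : (quadK 1 1 4 4).Adj a b := h1
  have had : (quadK 1 1 4 4).Adj a d := h2
  have hbd : b ≠ d := fun g => h3 (by rw [g])
  obtain ⟨s, hs, e1⟩ := onE_of h4
  obtain ⟨t, ht, e2⟩ := onE_of h5
  have i := labE.injective
  have g1 : lin (lab a) (lab b) p = 0 := by rw [e1]; exact lin_self _ _ _
  rw [e2] at g1
  simp only at g1
  rw [lin_sg] at g1
  have g2 : ori (lab a) (lab b) (lab a) = 0 := by unfold ori; ring
  rw [g2] at g1
  have g3 := ori_ne (lab a) (lab b) (lab d) (fun g => hab.ne (i g)) (fun g => had.ne (i g)) (fun g => hbd (i g))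
  have g4 : t = 0 := by
    have : (ori (lab a) (lab b) (lab d) : ℝ) ≠ 0 := by exact_mod_cast g3
    have g5 : t * (ori (lab a) (lab b) (lab d) : ℝ) = 0 := by simpa using g1
    exact (mul_eq_zero.1 g5).resolve_right this
  apply h6
  refine ⟨a, Sym2.mem_mk_left _ _, ?_⟩
  rw [e2, g4]
  simp [sg, DK, pr]

theorem opp {x y : ℤ} {t : ℝ} (hx : x ≠ 0) (hy : y ≠ 0) (h0 : 0 ≤ t) (h1 : t ≤ 1)
    (h : (1 - t) * x + t * y = 0) : x * y < 0 := by
  by_contra hc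
  push Not at hc
  have hc' : 0 < x * y := lt_of_le_of_ne hc (mul_ne_zero hx hy).symm
  rcases pos_and_pos_or_neg_and_neg_of_mul_pos hc' with ⟨a, b⟩ | ⟨a, b⟩
  · have a' : (0 : ℝ) < x := by exact_mod_cast a
    have b' : (0 : ℝ) < y := by exact_mod_cast b
    rcases h0.eq_or_lt with g | g
    · rw [← g] at h; simp at h; exact hx h
    · nlinarith [mul_pos g b', mul_nonneg (sub_nonneg.2 h1) a'.le]
  · have a' : (x : ℝ) < 0 := by exact_mod_cast a
    have b' : (y : ℝ) < 0 := by exact_mod_cast b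
    rcases h0.eq_or_lt with g | g
    · rw [← g] at h; simp at h; exact hx h
    · nlinarith [mul_neg_of_pos_of_neg g b', mul_nonpos_of_nonneg_of_nonpos (sub_nonneg.2 h1) a'.le]

/-- a crossing yields crossing segments -/
theorem DK_tst {x y : Fin 10 × Fin 10} {p : ℝ × ℝ}
    (h : DK.IsCrossing s(vtx x.1, vtx x.2) s(vtx y.1, vtx y.2) p) :
    tst x y ∧ x.1 ≠ y.1 ∧ onE x p ∧ onE y p := by
  have hadj : ∀ a, ¬ (a ∈ s(vtx x.1, vtx x.2) ∧ a ∈ s(vtx y.1, vtx y.2)) :=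
    fun a ha => DK_adj _ _ ⟨a, ha⟩ p h
  obtain ⟨h1, h2, -, h4, h5, -, -⟩ := h
  have n1 : x.1 ≠ y.1 := fun g => hadj (vtx x.1) (by rw [g]; simp)
  have n2 : x.1 ≠ y.2 := fun g => hadj (vtx x.1) (by rw [g]; simp)
  have n3 : x.2 ≠ y.1 := fun g => hadj (vtx x.2) (by rw [g]; simp)
  have n4 : x.2 ≠ y.2 := fun g => hadj (vtx x.2) (by rw [g]; simp)
  have m1 : x.1 ≠ x.2 := fun g => (show (quadK 1 1 4 4).Adj _ _ from h1).ne (by rw [g])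
  have m2 : y.1 ≠ y.2 := fun g => (show (quadK 1 1 4 4).Adj _ _ from h2).ne (by rw [g])
  have o1 := onE_of h4
  have o2 := onE_of h5
  rw [lab_vtx, lab_vtx] at o1 o2
  refine ⟨?_, n1, o1, o2⟩
  obtain ⟨s, hs, e1⟩ := o1
  obtain ⟨t, ht, e2⟩ := o2
  have k1 : lin x.1 x.2 p = 0 := by rw [e1]; exact lin_self _ _ _
  have k2 : lin y.1 y.2 p = 0 := by rw [e2]; exact lin_self _ _ _
  rw [e2] at k1
  rw [e1] at k2
  simp only at k1 k2
  rw [lin_sg] at k1 k2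
  exact ⟨opp (ori_ne _ _ _ m1 n1 n3) (ori_ne _ _ _ m1 n2 n4) ht.1 ht.2 k1,
    opp (ori_ne _ _ _ m2 n1.symm n2.symm) (ori_ne _ _ _ m2 n3.symm n4.symm) hs.1 hs.2 k2⟩

theorem onE_lin {x : Fin 10 × Fin 10} {p : ℝ × ℝ} (h : onE x p) :
    (lA x : ℝ) * p.1 + lB x * p.2 + lC x = 0 := by
  obtain ⟨t, -, rfl⟩ := h
  rw [← lin_eq]
  exact lin_self _ _ _

theorem DK_good : DK.IsGood where
  arc_inj a b h := by
    intro s _ t _ e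
    have hne : lab a ≠ lab b := fun g => h.ne (labE.injective g)
    simp only [DK, sg, Prod.mk.injEq] at e
    rcases P_ne _ _ hne with g | g
    · have g' : (PX (lab b) : ℝ) - PX (lab a) ≠ 0 := sub_ne_zero.2 (by exact_mod_cast g.symm)
      exact mul_right_cancel₀ g' (add_left_cancel e.1)
    · have g' : (PY (lab b) : ℝ) - PY (lab a) ≠ 0 := sub_ne_zero.2 (by exact_mod_cast g.symm)
      exact mul_right_cancel₀ g' (add_left_cancel e.2)
  adj_no_cross := DK_adj
  cross_once e f := by
    intro p hp p' hp'
    have hp : DK.IsCrossing e f p := hp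
    have hp' : DK.IsCrossing e f p' := hp'
    obtain ⟨x, hx, rfl⟩ := edge_rep hp.1
    obtain ⟨y, hy, rfl⟩ := edge_rep hp.2.1
    obtain ⟨t1, -, ⟨s, -, o1⟩, o2⟩ := DK_tst hp
    obtain ⟨-, -, ⟨s', -, o1'⟩, o2'⟩ := DK_tst hp'
    have k := onE_lin o2
    have k' := onE_lin o2'
    rw [← lin_eq, o1, lin_sg] at k
    rw [← lin_eq, o1', lin_sg] at k'
    have hd : (ori y.1 y.2 x.2 : ℝ) - ori y.1 y.2 x.1 ≠ 0 := by
      intro g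
      have g' : ori y.1 y.2 x.2 = ori y.1 y.2 x.1 := by exact_mod_cast sub_eq_zero.1 g
      have := t1.2
      rw [g'] at this
      nlinarith [mul_self_nonneg (ori y.1 y.2 x.1)]
    have : s = s' := mul_right_cancel₀ hd (by linarith)
    rw [o1, o1', this]
  no_triple p e f g _ _ _ := by
    rintro ⟨h1, h2, h3⟩
    obtain ⟨x, hx, rfl⟩ := edge_rep h1.1
    obtain ⟨y, hy, rfl⟩ := edge_rep h1.2.1
    obtain ⟨z, hz, rfl⟩ := edge_rep h2.2.1
    obtain ⟨t1, -, o1, o2⟩ := DK_tst h1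
    obtain ⟨t2, -, -, o3⟩ := DK_tst h2
    obtain ⟨t3, -⟩ := DK_tst h3
    have k1 := onE_lin o1
    have k2 := onE_lin o2
    have k3 := onE_lin o3
    apply no3 x hx y hy t1 z hz t2 t3
    have : (det3 x y z : ℝ) = 0 := by
      unfold det3
      push_cast
      linear_combination ((lA y : ℝ) * lB z - lA z * lB y) * k1 - ((lA x : ℝ) * lB z - lA z * lB x) * k2 +
        ((lA x : ℝ) * lB y - lA y * lB x) * k3
    exact_mod_cast this

theorem DK_le : DK.crNum ≤ 24 := by
  classical
  rw [crNum_eq DK_good]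
  have hsub : crossPairs DK ⊆
      ((CL.map fun x => s(s(vtx x.1.1, vtx x.1.2), s(vtx x.2.1, vtx x.2.2))).toFinset : Set (Sym2 (Sym2 VK))) := by
    rintro s ⟨e, f, p, rfl, h⟩
    obtain ⟨x, hx, rfl⟩ := edge_rep h.1
    obtain ⟨y, hy, rfl⟩ := edge_rep h.2.1
    obtain ⟨t1, hne, -⟩ := DK_tst h
    have t2 : tst y x := ⟨t1.2, t1.1⟩
    rw [Finset.mem_coe, List.mem_toFinset, List.mem_map]
    rcases lt_or_gt_of_ne hne with g | g
    · exact ⟨(x, y), by simp [CL, hx, hy, g, t1], rfl⟩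
    · exact ⟨(y, x), by simp [CL, hx, hy, g, t2], Sym2.eq_swap⟩
  refine (Set.ncard_le_ncard hsub (Finset.finite_toSet _)).trans ?_
  rw [Set.ncard_coe_finset]
  refine (List.toFinset_card_le _).trans ?_
  rw [List.length_map, CL_length]

end K1142

/-- The crossing number of the complete 4-partite graph `K_{1,1,4,4}` is 24. -/
theorem statement8 : crossingNumber (quadK 1 1 4 4) = 24 := by
  have hK : K1142.DK.crNum = 24 := le_antisymm K1142.DK_le (K1142.lowerK _ K1142.DK_good)
  apply le_antisymm
  · exact Nat.sInf_le ⟨K1142.DK, K1142.DK_good, hK⟩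
  · refine le_csInf ⟨24, K1142.DK, K1142.DK_good, hK⟩ ?_
    rintro n ⟨D, hD, rfl⟩
    exact K1142.lowerK D hD
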